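/- Let (u, π, v, θ) be a smooth solution of the stationary 3D tropical climate model. Suppose p ∈ (3/2, 3), q ∈ [2p′, 6], r ∈ [2, 2p′) where p′ = p/(p−1), α ∈ [0, 2/p − 1/3], β ∈ [0, 3/q − 1/2], γ ∈ [0, 3/r − 1/2], and the inequalities α + 2β < 3/p + 6/q − 2, α + ((4p−6)r/((6−r)p))·γ ≤ 1, and β + γ < 3/q + 3/r − 2 hold. Assume that liminf_{R→+∞} ( X_{α,p,R} + Y_{β,q,R} + Z_{γ,r,R} ) < +∞. Then u = 0, v = 0 and θ = 0 identically on ℝ³. -/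

import Mathlib

open MeasureTheory Filter Metric

noncomputable section

abbrev R3 : Type := EuclideanSpace ℝ (Fin 3)

/-- Partial derivative of `f` in the `j`-th coordinate direction. -/
def pd (f : R3 → ℝ) (j : Fin 3) (x : R3) : ℝ :=
  fderiv ℝ f x (EuclideanSpace.single j 1)

/-- Laplacian of `f`. -/
def lap (f : R3 → ℝ) (x : R3) : ℝ := ∑ j, pd (pd f j) j x

/-- The stationary 3D tropical climate model:
`-Δu + (u·∇)u + ∇π + div(v⊗v) = 0`, `-Δv + (u·∇)v + ∇θ + (v·∇)u = 0`,
`-Δθ + u·∇θ + div v = 0`, `div u = 0`. -/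
def TCM (u v : R3 → R3) (pr θ : R3 → ℝ) : Prop :=
  (∀ i x, -lap (fun y => u y i) x + (∑ j, u x j * pd (fun y => u y i) j x)
      + pd pr i x + (∑ j, pd (fun y => v y j * v y i) j x) = 0) ∧
  (∀ i x, -lap (fun y => v y i) x + (∑ j, u x j * pd (fun y => v y i) j x)
      + pd θ i x + (∑ j, v x j * pd (fun y => u y i) j x) = 0) ∧
  (∀ x, -lap θ x + (∑ j, u x j * pd θ j x) + (∑ j, pd (fun y => v y j) j x) = 0) ∧
  (∀ x, (∑ j, pd (fun y => u y j) j x) = 0)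

/-- The annulus `B_{2R} \ B_R`. -/
def annulus (R : ℝ) : Set R3 := ball (0 : R3) (2 * R) \ ball 0 R

/-- `L^p` norm of a scalar function on a set `E`. -/
def lpS (g : R3 → ℝ) (p : ℝ) (E : Set R3) : ℝ := (∫ x in E, |g x| ^ p) ^ (1 / p)

/-- `X_{α,p,R} = R^{-α} ‖f‖_{L^p(B_{2R} \ B_R)}` for a vector field `f`. -/
def XnV (f : R3 → R3) (a p R : ℝ) : ℝ := R ^ (-a) * lpS (fun x => ‖f x‖) p (annulus R)

/-- `X_{α,p,R} = R^{-α} ‖f‖_{L^p(B_{2R} \ B_R)}` for a scalar function `f`. -/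
def XnS (f : R3 → ℝ) (a p R : ℝ) : ℝ := R ^ (-a) * lpS f p (annulus R)


abbrev sh (R τ : ℝ) : Set R3 := ball (0 : R3) τ \ ball 0 R

lemma sh_meas (R τ : ℝ) : MeasurableSet (sh R τ) := measurableSet_ball.diff measurableSet_ball

lemma sh_bdd (R τ : ℝ) : Bornology.IsBounded (sh R τ) := isBounded_ball.subset Set.sdiff_subset

lemma integrableOn_cont {f : R3 → ℝ} (hf : Continuous f) {E : Set R3}
    (hb : Bornology.IsBounded E) : IntegrableOn f E := by
  have hc : IsCompact (closure E) := hb.isCompact_closure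
  exact (hf.continuousOn.integrableOn_compact hc).mono_set subset_closure

lemma lpS_nonneg (f : R3 → ℝ) (p : ℝ) (E : Set R3) : 0 ≤ lpS f p E :=
  Real.rpow_nonneg (integral_nonneg fun x => Real.rpow_nonneg (abs_nonneg _) _) _

lemma cont_abs_rpow {f : R3 → ℝ} (hf : Continuous f) {p : ℝ} (hp : 0 ≤ p) :
    Continuous fun x => |f x| ^ p := hf.abs.rpow_const fun _ => Or.inr hp

lemma lint_eq {f : R3 → ℝ} (hf : Continuous f) {p : ℝ} (hp : 0 ≤ p) {E : Set R3}
    (hb : Bornology.IsBounded E) :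
    ∫⁻ x in E, ‖f x‖ₑ ^ p = ENNReal.ofReal (∫ x in E, |f x| ^ p) := by
  rw [ofReal_integral_eq_lintegral_ofReal (integrableOn_cont (cont_abs_rpow hf hp) hb)
    (Eventually.of_forall fun x => Real.rpow_nonneg (abs_nonneg _) _)]
  refine lintegral_congr fun x => ?_
  rw [← ENNReal.ofReal_rpow_of_nonneg (abs_nonneg _) hp, Real.enorm_eq_ofReal_abs]

lemma ofReal_lpS {f : R3 → ℝ} (hf : Continuous f) {p : ℝ} (hp : 0 < p) {E : Set R3}
    (hb : Bornology.IsBounded E) :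
    ENNReal.ofReal (lpS f p E) = (∫⁻ x in E, ‖f x‖ₑ ^ p) ^ (1 / p) := by
  rw [lint_eq hf hp.le hb, lpS, ENNReal.ofReal_rpow_of_nonneg _ (by positivity)]
  exact integral_nonneg fun x => Real.rpow_nonneg (abs_nonneg _) _

lemma lpS_rpow {f : R3 → ℝ} {p : ℝ} (hp : 0 < p) (E : Set R3) :
    lpS f p E ^ p = ∫ x in E, |f x| ^ p := by
  rw [lpS, ← Real.rpow_mul (integral_nonneg fun x => Real.rpow_nonneg (abs_nonneg _) _)]
  rw [one_div_mul_cancel hp.ne', Real.rpow_one]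

lemma lpS_mono_set {f : R3 → ℝ} (hf : Continuous f) {p : ℝ} (hp : 0 < p) {E E' : Set R3}
    (hb : Bornology.IsBounded E') (h : E ⊆ E') : lpS f p E ≤ lpS f p E' := by
  unfold lpS
  refine Real.rpow_le_rpow (integral_nonneg fun x => Real.rpow_nonneg (abs_nonneg _) _) ?_
    (by positivity)
  exact setIntegral_mono_set (integrableOn_cont (cont_abs_rpow hf hp.le) hb)
    (Eventually.of_forall fun x => Real.rpow_nonneg (abs_nonneg _) _)
    (LE.le.eventuallyLE h)

lemma lpS_mono {f g : R3 → ℝ} (hf : Continuous f) (hg : Continuous g) {p : ℝ} (hp : 0 < p)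
    {E : Set R3} (hE : MeasurableSet E)
    (hb : Bornology.IsBounded E) (h : ∀ x ∈ E, |f x| ≤ |g x|) : lpS f p E ≤ lpS g p E := by
  unfold lpS
  refine Real.rpow_le_rpow (integral_nonneg fun x => Real.rpow_nonneg (abs_nonneg _) _) ?_
    (by positivity)
  exact setIntegral_mono_on (integrableOn_cont (cont_abs_rpow hf hp.le) hb)
    (integrableOn_cont (cont_abs_rpow hg hp.le) hb) hE
    fun x hx => Real.rpow_le_rpow (abs_nonneg _) (h x hx) hp.le

/-- Hölder -/
lemma holder2 {f g : R3 → ℝ} (hf : Continuous f) (hg : Continuous g) {a b : ℝ}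
    (hab : a.HolderConjugate b) {E : Set R3} (hb : Bornology.IsBounded E) :
    ∫ x in E, |f x| * |g x| ≤ lpS f a E * lpS g b E := by
  have h := ENNReal.lintegral_mul_le_Lp_mul_Lq (volume.restrict E) hab
    (f := fun x => ‖f x‖ₑ) (g := fun x => ‖g x‖ₑ) hf.enorm.measurable.aemeasurable
    hg.enorm.measurable.aemeasurable
  rw [← ofReal_lpS hf hab.pos hb, ← ofReal_lpS hg hab.symm.pos hb,
    ← ENNReal.ofReal_mul (lpS_nonneg _ _ _)] at h
  rw [← ENNReal.ofReal_le_ofReal_iff (mul_nonneg (lpS_nonneg _ _ _) (lpS_nonneg _ _ _))]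
  rw [ofReal_integral_eq_lintegral_ofReal
    (f := fun x => |f x| * |g x|) (integrableOn_cont (hf.abs.mul hg.abs) hb)
    (Eventually.of_forall fun x => mul_nonneg (abs_nonneg _) (abs_nonneg _))]
  refine le_trans (le_of_eq ?_) h
  refine lintegral_congr fun x => ?_
  simp [ENNReal.ofReal_mul, Real.enorm_eq_ofReal_abs]

/-- interpolation -/
lemma lpS_interp {f : R3 → ℝ} (hf : Continuous f) {a b s l : ℝ} (ha : 0 < a) (hb' : 0 < b)
    (hs : 0 < s) (hl0 : 0 ≤ l) (hl1 : l ≤ 1) (hsl : 1 / s = (1 - l) / a + l / b)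
    {E : Set R3} (hb : Bornology.IsBounded E) :
    lpS f s E ≤ lpS f a E ^ (1 - l) * lpS f b E ^ l := by
  have h := ENNReal.lintegral_mul_norm_pow_le (μ := volume.restrict E)
    (f := fun x => ‖f x‖ₑ ^ a) (g := fun x => ‖f x‖ₑ ^ b)
    (by exact (hf.enorm.measurable.pow_const _).aemeasurable)
    (by exact (hf.enorm.measurable.pow_const _).aemeasurable)
    (p := s * (1 - l) / a) (q := s * l / b)
    (by have : 0 ≤ 1 - l := by linarith
        positivity) (by positivity)
    (by have : s * (1 / s) = 1 := by field_simp
        rw [hsl] at this; linear_combination this)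
  have e : ∀ x, (‖f x‖ₑ ^ a) ^ (s * (1 - l) / a) * (‖f x‖ₑ ^ b) ^ (s * l / b) = ‖f x‖ₑ ^ s := by
    intro x
    rw [← ENNReal.rpow_mul, ← ENNReal.rpow_mul, ← ENNReal.rpow_add_of_nonneg]
    · congr 1; field_simp; ring
    · have : 0 ≤ 1 - l := by linarith
      positivity
    · positivity
  simp only [e] at h
  rw [← ENNReal.ofReal_le_ofReal_iff (mul_nonneg (Real.rpow_nonneg (lpS_nonneg _ _ _) _)
    (Real.rpow_nonneg (lpS_nonneg _ _ _) _)), ENNReal.ofReal_mul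
    (Real.rpow_nonneg (lpS_nonneg _ _ _) _), ← ENNReal.ofReal_rpow_of_nonneg (lpS_nonneg _ _ _)
    (by linarith), ← ENNReal.ofReal_rpow_of_nonneg (lpS_nonneg _ _ _) hl0,
    ofReal_lpS hf ha hb, ofReal_lpS hf hb' hb, ofReal_lpS hf hs hb]
  calc _ ≤ _ := ENNReal.rpow_le_rpow h (by positivity : 0 ≤ 1 / s)
    _ = _ := by
      rw [ENNReal.mul_rpow_of_nonneg _ _ (by positivity)]
      simp only [← ENNReal.rpow_mul]
      congr 2 <;> field_simp

/-- lowering the exponent -/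
lemma lpS_lower {f : R3 → ℝ} (hf : Continuous f) {a s : ℝ} (hs : 0 < s) (hsa : s ≤ a)
    {E : Set R3} (hb : Bornology.IsBounded E) :
    lpS f s E ≤ (volume.real E) ^ (1 / s - 1 / a) * lpS f a E := by
  have ha : 0 < a := hs.trans_le hsa
  have h := ENNReal.lintegral_mul_norm_pow_le (μ := volume.restrict E)
    (f := fun x => ‖f x‖ₑ ^ a) (g := fun x => 1)
    (by exact (hf.enorm.measurable.pow_const _).aemeasurable)
    aemeasurable_const
    (p := s / a) (q := 1 - s / a)
    (by positivity) (by rw [sub_nonneg, div_le_one ha]; exact hsa) (by ring)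
  have e : ∀ x, (‖f x‖ₑ ^ a) ^ (s / a) * 1 ^ (1 - s / a) = ‖f x‖ₑ ^ s := by
    intro x
    rw [← ENNReal.rpow_mul, ENNReal.one_rpow, mul_one]
    congr 1; field_simp
  simp only [e] at h
  have hfin : volume E ≠ ⊤ := hb.measure_lt_top.ne
  have hE : 0 ≤ 1 / s - 1 / a := sub_nonneg.2 (one_div_le_one_div_of_le hs hsa)
  rw [← ENNReal.ofReal_le_ofReal_iff (mul_nonneg (by positivity) (lpS_nonneg _ _ _)),
    ENNReal.ofReal_mul (by positivity), ← ENNReal.ofReal_rpow_of_nonneg (by positivity) hE,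
    ofReal_lpS hf hs hb, ofReal_lpS hf ha hb, ofReal_measureReal hfin]
  calc _ ≤ _ := ENNReal.rpow_le_rpow h (by positivity : 0 ≤ 1 / s)
    _ = _ := by
      rw [ENNReal.mul_rpow_of_nonneg _ _ (by positivity)]
      simp only [← ENNReal.rpow_mul, lintegral_one, Measure.restrict_apply_univ]
      rw [mul_comm]
      congr 2 <;> field_simp


lemma lint_smul (f : R3 → ENNReal) (hf : Measurable f) (s : ℝ) (hs : 0 < s) (x : R3) :
    ∫⁻ z, f (x - s • z) = ENNReal.ofReal (s ^ (-3 : ℝ)) * ∫⁻ z, f z := by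
  have h1 : ∫⁻ z : R3, f (x - z) = ∫⁻ z, f z := lintegral_sub_left_eq_self f x
  rw [← h1]
  have h2 : Measurable fun z : R3 => s • z := measurable_const_smul s
  have := lintegral_map (μ := (volume : Measure R3)) (f := fun z => f (x - z)) (g := fun z => s • z)
    (hf.comp (measurable_const.sub measurable_id)) h2
  rw [← this, Measure.map_addHaar_smul _ hs.ne', lintegral_smul_measure]
  simp only [finrank_euclideanSpace, Fintype.card_fin, smul_eq_mul]
  congr 2
  rw [abs_of_pos (by positivity), Real.rpow_neg hs.le]
  norm_cast

lemma young_enn (H F : R3 → ENNReal) (hH : Measurable H) (hF : Measurable F) (s : ℝ) (hs : 0 < s)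
    (a c t : ℝ) (ha : 1 ≤ a) (hc : 1 ≤ c) (ht : t = 1 / a + 1 / c - 1) (ht0 : 0 ≤ t) :
    ∫⁻ z in closedBall (0 : R3) 1, ∫⁻ x, H x * F (x - s • z) ≤
      volume (closedBall (0 : R3) 1) ^ (1 - t) * ENNReal.ofReal (s ^ (-3 : ℝ)) ^ t *
        ((∫⁻ x, H x ^ c) ^ (1 / c) * (∫⁻ x, F x ^ a) ^ (1 / a)) := by
  set B := closedBall (0 : R3) 1
  set μ : Measure (R3 × R3) := (volume.restrict B).prod volume
  have mF : Measurable fun p : R3 × R3 => F (p.2 - s • p.1) :=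
    hF.comp (by fun_prop)
  have mH : Measurable fun p : R3 × R3 => H p.2 := hH.comp measurable_snd
  have ha1 : 1 / a ≤ 1 := by rw [div_le_one (by linarith)]; exact ha
  have hc1 : 1 / c ≤ 1 := by rw [div_le_one (by linarith)]; exact hc
  have hia : 0 < 1 / a := by positivity
  have hic : 0 < 1 / c := by positivity
  have ha0 : a ≠ 0 := by linarith
  have hc0 : c ≠ 0 := by linarith
  let f : Fin 3 → R3 × R3 → ENNReal :=
    ![fun p => F (p.2 - s • p.1) ^ a, fun p => H p.2 ^ c,
      fun p => F (p.2 - s • p.1) ^ a * H p.2 ^ c]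
  let w : Fin 3 → ℝ := ![1 - 1 / c, 1 - 1 / a, t]
  have hold := ENNReal.lintegral_prod_norm_pow_le (μ := μ) Finset.univ (f := f)
    (p := w)
    (by
      intro i _
      fin_cases i
      · exact (mF.pow_const _).aemeasurable
      · exact (mH.pow_const _).aemeasurable
      · exact ((mF.pow_const _).mul (mH.pow_const _)).aemeasurable)
    (by simp [w, Fin.sum_univ_three, ht]; ring)
    (by
      intro i _
      fin_cases i
      · simp [w]; simpa using hc1
      · simp [w]; simpa using ha1
      · simpa [w] using ht0)
  simp only [Fin.prod_univ_three] at hold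
  have e1 : ∀ p : R3 × R3, f 0 p ^ w 0 * f 1 p ^ w 1 * f 2 p ^ w 2 = H p.2 * F (p.2 - s • p.1) := by
    intro p
    simp only [f, w, Matrix.cons_val]
    generalize F (p.2 - s • p.1) = X
    generalize H p.2 = Y
    rw [ENNReal.mul_rpow_of_nonneg _ _ ht0]
    simp only [← ENNReal.rpow_mul]
    have : X ^ (a * (1 - 1 / c)) * X ^ (a * t) = X := by
      rw [← ENNReal.rpow_add_of_nonneg]
      · rw [ht]
        convert ENNReal.rpow_one X using 2
        field_simp; ring
      · exact mul_nonneg (by linarith) (by linarith)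
      · exact mul_nonneg (by linarith) (by linarith)
    have h2 : Y ^ (c * (1 - 1 / a)) * Y ^ (c * t) = Y := by
      rw [← ENNReal.rpow_add_of_nonneg]
      · rw [ht]
        convert ENNReal.rpow_one Y using 2
        field_simp; ring
      · exact mul_nonneg (by linarith) (by linarith)
      · exact mul_nonneg (by linarith) (by linarith)
    calc _ = (X ^ (a * (1 - 1 / c)) * X ^ (a * t)) * (Y ^ (c * (1 - 1 / a)) * Y ^ (c * t)) := by ring
      _ = _ := by rw [this, h2, mul_comm]
  simp only [e1] at hold
  have i0 : ∫⁻ p, f 0 p ∂μ = volume B * ∫⁻ x, F x ^ a := by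
    simp only [f, Matrix.cons_val]
    rw [lintegral_prod _ (mF.pow_const _).aemeasurable]
    have : ∀ z : R3, ∫⁻ y : R3, F (y - s • z) ^ a = ∫⁻ x, F x ^ a := fun z =>
      lintegral_sub_right_eq_self (fun x => F x ^ a) (s • z)
    simp only [this, lintegral_const, Measure.restrict_apply_univ]
    rw [mul_comm]
  have i1 : ∫⁻ p, f 1 p ∂μ = volume B * ∫⁻ x, H x ^ c := by
    simp only [f, Matrix.cons_val]
    rw [lintegral_prod _ (mH.pow_const _).aemeasurable]
    simp only [lintegral_const, Measure.restrict_apply_univ]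
    rw [mul_comm]
  have i2 : ∫⁻ p, f 2 p ∂μ ≤ ENNReal.ofReal (s ^ (-3 : ℝ)) *
      ((∫⁻ x, F x ^ a) * ∫⁻ x, H x ^ c) := by
    simp only [f, Matrix.cons_val]
    have m2 : Measurable fun p : R3 × R3 => F (p.2 - s • p.1) ^ a * H p.2 ^ c :=
      (mF.pow_const _).mul (mH.pow_const _)
    rw [lintegral_prod_symm _ m2.aemeasurable]
    calc ∫⁻ x, ∫⁻ z in B, F (x - s • z) ^ a * H x ^ c
        ≤ ∫⁻ x, ∫⁻ z, F (x - s • z) ^ a * H x ^ c :=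
          lintegral_mono fun x => setLIntegral_le_lintegral _ _
      _ = ∫⁻ x, (ENNReal.ofReal (s ^ (-3 : ℝ)) * ∫⁻ z, F z ^ a) * H x ^ c := by
          refine lintegral_congr fun x => ?_
          have m4 : Measurable fun z : R3 => F (x - s • z) ^ a :=
            (hF.comp (by fun_prop)).pow_const _
          rw [lintegral_mul_const _ m4,
            lint_smul (fun z => F z ^ a) (hF.pow_const _) s hs]
      _ = _ := by
          rw [lintegral_const_mul _ (hH.pow_const _), mul_assoc]
  have m3 : Measurable fun p : R3 × R3 => H p.2 * F (p.2 - s • p.1) := mH.mul mF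
  rw [lintegral_prod _ m3.aemeasurable] at hold
  refine hold.trans ?_
  rw [i0, i1]
  simp only [w, Matrix.cons_val]
  set IF := ∫⁻ x, F x ^ a
  set IH := ∫⁻ x, H x ^ c
  refine (mul_le_mul_right (ENNReal.rpow_le_rpow i2 ht0) _).trans (le_of_eq ?_)
  rw [ENNReal.mul_rpow_of_nonneg _ _ (by linarith : 0 ≤ 1 - 1 / c),
    ENNReal.mul_rpow_of_nonneg _ _ (by linarith : 0 ≤ 1 - 1 / a),
    ENNReal.mul_rpow_of_nonneg _ _ ht0, ENNReal.mul_rpow_of_nonneg _ _ ht0]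
  have r1 : volume B ^ (1 - 1 / c) * volume B ^ (1 - 1 / a) = volume B ^ (1 - t) := by
    rw [← ENNReal.rpow_add_of_nonneg _ _ (by linarith) (by linarith)]
    congr 1; rw [ht]; ring
  have r2 : IF ^ (1 - 1 / c) * IF ^ t = IF ^ (1 / a) := by
    rw [← ENNReal.rpow_add_of_nonneg _ _ (by linarith) (by linarith)]
    congr 1; rw [ht]; ring
  have r3 : IH ^ (1 - 1 / a) * IH ^ t = IH ^ (1 / c) := by
    rw [← ENNReal.rpow_add_of_nonneg _ _ (by linarith) (by linarith)]
    congr 1; rw [ht]; ring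
  rw [← r1, ← r2, ← r3]
  ring

/-- real Young inequality -/
lemma young_real {h k f : R3 → ℝ} (hh : Continuous h) (hf : Continuous f) {C : ℝ}
    (hkC : ∀ z, |k z| ≤ C) (hk0 : ∀ z, z ∉ closedBall (0 : R3) 1 → k z = 0)
    {S D : Set R3} (hD : MeasurableSet D) (hDb : Bornology.IsBounded D) {s : ℝ} (hs : 0 < s)
    (hS : ∀ x, x ∉ S → h x = 0) (hSD : S ⊆ D)
    (hSz : ∀ x ∈ S, ∀ z ∈ closedBall (0 : R3) 1, x - s • z ∈ D)
    {a c t : ℝ} (ha : 1 ≤ a) (hc : 1 ≤ c) (ht : t = 1 / a + 1 / c - 1) (ht0 : 0 ≤ t) :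
    |∫ z, ∫ x, h x * k z * f (x - s • z)| ≤
      C * volume.real (closedBall (0 : R3) 1) ^ (1 - t) * s ^ (-3 * t) * 
        (lpS h c D * lpS f a D) := by
  have hC : 0 ≤ C := (abs_nonneg _).trans (hkC 0)
  have ht1 : 0 ≤ 1 - t := by
    have ha1 : 1 / a ≤ 1 := by rw [div_le_one (by linarith)]; exact ha
    have hc1 : 1 / c ≤ 1 := by rw [div_le_one (by linarith)]; exact hc
    linarith
  set B := closedBall (0 : R3) 1
  let H : R3 → ENNReal := D.indicator fun x => ‖h x‖ₑ
  let F : R3 → ENNReal := D.indicator fun x => ‖f x‖ₑ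
  have mH : Measurable H := hh.enorm.measurable.indicator hD
  have mF : Measurable F := hf.enorm.measurable.indicator hD
  have key := young_enn H F mH mF s hs a c t ha hc ht ht0
  have pw : ∀ z x, ‖h x * k z * f (x - s • z)‖ₑ ≤
      B.indicator (fun z => ENNReal.ofReal C * (H x * F (x - s • z))) z := by
    intro z x
    by_cases hz : z ∈ B
    · by_cases hx : x ∈ S
      · have h1 := hSD hx
        have h2 := hSz x hx z hz
        simp only [H, F, Set.indicator_of_mem hz, Set.indicator_of_mem h1, Set.indicator_of_mem h2]
        rw [enorm_mul, enorm_mul]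
        have : ‖k z‖ₑ ≤ ENNReal.ofReal C := by
          rw [Real.enorm_eq_ofReal_abs]; exact ENNReal.ofReal_le_ofReal (hkC z)
        calc _ = ‖k z‖ₑ * (‖h x‖ₑ * ‖f (x - s • z)‖ₑ) := by ring
          _ ≤ _ := by gcongr
      · simp [hS x hx]
    · simp [hk0 z hz]
  have iH : ∫⁻ x, H x ^ c = ∫⁻ x in D, ‖h x‖ₑ ^ c := by
    rw [← lintegral_indicator hD]
    refine lintegral_congr fun x => ?_
    by_cases hx : x ∈ D <;> simp [H, hx]
    linarith
  have iF : ∫⁻ x, F x ^ a = ∫⁻ x in D, ‖f x‖ₑ ^ a := by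
    rw [← lintegral_indicator hD]
    refine lintegral_congr fun x => ?_
    by_cases hx : x ∈ D <;> simp [F, hx]
    linarith
  rw [iH, iF, ← ofReal_lpS hh (by linarith) hDb, ← ofReal_lpS hf (by linarith) hDb] at key
  have hR : 0 ≤ C * volume.real B ^ (1 - t) * s ^ (-3 * t) * (lpS h c D * lpS f a D) := by
    have := lpS_nonneg h c D
    have := lpS_nonneg f a D
    positivity
  rw [← ENNReal.ofReal_le_ofReal_iff hR, ← Real.enorm_eq_ofReal_abs]
  calc ‖∫ z, ∫ x, h x * k z * f (x - s • z)‖ₑ ≤ ∫⁻ z, ‖∫ x, h x * k z * f (x - s • z)‖ₑ :=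
        enorm_integral_le_lintegral_enorm _
    _ ≤ ∫⁻ z, ∫⁻ x, ‖h x * k z * f (x - s • z)‖ₑ :=
        lintegral_mono fun z => enorm_integral_le_lintegral_enorm _
    _ ≤ ∫⁻ z, B.indicator (fun z => ENNReal.ofReal C * ∫⁻ x, H x * F (x - s • z)) z := by
        refine lintegral_mono fun z => ?_
        refine (lintegral_mono (pw z)).trans ?_
        by_cases hz : z ∈ B
        · simp only [Set.indicator_of_mem hz]
          rw [lintegral_const_mul]
          exact mH.mul (mF.comp (by fun_prop))
        · simp [hz]
    _ = ENNReal.ofReal C * ∫⁻ z in B, ∫⁻ x, H x * F (x - s • z) := by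
        rw [lintegral_indicator measurableSet_closedBall, lintegral_const_mul]
        apply Measurable.lintegral_prod_right'
          (f := fun p : R3 × R3 => H p.2 * F (p.2 - s • p.1))
        exact (mH.comp measurable_snd).mul (mF.comp (by fun_prop))
    _ ≤ _ := mul_le_mul_right key _
    _ = _ := by
        have hB : volume B ≠ ⊤ := measure_closedBall_lt_top.ne
        rw [← ofReal_measureReal hB, ENNReal.ofReal_rpow_of_nonneg (by positivity) ht1,
          ENNReal.ofReal_rpow_of_nonneg (by positivity) ht0,
          ← ENNReal.ofReal_mul (lpS_nonneg _ _ _), ← ENNReal.ofReal_mul (by positivity),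
          ← ENNReal.ofReal_mul (by positivity), ← ENNReal.ofReal_mul hC, ← Real.rpow_mul hs.le]
        congr 1; ring


lemma pd_smooth {f : R3 → ℝ} (hf : ContDiff ℝ (⊤ : ℕ∞) f) (j : Fin 3) :
    ContDiff ℝ (⊤ : ℕ∞) (pd f j) := by
  unfold pd
  exact (hf.fderiv_right (m := (⊤ : ℕ∞)) (by simp)).clm_apply contDiff_const

lemma smooth_diff {f : R3 → ℝ} (hf : ContDiff ℝ (⊤ : ℕ∞) f) : Differentiable ℝ f :=
  hf.differentiable (by simp)

lemma comp_smooth {u : R3 → R3} (hu : ContDiff ℝ (⊤ : ℕ∞) u) (i : Fin 3) :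
    ContDiff ℝ (⊤ : ℕ∞) (fun y => u y i) := by
  exact contDiff_euclidean.1 hu i

lemma pd_add' {f g : R3 → ℝ} (hf : Differentiable ℝ f) (hg : Differentiable ℝ g) (j : Fin 3)
    (x : R3) : pd (fun y => f y + g y) j x = pd f j x + pd g j x := by
  unfold pd
  rw [fderiv_fun_add (hf x) (hg x)]; simp

lemma pd_sub' {f g : R3 → ℝ} (hf : Differentiable ℝ f) (hg : Differentiable ℝ g) (j : Fin 3)
    (x : R3) : pd (fun y => f y - g y) j x = pd f j x - pd g j x := by
  unfold pd
  rw [fderiv_fun_sub (hf x) (hg x)]; simp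

lemma pd_mul' {f g : R3 → ℝ} (hf : Differentiable ℝ f) (hg : Differentiable ℝ g) (j : Fin 3)
    (x : R3) : pd (fun y => f y * g y) j x = pd f j x * g x + f x * pd g j x := by
  unfold pd
  rw [fderiv_fun_mul (hf x) (hg x)]; simp; ring

lemma pd_const' (c : ℝ) (j : Fin 3) (x : R3) : pd (fun _ => c) j x = 0 := by
  unfold pd
  simp

lemma pd_supp {f : R3 → ℝ} (hf : HasCompactSupport f) (j : Fin 3) :
    HasCompactSupport (pd f j) := by
  have := hf.fderiv (𝕜 := ℝ)
  exact this.comp_left (g := fun L : R3 →L[ℝ] ℝ => L (EuclideanSpace.single j 1)) rfl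

lemma ibp {f g : R3 → ℝ} (hf : ContDiff ℝ (⊤ : ℕ∞) f) (hg : ContDiff ℝ (⊤ : ℕ∞) g)
    (hc : HasCompactSupport g) (j : Fin 3) :
    ∫ x, g x * pd f j x = - ∫ x, pd g j x * f x := by
  unfold pd
  apply integral_mul_fderiv_eq_neg_fderiv_mul_of_integrable
  · exact (((pd_smooth hg j).continuous.mul hf.continuous)).integrable_of_hasCompactSupport
      ((pd_supp hc j).mul_right)
  · exact ((hg.continuous.mul (pd_smooth hf j).continuous)).integrable_of_hasCompactSupport
      (hc.mul_right)
  · exact (hg.continuous.mul hf.continuous).integrable_of_hasCompactSupport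
      (hc.mul_right)
  · exact fun x _ => smooth_diff hg x
  · exact fun x _ => smooth_diff hf x

/-- the flux -/
def flux (u v : R3 → R3) (pr θ : R3 → ℝ) (j : Fin 3) (x : R3) : ℝ :=
  (∑ i, u x i * pd (fun y => u y i) j x) + (∑ i, v x i * pd (fun y => v y i) j x)
    + θ x * pd θ j x
    - (2⁻¹ * ((∑ i, u x i * u x i) + (∑ i, v x i * v x i) + θ x * θ x) + pr x) * u x j
    - (∑ i, u x i * v x i) * v x j - θ x * v x j

def grads (u v : R3 → R3) (θ : R3 → ℝ) (x : R3) : ℝ :=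
  (∑ i, ∑ j, pd (fun y => u y i) j x ^ 2) + (∑ i, ∑ j, pd (fun y => v y i) j x ^ 2)
    + ∑ j, pd θ j x ^ 2

lemma flux_smooth {u v : R3 → R3} {pr θ : R3 → ℝ}
    (hu : ContDiff ℝ (⊤ : ℕ∞) u) (hv : ContDiff ℝ (⊤ : ℕ∞) v)
    (hpr : ContDiff ℝ (⊤ : ℕ∞) pr) (hθ : ContDiff ℝ (⊤ : ℕ∞) θ) (j : Fin 3) :
    ContDiff ℝ (⊤ : ℕ∞) (flux u v pr θ j) := by
  have hui := comp_smooth hu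
  have hvi := comp_smooth hv
  have h1 := fun i => pd_smooth (hui i) j
  have h2 := fun i => pd_smooth (hvi i) j
  have h3 := pd_smooth hθ j
  unfold flux
  fun_prop

lemma div_flux {u v : R3 → R3} {pr θ : R3 → ℝ}
    (hu : ContDiff ℝ (⊤ : ℕ∞) u) (hv : ContDiff ℝ (⊤ : ℕ∞) v)
    (hpr : ContDiff ℝ (⊤ : ℕ∞) pr) (hθ : ContDiff ℝ (⊤ : ℕ∞) θ)
    (hsol : TCM u v pr θ) (x : R3) :
    ∑ j, pd (flux u v pr θ j) j x = grads u v θ x := by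
  obtain ⟨e1, e2, e3, e4⟩ := hsol
  have d1 := fun i => smooth_diff (comp_smooth hu i)
  have d2 := fun i => smooth_diff (comp_smooth hv i)
  have d3 := smooth_diff hθ
  have d4 := smooth_diff hpr
  have d5 := fun i j => smooth_diff (pd_smooth (comp_smooth hu i) j)
  have d6 := fun i j => smooth_diff (pd_smooth (comp_smooth hv i) j)
  have d7 := fun j => smooth_diff (pd_smooth hθ j)
  have e1' := fun i => e1 i x
  have e2' := fun i => e2 i x
  have e3' := e3 x
  have e4' := e4 x
  unfold flux grads
  unfold lap at e1' e2' e3'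
  have a0 := e1' 0
  have a1 := e1' 1
  have a2 := e1' 2
  have b0 := e2' 0
  have b1 := e2' 1
  have b2 := e2' 2
  clear e1 e2 e3 e4 e1' e2'
  simp only [Fin.sum_univ_three] at *
  simp (disch := fun_prop) only [pd_add', pd_sub', pd_mul', pd_const'] at *
  linear_combination (-u x 0) * a0 - u x 1 * a1 - u x 2 * a2 - v x 0 * b0 - v x 1 * b1 - v x 2 * b2
    - θ x * e3' - (2⁻¹ * ((u x 0 * u x 0 + u x 1 * u x 1 + u x 2 * u x 2) + (v x 0 * v x 0 + v x 1 * v x 1 + v x 2 * v x 2) + θ x * θ x) + pr x) * e4'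

lemma energy_id {u v : R3 → R3} {pr θ : R3 → ℝ}
    (hu : ContDiff ℝ (⊤ : ℕ∞) u) (hv : ContDiff ℝ (⊤ : ℕ∞) v)
    (hpr : ContDiff ℝ (⊤ : ℕ∞) pr) (hθ : ContDiff ℝ (⊤ : ℕ∞) θ)
    (hsol : TCM u v pr θ) {φ : R3 → ℝ} (hφ : ContDiff ℝ (⊤ : ℕ∞) φ) (hc : HasCompactSupport φ) :
    ∫ x, φ x * grads u v θ x = - ∫ x, ∑ j, pd φ j x * flux u v pr θ j x := by
  have hF := fun j => flux_smooth hu hv hpr hθ j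
  simp only [← div_flux hu hv hpr hθ hsol, Finset.mul_sum]
  rw [integral_finsetSum, integral_finsetSum, ← Finset.sum_neg_distrib]
  · exact Finset.sum_congr rfl fun j _ => ibp (hF j) hφ hc j
  · intro j _
    exact (((pd_smooth hφ j).continuous.mul (hF j).continuous)).integrable_of_hasCompactSupport
      ((pd_supp hc j).mul_right)
  · intro j _
    exact ((hφ.continuous.mul (pd_smooth (hF j) j).continuous)).integrable_of_hasCompactSupport
      (hc.mul_right)

/-- `g = u · ∇φ` -/
def gfun (u : R3 → R3) (φ : R3 → ℝ) (x : R3) : ℝ := ∑ j, u x j * pd φ j x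

lemma gfun_smooth {u : R3 → R3} (hu : ContDiff ℝ (⊤ : ℕ∞) u) {φ : R3 → ℝ}
    (hφ : ContDiff ℝ (⊤ : ℕ∞) φ) : ContDiff ℝ (⊤ : ℕ∞) (gfun u φ) := by
  have hui := comp_smooth hu
  have h1 := fun j => pd_smooth hφ j
  unfold gfun
  fun_prop

lemma gfun_integral {u : R3 → R3} (hu : ContDiff ℝ (⊤ : ℕ∞) u) {φ : R3 → ℝ}
    (hφ : ContDiff ℝ (⊤ : ℕ∞) φ) (hc : HasCompactSupport φ)
    (hdiv : ∀ x, (∑ j, pd (fun y => u y j) j x) = 0) : ∫ x, gfun u φ x = 0 := by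
  unfold gfun
  rw [integral_finsetSum]
  · have : ∀ j, ∫ x, u x j * pd φ j x = - ∫ x, φ x * pd (fun y => u y j) j x := by
      intro j
      rw [ibp (comp_smooth hu j) hφ hc j, neg_neg]
      exact integral_congr_ae (Eventually.of_forall fun x => mul_comm _ _)
    simp only [this, Finset.sum_neg_distrib]
    rw [← integral_finsetSum]
    · simp [← Finset.mul_sum, hdiv]
    · intro j _
      exact ((hφ.continuous.mul (pd_smooth (comp_smooth hu j) j).continuous)).integrable_of_hasCompactSupport
        (hc.mul_right)
  · intro j _
    exact (((comp_smooth hu j).continuous.mul (pd_smooth hφ j).continuous)).integrable_of_hasCompactSupport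
      ((pd_supp hc j).mul_left)

lemma pd_pr {u v : R3 → R3} {pr θ : R3 → ℝ}
    (hu : ContDiff ℝ (⊤ : ℕ∞) u)
    (hsol : TCM u v pr θ) (i : Fin 3) (x : R3) :
    pd pr i x = ∑ j, (pd (pd (fun y => u y i) j) j x - pd (fun y => u y i * u y j) j x
      - pd (fun y => v y j * v y i) j x) := by
  obtain ⟨e1, e2, e3, e4⟩ := hsol
  have d1 := fun i => smooth_diff (comp_smooth hu i)
  have a := e1 i x
  have b := e4 x
  unfold lap at a
  simp only [Fin.sum_univ_three] at *
  have c : ∀ j, pd (fun y => u y i * u y j) j x = pd (fun y => u y i) j x * u x j + u x i * pd (fun y => u y j) j x :=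
    fun j => pd_mul' (d1 i) (d1 j) j x
  simp only [c]
  linear_combination a + u x i * b


/-- bilinear form -/
def JJ (g k f : R3 → ℝ) (s : ℝ) : ℝ := ∫ z, ∫ x, g x * k z * f (x - s • z)

lemma JJ_set {g k f : R3 → ℝ} (hg : Continuous g) (hk : Continuous k) (hf : Continuous f)
    (hgc : HasCompactSupport g) (hkc : HasCompactSupport k) (s : ℝ) :
    JJ g k f s = ∫ w in (tsupport k ×ˢ tsupport g), g w.2 * k w.1 * f (w.2 - s • w.1) := by
  have hK : IsCompact (tsupport k ×ˢ tsupport g) := hkc.isCompact.prod hgc.isCompact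
  have hcont : Continuous (fun w : R3 × R3 => g w.2 * k w.1 * f (w.2 - s • w.1)) := by fun_prop
  have h0 : ∀ w : R3 × R3, w ∉ tsupport k ×ˢ tsupport g → g w.2 * k w.1 * f (w.2 - s • w.1) = 0 := by
    intro w hw
    rw [Set.mem_prod, not_and_or] at hw
    rcases hw with hw | hw
    · simp [image_eq_zero_of_notMem_tsupport hw]
    · simp [image_eq_zero_of_notMem_tsupport hw]
  have hcs : HasCompactSupport (fun w : R3 × R3 => g w.2 * k w.1 * f (w.2 - s • w.1)) :=
    HasCompactSupport.intro hK h0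
  rw [setIntegral_eq_integral_of_forall_compl_eq_zero h0]
  rw [Measure.volume_eq_prod, integral_prod _ (hcont.integrable_of_hasCompactSupport hcs)]
  rfl

lemma JJ_swap {g k f : R3 → ℝ} (hg : Continuous g) (hk : Continuous k) (hf : Continuous f)
    (hgc : HasCompactSupport g) (hkc : HasCompactSupport k) (s : ℝ) :
    JJ g k f s = ∫ x, ∫ z, g x * k z * f (x - s • z) := by
  unfold JJ
  apply integral_integral_swap_of_hasCompactSupport (f := fun z x => g x * k z * f (x - s • z))
  · unfold Function.uncurry; fun_prop
  · apply HasCompactSupport.intro (hkc.isCompact.prod hgc.isCompact)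
    intro w hw
    rw [Set.mem_prod, not_and_or] at hw
    rcases hw with hw | hw
    · simp [Function.uncurry, image_eq_zero_of_notMem_tsupport hw]
    · simp [Function.uncurry, image_eq_zero_of_notMem_tsupport hw]

lemma JJ_cont {g k f : R3 → ℝ} (hg : Continuous g) (hk : Continuous k) (hf : Continuous f)
    (hgc : HasCompactSupport g) (hkc : HasCompactSupport k) : Continuous (JJ g k f) := by
  have : JJ g k f = fun s => ∫ w in (tsupport k ×ˢ tsupport g), g w.2 * k w.1 * f (w.2 - s • w.1) :=
    funext (JJ_set hg hk hf hgc hkc)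
  rw [this]
  apply continuous_parametric_integral_of_continuous (f := fun (s : ℝ) (w : R3 × R3) => g w.2 * k w.1 * f (w.2 - s • w.1))
  · unfold Function.uncurry; fun_prop
  · exact hkc.isCompact.prod hgc.isCompact

lemma pd_shift (f : R3 → ℝ) (c : R3) (j : Fin 3) (x : R3) :
    pd (fun y => f (y - c)) j x = pd f j (x - c) := by
  unfold pd; rw [fderiv_comp_sub]

lemma pd_scale {f : R3 → ℝ} (hf : Differentiable ℝ f) (c : R3) (s : ℝ) (j : Fin 3) (x : R3) :
    pd (fun y => f (c - s • y)) j x = -s * pd f j (c - s • x) := by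
  unfold pd
  have h : HasFDerivAt (fun y : R3 => c - s • y) (-(s • ContinuousLinearMap.id ℝ R3)) x :=
    ((hasFDerivAt_id x).const_smul s).const_sub c
  have h2 := (hf (c - s • x)).hasFDerivAt.comp x h
  have h3 : (f ∘ fun y => c - s • y) = fun y => f (c - s • y) := rfl
  rw [h3] at h2
  rw [h2.fderiv]
  simp

lemma JJ_near {g k f : R3 → ℝ} (hg : ContDiff ℝ (⊤ : ℕ∞) g) (hf : ContDiff ℝ (⊤ : ℕ∞) f)
    (hgc : HasCompactSupport g) (j : Fin 3) (s : ℝ) :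
    JJ g k (pd f j) s = - JJ (pd g j) k f s := by
  unfold JJ
  rw [← integral_neg]
  congr 1; ext z
  have h1 : ∀ x, g x * k z * pd f j (x - s • z) = k z * (g x * pd (fun y => f (y - s • z)) j x) := by
    intro x; rw [pd_shift]; ring
  have h2 : ∀ x, pd g j x * k z * f (x - s • z) = k z * (pd g j x * f (x - s • z)) := by
    intro x; ring
  simp only [h1, h2, integral_const_mul]
  rw [ibp (f := fun y => f (y - s • z)) (by fun_prop) hg hgc j]; ring

lemma JJ_far {g k f : R3 → ℝ} (hg : ContDiff ℝ (⊤ : ℕ∞) g) (hk : ContDiff ℝ (⊤ : ℕ∞) k)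
    (hf : ContDiff ℝ (⊤ : ℕ∞) f)
    (hgc : HasCompactSupport g) (hkc : HasCompactSupport k) (j : Fin 3) {s : ℝ} (hs : s ≠ 0) :
    JJ g k (pd f j) s = s⁻¹ * JJ g (pd k j) f s := by
  rw [JJ_swap hg.continuous hk.continuous (pd_smooth hf j).continuous hgc hkc,
    JJ_swap hg.continuous (pd_smooth hk j).continuous hf.continuous hgc (pd_supp hkc j),
    ← integral_const_mul]
  congr 1; ext x
  have h1 : ∀ z, g x * k z * pd f j (x - s • z) = -(g x * s⁻¹) * (k z * pd (fun y => f (x - s • y)) j z) := by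
    intro z; rw [pd_scale (smooth_diff hf)]; field_simp
  have h2 : ∀ z, g x * pd k j z * f (x - s • z) = g x * (pd k j z * f (x - s • z)) := by
    intro z; ring
  simp only [h1, h2, integral_const_mul]
  rw [ibp (f := fun y => f (x - s • y)) (by fun_prop) hk hkc j]; ring

lemma fderiv_sum3 (f : R3 → ℝ) (x z : R3) : fderiv ℝ f x z = ∑ i, z i * pd f i x := by
  have h : z = ∑ i, z i • EuclideanSpace.single i (1 : ℝ) := by
    ext j
    simp [Finset.sum_apply, Pi.single_apply]
  conv_lhs => rw [h]
  simp [pd]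

lemma JJ_int {g k f : R3 → ℝ} (hg : Continuous g) (hk : Continuous k) (hf : Continuous f)
    (hgc : HasCompactSupport g) (hkc : HasCompactSupport k) (δ : ℝ) :
    ∫ s in (0:ℝ)..δ, JJ g k f s = ∫ w in (tsupport k ×ˢ tsupport g),
      ∫ s in (0:ℝ)..δ, g w.2 * k w.1 * f (w.2 - s • w.1) := by
  simp_rw [JJ_set hg hk hf hgc hkc]
  apply intervalIntegral_integral_swap (f := fun (s : ℝ) (w : R3 × R3) => g w.2 * k w.1 * f (w.2 - s • w.1))
  rw [Measure.prod_restrict]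
  have hc : Continuous (Function.uncurry fun (s : ℝ) (w : R3 × R3) => g w.2 * k w.1 * f (w.2 - s • w.1)) := by
    unfold Function.uncurry; fun_prop
  have : IntegrableOn (Function.uncurry fun (s : ℝ) (w : R3 × R3) => g w.2 * k w.1 * f (w.2 - s • w.1))
      (Set.uIcc 0 δ ×ˢ (tsupport k ×ˢ tsupport g)) := by
    apply hc.continuousOn.integrableOn_compact
    exact isCompact_uIcc.prod (hkc.isCompact.prod hgc.isCompact)
  exact this.mono_set (Set.prod_mono Set.uIoc_subset_uIcc le_rfl)

lemma rep {g η P : R3 → ℝ} (hg : Continuous g) (hη : Continuous η) (hP : ContDiff ℝ (⊤ : ℕ∞) P)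
    (hgc : HasCompactSupport g) (hηc : HasCompactSupport η) (δ : ℝ) :
    JJ g η P 0 - JJ g η P δ = ∑ i, ∫ s in (0:ℝ)..δ, JJ g (fun z => η z * z i) (pd P i) s := by
  have hkc : ∀ i : Fin 3, HasCompactSupport (fun z : R3 => η z * z i) := fun i => hηc.mul_right
  have hPi := fun i => (pd_smooth hP i).continuous
  have hPc := hP.continuous
  have hset : ∀ i, ∫ s in (0:ℝ)..δ, JJ g (fun z => η z * z i) (pd P i) s =
      ∫ w in (tsupport η ×ˢ tsupport g), ∫ s in (0:ℝ)..δ, g w.2 * (η w.1 * w.1 i) * pd P i (w.2 - s • w.1) := by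
    intro i
    rw [JJ_int hg (by fun_prop) (hPi i) hgc (hkc i)]
    symm
    apply setIntegral_eq_of_subset_of_forall_sdiff_eq_zero
    · exact (hηc.isCompact.prod hgc.isCompact).measurableSet
    · exact Set.prod_mono (tsupport_mul_subset_left) le_rfl
    · rintro w ⟨hw, hw'⟩
      have h1 : w.1 ∉ tsupport (fun z => η z * z i) := fun h => hw' ⟨h, hw.2⟩
      have h2 := image_eq_zero_of_notMem_tsupport h1
      simp only at h2
      simp [h2]
  have hK : IsCompact (tsupport η ×ˢ tsupport g) := hηc.isCompact.prod hgc.isCompact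
  have hci : ∀ i, IntegrableOn (fun w : R3 × R3 => ∫ s in (0:ℝ)..δ, g w.2 * (η w.1 * w.1 i) * pd P i (w.2 - s • w.1)) (tsupport η ×ˢ tsupport g) := by
    intro i
    apply Continuous.continuousOn _ |>.integrableOn_compact hK
    apply intervalIntegral.continuous_parametric_intervalIntegral_of_continuous' (f := fun (w : R3 × R3) s => g w.2 * (η w.1 * w.1 i) * pd P i (w.2 - s • w.1))
    unfold Function.uncurry
    have := hPi i
    fun_prop
  simp_rw [hset]
  rw [JJ_set hg hη hPc hgc hηc, JJ_set hg hη hPc hgc hηc, ← integral_sub, ← integral_finsetSum]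
  rotate_left
  · exact fun i _ => hci i
  · exact (by fun_prop : Continuous _).continuousOn.integrableOn_compact hK
  · exact (by fun_prop : Continuous _).continuousOn.integrableOn_compact hK
  congr 1; ext w
  rw [← intervalIntegral.integral_finsetSum]
  swap
  · intro i _
    have := hPi i
    exact (by fun_prop : Continuous _).intervalIntegrable _ _
  have hd : ∀ s : ℝ, HasDerivAt (fun s : ℝ => - (g w.2 * η w.1 * P (w.2 - s • w.1)))
      (∑ i, g w.2 * (η w.1 * w.1 i) * pd P i (w.2 - s • w.1)) s := by
    intro s
    have h1 : HasDerivAt (fun s : ℝ => w.2 - s • w.1) (-w.1) s := by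
      have := ((hasDerivAt_id s).smul_const w.1).const_sub w.2
      simpa using this
    have h2 := ((smooth_diff hP (w.2 - s • w.1)).hasFDerivAt.comp_hasDerivAt s h1).const_mul (g w.2 * η w.1) |>.neg
    have h3 : (∑ i, g w.2 * (η w.1 * w.1 i) * pd P i (w.2 - s • w.1)) =
        (-(g w.2 * η w.1 * (fderiv ℝ P (w.2 - s • w.1)) (-w.1))) := by
      rw [map_neg, fderiv_sum3]
      simp only [Finset.mul_sum, mul_neg, neg_neg]
      exact Finset.sum_congr rfl fun i _ => by ring
    rw [h3]
    exact h2
  rw [intervalIntegral.integral_eq_sub_of_hasDerivAt (fun s _ => hd s)]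
  · simp; ring
  · exact (by fun_prop : Continuous _).intervalIntegrable _ _

lemma JJ_sum {ι : Type} (T : Finset ι) {g k : R3 → ℝ} {f : ι → R3 → ℝ} (hg : Continuous g) (hk : Continuous k)
    (hf : ∀ i, Continuous (f i))
    (hgc : HasCompactSupport g) (hkc : HasCompactSupport k) (s : ℝ) :
    JJ g k (fun x => ∑ i ∈ T, f i x) s = ∑ i ∈ T, JJ g k (f i) s := by
  have hK : IsCompact (tsupport k ×ˢ tsupport g) := hkc.isCompact.prod hgc.isCompact
  simp_rw [JJ_set hg hk (hf _) hgc hkc]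
  rw [JJ_set hg hk (by fun_prop) hgc hkc, ← integral_finsetSum]
  · simp_rw [Finset.mul_sum]
  · intro i _
    have := hf i
    exact (by fun_prop : Continuous _).continuousOn.integrableOn_compact hK

lemma JJ_sub {g k f f' : R3 → ℝ} (hg : Continuous g) (hk : Continuous k)
    (hf : Continuous f) (hf' : Continuous f')
    (hgc : HasCompactSupport g) (hkc : HasCompactSupport k) (s : ℝ) :
    JJ g k (fun x => f x - f' x) s = JJ g k f s - JJ g k f' s := by
  have hK : IsCompact (tsupport k ×ˢ tsupport g) := hkc.isCompact.prod hgc.isCompact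
  simp_rw [JJ_set hg hk hf hgc hkc, JJ_set hg hk hf' hgc hkc]
  rw [JJ_set hg hk (by fun_prop) hgc hkc, ← integral_sub]
  · simp_rw [mul_sub]
  · exact (by fun_prop : Continuous _).continuousOn.integrableOn_compact hK
  · exact (by fun_prop : Continuous _).continuousOn.integrableOn_compact hK


def etab : ContDiffBump (0 : R3) := ⟨1/2, 1, by norm_num, by norm_num⟩
/-- mollifier -/
def eta : R3 → ℝ := etab.normed volume
def kk (i : Fin 3) (z : R3) : ℝ := eta z * z i

lemma eta_smooth : ContDiff ℝ (⊤ : ℕ∞) eta := etab.contDiff_normed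
lemma eta_supp : HasCompactSupport eta := etab.hasCompactSupport_normed
lemma eta_int : ∫ x, eta x = 1 := etab.integral_normed
lemma kk_smooth (i : Fin 3) : ContDiff ℝ (⊤ : ℕ∞) (kk i) := by
  have := eta_smooth
  unfold kk
  fun_prop
lemma kk_supp (i : Fin 3) : HasCompactSupport (kk i) := eta_supp.mul_right
lemma eta_ts : tsupport eta = closedBall 0 1 := etab.tsupport_normed_eq
lemma eta_zero (z : R3) (hz : z ∉ closedBall (0 : R3) 1) : eta z = 0 := by
  rw [← eta_ts] at hz
  exact image_eq_zero_of_notMem_tsupport hz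
lemma kk_ts (i : Fin 3) : tsupport (kk i) ⊆ closedBall 0 1 := by
  rw [← eta_ts]
  exact tsupport_mul_subset_left
lemma kk_zero (i : Fin 3) (z : R3) (hz : z ∉ closedBall (0 : R3) 1) : kk i z = 0 := by
  simp [kk, eta_zero z hz]

lemma pd_tsupport {g : R3 → ℝ} {S : Set R3} (hS : IsClosed S) (hg : ∀ x, x ∉ S → g x = 0)
    (j : Fin 3) (x : R3) (hx : x ∉ S) : pd g j x = 0 := by
  unfold pd
  have : g =ᶠ[nhds x] fun _ => 0 := by
    filter_upwards [hS.isOpen_compl.mem_nhds hx] with y hy using hg y hy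
  rw [this.fderiv_eq]; simp

lemma bdd_of_cs {f : R3 → ℝ} (hf : Continuous f) (hc : HasCompactSupport f) :
    ∃ C, ∀ x, |f x| ≤ C := by
  obtain ⟨C, hC⟩ := hc.exists_bound_of_continuous hf
  exact ⟨C, hC⟩

lemma ker_bd : ∃ C : ℝ, 0 ≤ C ∧ (∀ i z, |kk i z| ≤ C) ∧ (∀ i j z, |pd (kk i) j z| ≤ C) ∧
    (∀ j z, |pd eta j z| ≤ C) := by
  choose a ha using fun i => bdd_of_cs (kk_smooth i).continuous (kk_supp i)
  choose b hb using fun i j => bdd_of_cs (pd_smooth (kk_smooth i) j).continuous (pd_supp (kk_supp i) j)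
  choose c hc using fun j => bdd_of_cs (pd_smooth eta_smooth j).continuous (pd_supp eta_supp j)
  have a0 : ∀ i, 0 ≤ a i := fun i => (abs_nonneg _).trans (ha i 0)
  have b0 : ∀ i j, 0 ≤ b i j := fun i j => (abs_nonneg _).trans (hb i j 0)
  have c0 : ∀ j, 0 ≤ c j := fun j => (abs_nonneg _).trans (hc j 0)
  have A0 : 0 ≤ ∑ i, a i := Finset.sum_nonneg fun i _ => a0 i
  have B0 : 0 ≤ ∑ i, ∑ j, b i j := Finset.sum_nonneg fun i _ => Finset.sum_nonneg fun j _ => b0 i j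
  have C0 : 0 ≤ ∑ i, c i := Finset.sum_nonneg fun i _ => c0 i
  refine ⟨∑ i, a i + ∑ i, ∑ j, b i j + ∑ j, c j, by positivity, ?_, ?_, ?_⟩
  · intro i z
    have := Finset.single_le_sum (fun i _ => a0 i) (Finset.mem_univ i)
    linarith [ha i z]
  · intro i j z
    have h1 := Finset.single_le_sum (fun j _ => b0 i j) (Finset.mem_univ j)
    have h2 := Finset.single_le_sum (f := fun i => ∑ j, b i j) (fun i _ => Finset.sum_nonneg fun j _ => b0 i j) (Finset.mem_univ i)
    linarith [hb i j z]
  · intro i z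
    have := Finset.single_le_sum (fun i _ => c0 i) (Finset.mem_univ i)
    linarith [hc i z]

structure Geo (S D : Set R3) (δ : ℝ) : Prop where
  cS : IsClosed S
  mD : MeasurableSet D
  bD : Bornology.IsBounded D
  sub : S ⊆ D
  tr : ∀ x ∈ S, ∀ z ∈ closedBall (0 : R3) 1, ∀ s, 0 < s → s ≤ δ → x - s • z ∈ D

lemma pow_vol {V t : ℝ} (hV : 0 ≤ V) (h0 : 0 ≤ t) (h1 : t ≤ 1) : V ^ (1 - t) ≤ 1 + V := by
  rcases le_total V 1 with h | h
  · have := Real.rpow_le_one hV h (by linarith : 0 ≤ 1 - t)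
    linarith
  · have := Real.rpow_le_rpow_of_exponent_le h (by linarith : 1 - t ≤ 1)
    rw [Real.rpow_one] at this
    linarith

lemma young_c : ∃ C : ℝ, 0 ≤ C ∧ ∀ (i j : Fin 3) (h f : R3 → ℝ) (S D : Set R3) (δ s a c t : ℝ),
    Continuous h → Continuous f → Geo S D δ → (∀ x, x ∉ S → h x = 0) → 0 < s → s ≤ δ →
    1 ≤ a → 1 ≤ c → t = 1 / a + 1 / c - 1 → 0 ≤ t →
    |JJ h (kk i) f s| ≤ C * s ^ (-3 * t) * (lpS h c D * lpS f a D) ∧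
    |JJ h (pd (kk i) j) f s| ≤ C * s ^ (-3 * t) * (lpS h c D * lpS f a D) := by
  obtain ⟨C, hC0, hC1, hC2, -⟩ := ker_bd
  set V := volume.real (closedBall (0 : R3) 1)
  have hV : 0 ≤ V := measureReal_nonneg
  refine ⟨C * (1 + V), by positivity, ?_⟩
  intro i j h f S D δ s a c t hh hf hG hS hs hsδ ha hc ht ht0
  have ht1 : t ≤ 1 := by
    have ha1 : 1 / a ≤ 1 := by rw [div_le_one (by linarith)]; exact ha
    have hc1 : 1 / c ≤ 1 := by rw [div_le_one (by linarith)]; exact hc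
    linarith
  have hVt := pow_vol hV ht0 ht1
  have hpos : 0 ≤ s ^ (-3 * t) * (lpS h c D * lpS f a D) :=
    mul_nonneg (by positivity) (mul_nonneg (lpS_nonneg _ _ _) (lpS_nonneg _ _ _))
  have key : C * V ^ (1 - t) * s ^ (-3 * t) * (lpS h c D * lpS f a D) ≤
      C * (1 + V) * s ^ (-3 * t) * (lpS h c D * lpS f a D) := by
    rw [mul_assoc (C * V ^ (1-t)), mul_assoc (C * (1 + V))]
    gcongr
  constructor
  · refine (young_real hh hf (hC1 i) (kk_zero i) hG.mD hG.bD hs hS hG.sub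
      (fun x hx z hz => hG.tr x hx z hz s hs hsδ) ha hc ht ht0).trans key
  · refine (young_real hh hf (hC2 i j) (fun z hz => ?_) hG.mD hG.bD hs hS hG.sub
      (fun x hx z hz => hG.tr x hx z hz s hs hsδ) ha hc ht ht0).trans key
    exact pd_tsupport isClosed_closedBall (kk_zero i) j z hz

lemma near_bd : ∃ C : ℝ, 0 ≤ C ∧ ∀ (i j : Fin 3) (g f : R3 → ℝ) (S D : Set R3) (δ ε a c t : ℝ),
    ContDiff ℝ (⊤ : ℕ∞) g → ContDiff ℝ (⊤ : ℕ∞) f → HasCompactSupport g →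
    Geo S D δ → (∀ x, x ∉ S → g x = 0) → 0 < ε → ε ≤ δ →
    1 ≤ a → 1 ≤ c → t = 1 / a + 1 / c - 1 → 0 ≤ t → t < 1 / 3 →
    |∫ s in (0:ℝ)..ε, JJ g (kk i) (pd f j) s| ≤
      C / (1 - 3 * t) * ε ^ (1 - 3 * t) * (lpS (pd g j) c D * lpS f a D) := by
  obtain ⟨C, hC0, hC⟩ := young_c
  refine ⟨C, hC0, ?_⟩
  intro i j g f S D δ ε a c t hg hf hgc hG hS hε hεδ ha hc ht ht0 ht1
  have hr : -1 < -3 * t := by linarith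
  have h := intervalIntegral.norm_integral_le_of_norm_le (μ := volume) (a := 0) (b := ε)
    (f := fun s => JJ g (kk i) (pd f j) s)
    (g := fun s => C * (lpS (pd g j) c D * lpS f a D) * s ^ (-3 * t)) hε.le
    (Eventually.of_forall fun s hs => by
      rw [JJ_near hg hf hgc, norm_neg, Real.norm_eq_abs]
      refine ((hC i j (pd g j) f S D δ s a c t (pd_smooth hg j).continuous hf.continuous hG
        (pd_tsupport hG.cS hS j) hs.1 (hs.2.trans hεδ) ha hc ht ht0).1).trans (le_of_eq (by ring)))
    ((intervalIntegral.intervalIntegrable_rpow' hr).const_mul _)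
  rw [intervalIntegral.integral_const_mul, integral_rpow (Or.inl hr), Real.norm_eq_abs] at h
  refine h.trans (le_of_eq ?_)
  have e1 : -3 * t + 1 = 1 - 3 * t := by ring
  rw [e1, Real.zero_rpow (by linarith)]
  ring

lemma far_log : ∃ C : ℝ, 0 ≤ C ∧ ∀ (i j : Fin 3) (g f : R3 → ℝ) (S D : Set R3) (δ ε a c : ℝ),
    ContDiff ℝ (⊤ : ℕ∞) g → ContDiff ℝ (⊤ : ℕ∞) f → HasCompactSupport g →
    Geo S D δ → (∀ x, x ∉ S → g x = 0) → 0 < ε → ε ≤ δ →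
    1 ≤ a → 1 ≤ c → 1 / a + 1 / c = 1 →
    |∫ s in ε..δ, JJ g (kk i) (pd f j) s| ≤
      C * Real.log (δ / ε) * (lpS g c D * lpS f a D) := by
  obtain ⟨C, hC0, hC⟩ := young_c
  refine ⟨C, hC0, ?_⟩
  intro i j g f S D δ ε a c hg hf hgc hG hS hε hεδ ha hc ht
  have h0 : (0:ℝ) ∉ Set.uIcc ε δ := Set.notMem_uIcc_of_lt hε (hε.trans_le hεδ)
  have h := intervalIntegral.norm_integral_le_of_norm_le (μ := volume) (a := ε) (b := δ)
    (f := fun s => JJ g (kk i) (pd f j) s)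
    (g := fun s => C * (lpS g c D * lpS f a D) * s⁻¹) hεδ
    (Eventually.of_forall fun s hs => by
      have hs0 : 0 < s := hε.trans hs.1
      rw [JJ_far hg (kk_smooth i) hf hgc (kk_supp i) j hs0.ne', Real.norm_eq_abs, abs_mul,
        abs_of_pos (inv_pos.2 hs0), mul_comm]
      have := (hC i j g f S D δ s a c 0 hg.continuous hf.continuous hG
        hS hs0 hs.2 ha hc (by linarith) le_rfl).2
      simp only [mul_zero, Real.rpow_zero, mul_one] at this
      gcongr)
    ((intervalIntegral.intervalIntegrable_inv (fun x hx h => h0 (h ▸ hx)) continuousOn_id).const_mul _)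
  rw [intervalIntegral.integral_const_mul, integral_inv_of_pos hε (hε.trans_le hεδ), Real.norm_eq_abs] at h
  refine h.trans (le_of_eq (by ring))

lemma far_pos : ∃ C : ℝ, 0 ≤ C ∧ ∀ (i j : Fin 3) (g f : R3 → ℝ) (S D : Set R3) (δ ε a c t : ℝ),
    ContDiff ℝ (⊤ : ℕ∞) g → ContDiff ℝ (⊤ : ℕ∞) f → HasCompactSupport g →
    Geo S D δ → (∀ x, x ∉ S → g x = 0) → 0 < ε → ε ≤ δ →
    1 ≤ a → 1 ≤ c → t = 1 / a + 1 / c - 1 → 0 < t →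
    |∫ s in ε..δ, JJ g (kk i) (pd f j) s| ≤
      C / (3 * t) * ε ^ (-3 * t) * (lpS g c D * lpS f a D) := by
  obtain ⟨C, hC0, hC⟩ := young_c
  refine ⟨C, hC0, ?_⟩
  intro i j g f S D δ ε a c t hg hf hgc hG hS hε hεδ ha hc ht ht0
  have h0 : (0:ℝ) ∉ Set.uIcc ε δ := Set.notMem_uIcc_of_lt hε (hε.trans_le hεδ)
  have h := intervalIntegral.norm_integral_le_of_norm_le (μ := volume) (a := ε) (b := δ)
    (f := fun s => JJ g (kk i) (pd f j) s)
    (g := fun s => C * (lpS g c D * lpS f a D) * s ^ (-3 * t - 1)) hεδ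
    (Eventually.of_forall fun s hs => by
      have hs0 : 0 < s := hε.trans hs.1
      rw [JJ_far hg (kk_smooth i) hf hgc (kk_supp i) j hs0.ne', Real.norm_eq_abs, abs_mul,
        abs_of_pos (inv_pos.2 hs0), Real.rpow_sub_one hs0.ne']
      have := (hC i j g f S D δ s a c t hg.continuous hf.continuous hG
        hS hs0 hs.2 ha hc ht ht0.le).2
      calc s⁻¹ * |JJ g (pd (kk i) j) f s| ≤ s⁻¹ * (C * s ^ (-3 * t) * (lpS g c D * lpS f a D)) := by gcongr
        _ = _ := by ring)
    ((intervalIntegral.intervalIntegrable_rpow (Or.inr h0)).const_mul _)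
  rw [intervalIntegral.integral_const_mul, integral_rpow (Or.inr ⟨by linarith, h0⟩), Real.norm_eq_abs] at h
  refine h.trans ?_
  have e1 : -3 * t - 1 + 1 = -(3 * t) := by ring
  have hp := mul_nonneg hC0 (mul_nonneg (lpS_nonneg g c D) (lpS_nonneg f a D))
  have e2 : C / (3 * t) * ε ^ (-3 * t) * (lpS g c D * lpS f a D) = C * (lpS g c D * lpS f a D) * (ε ^ (-(3 * t)) / (3*t)) := by
    rw [neg_mul]; ring
  rw [e1, e2]
  apply mul_le_mul_of_nonneg_left _ hp
  rw [div_neg, ← neg_div]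
  have : 0 ≤ δ ^ (-(3 * t)) := Real.rpow_nonneg (hε.le.trans hεδ) _
  gcongr
  linarith

/-- mollified function -/
def Pm (P : R3 → ℝ) (δ : ℝ) (x : R3) : ℝ := ∫ z, eta z * P (x - δ • z)

lemma inner_bd : ∃ C : ℝ, 0 ≤ C ∧ ∀ (j : Fin 3) (f : R3 → ℝ) (w : R3) (D : Set R3) (δ : ℝ),
    ContDiff ℝ (⊤ : ℕ∞) f → 0 < δ → MeasurableSet D → Bornology.IsBounded D →
    (∀ z ∈ closedBall (0 : R3) 1, w - δ • z ∈ D) →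
    |∫ z, eta z * pd f j (w - δ • z)| ≤ C / δ ^ 4 * lpS f 1 D := by
  obtain ⟨C, hC0, -, -, hC⟩ := ker_bd
  refine ⟨C, hC0, ?_⟩
  intro j f w D δ hf hδ hD hDb hw
  have h1 : ∀ z, eta z * pd f j (w - δ • z) = -δ⁻¹ * (eta z * pd (fun y => f (w - δ • y)) j z) := by
    intro z; rw [pd_scale (smooth_diff hf)]; field_simp
  simp only [h1, integral_const_mul]
  rw [ibp (f := fun y => f (w - δ • y)) (by fun_prop) eta_smooth eta_supp j]
  set G : R3 → ℝ := D.indicator (fun x => |f x|) with hG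
  have hGi : Integrable G := by
    rw [hG, integrable_indicator_iff hD]
    exact integrableOn_cont hf.continuous.abs hDb
  have hGi2 : Integrable (fun z => G (w - δ • z)) := 
    (hGi.comp_sub_left w).comp_smul hδ.ne'
  have hcv : ∫ z, G (w - δ • z) = (δ ^ 3)⁻¹ * ∫ x in D, |f x| := by
    have := Measure.integral_comp_smul (volume : Measure R3) (fun y => G (w - y)) δ
    rw [this, integral_sub_left_eq_self, hG, integral_indicator hD]
    simp [abs_of_pos hδ]
  have hb : ‖∫ z, pd eta j z * f (w - δ • z)‖ ≤ ∫ z, C * G (w - δ • z) := by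
    apply norm_integral_le_of_norm_le (hGi2.const_mul C)
    refine Eventually.of_forall fun z => ?_
    by_cases hz : z ∈ closedBall (0 : R3) 1
    · rw [hG, Set.indicator_of_mem (hw z hz), norm_mul, Real.norm_eq_abs, Real.norm_eq_abs]
      have := hC j z
      gcongr
    · rw [pd_tsupport isClosed_closedBall eta_zero j z hz]
      simp only [zero_mul, norm_zero]
      exact mul_nonneg hC0 (Set.indicator_nonneg (fun _ _ => abs_nonneg _) _)
  rw [integral_const_mul, hcv, Real.norm_eq_abs] at hb
  have hl : lpS f 1 D = ∫ x in D, |f x| := by simp [lpS]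
  rw [hl, neg_mul_neg, abs_mul, abs_of_pos (inv_pos.2 hδ)]
  calc δ⁻¹ * |∫ z, pd eta j z * f (w - δ • z)| ≤ δ⁻¹ * (C * ((δ ^ 3)⁻¹ * ∫ x in D, |f x|)) := by gcongr
    _ = _ := by field_simp

set_option maxHeartbeats 1000000 in
lemma Pm_diff : ∃ C : ℝ, 0 ≤ C ∧ ∀ (P : R3 → ℝ) (F : Fin 3 → Fin 3 → R3 → ℝ) (x y : R3) (D : Set R3) (δ : ℝ),
    ContDiff ℝ (⊤ : ℕ∞) P → (∀ i j, ContDiff ℝ (⊤ : ℕ∞) (F i j)) →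
    (∀ i x, pd P i x = ∑ j, pd (F i j) j x) →
    0 < δ → MeasurableSet D → Bornology.IsBounded D →
    (∀ t : ℝ, 0 ≤ t → t ≤ 1 → ∀ z ∈ closedBall (0 : R3) 1, y + t • (x - y) - δ • z ∈ D) →
    |Pm P δ x - Pm P δ y| ≤ C / δ ^ 4 * ‖x - y‖ * ∑ i, ∑ j, lpS (F i j) 1 D := by
  obtain ⟨C, hC0, hC⟩ := inner_bd
  refine ⟨C, hC0, ?_⟩
  intro P F x y D δ hP hF hPF hδ hD hDb hw
  have hPi := fun i => (pd_smooth hP i).continuous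
  have hFij := fun i j => (pd_smooth (hF i j) j).continuous
  have hPc := hP.continuous
  have hec := eta_smooth.continuous
  have hci : ∀ (f : R3 → ℝ) (hf : Continuous f) w, Integrable (fun z => eta z * f (w - δ • z)) := by
    intro f hf w
    exact (by fun_prop : Continuous _).integrable_of_hasCompactSupport eta_supp.mul_right
  obtain ⟨H, hH⟩ : ∃ H : ℝ → R3 → ℝ, H = fun t z => ∑ i, (x - y) i * (eta z * pd P i (y + t • (x - y) - δ • z)) := ⟨_, rfl⟩
  have hH0 : ∀ t z, z ∉ closedBall (0 : R3) 1 → H t z = 0 := by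
    intro t z hz
    simp [hH, eta_zero z hz]
  have hHc : Continuous (Function.uncurry H) := by
    rw [hH]
    unfold Function.uncurry
    refine continuous_finsetSum _ fun i _ => ?_
    have := hPi i
    fun_prop
  have e1 : Pm P δ x - Pm P δ y = ∫ t in (0:ℝ)..1, ∫ z, H t z := by
    have e2 : ∀ t, ∫ z, H t z = ∫ z in closedBall (0 : R3) 1, H t z := fun t =>
      (setIntegral_eq_integral_of_forall_compl_eq_zero (hH0 t)).symm
    simp_rw [e2]
    rw [intervalIntegral_integral_swap]
    swap
    · rw [Measure.prod_restrict]
      have : IntegrableOn (Function.uncurry H) (Set.uIcc 0 1 ×ˢ closedBall (0 : R3) 1) := 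
        hHc.continuousOn.integrableOn_compact (isCompact_uIcc.prod (isCompact_closedBall _ _))
      exact this.mono_set (Set.prod_mono Set.uIoc_subset_uIcc le_rfl)
    rw [setIntegral_eq_integral_of_forall_compl_eq_zero (fun z hz => by simp [hH0 _ z hz])]
    unfold Pm
    rw [← integral_sub (hci P hPc x) (hci P hPc y)]
    congr 1; ext z
    have hd : ∀ t : ℝ, HasDerivAt (fun t : ℝ => eta z * P (y + t • (x - y) - δ • z)) (H t z) t := by
      intro t
      have h1 : HasDerivAt (fun t : ℝ => y + t • (x - y) - δ • z) (x - y) t := by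
        have := (((hasDerivAt_id t).smul_const (x - y)).const_add y).sub_const (δ • z)
        simpa using this
      have h2 := ((smooth_diff hP (y + t • (x - y) - δ • z)).hasFDerivAt.comp_hasDerivAt t h1).const_mul (eta z)
      have h3 : H t z = eta z * (fderiv ℝ P (y + t • (x - y) - δ • z)) (x - y) := by
        rw [fderiv_sum3, hH]
        simp only [Finset.mul_sum]
        exact Finset.sum_congr rfl fun i _ => by ring
      rw [h3]
      exact h2
    rw [intervalIntegral.integral_eq_sub_of_hasDerivAt (fun s _ => hd s)]
    · simp
    · have : Continuous (fun t => H t z) := by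
        have h9 : Continuous (fun t : ℝ => (t, z)) := by fun_prop
        exact Continuous.comp (g := Function.uncurry H) hHc h9
      exact this.intervalIntegrable _ _
  rw [e1]
  have hbound : ∀ t ∈ Set.uIoc (0:ℝ) 1, ‖∫ z, H t z‖ ≤ C / δ ^ 4 * ‖x - y‖ * ∑ i, ∑ j, lpS (F i j) 1 D := by
    intro t ht
    rw [Set.uIoc_of_le zero_le_one] at ht
    simp only [hH]
    rw [integral_finsetSum _ (fun i _ => (hci _ (hPi i) _).const_mul _), Finset.mul_sum]
    refine (norm_sum_le _ _).trans (Finset.sum_le_sum fun i _ => ?_)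
    rw [integral_const_mul, norm_mul]
    have h5 : ‖(x - y) i‖ ≤ ‖x - y‖ := PiLp.norm_apply_le _ _
    have h6 : ‖∫ z, eta z * pd P i (y + t • (x - y) - δ • z)‖ ≤ ∑ j, C / δ ^ 4 * lpS (F i j) 1 D := by
      simp only [hPF, Finset.mul_sum]
      rw [integral_finsetSum _ (fun j _ => hci _ (hFij i j) _)]
      refine (norm_sum_le _ _).trans (Finset.sum_le_sum fun j _ => ?_)
      exact hC j (F i j) _ D δ (hF i j) hδ hD hDb (hw t ht.1.le ht.2)
    calc _ ≤ ‖x - y‖ * ∑ j, C / δ ^ 4 * lpS (F i j) 1 D := by gcongr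
      _ = _ := by rw [← Finset.mul_sum]; ring
  have := intervalIntegral.norm_integral_le_of_norm_le_const hbound
  simpa using this


lemma pd_comp {ψ : ℝ → ℝ} {h : R3 → ℝ} (hψ : Differentiable ℝ ψ) (hh : Differentiable ℝ h)
    (j : Fin 3) (x : R3) : pd (fun y => ψ (h y)) j x = deriv ψ (h x) * pd h j x := by
  unfold pd
  have := ((hψ (h x)).hasDerivAt.comp_hasFDerivAt x (hh x).hasFDerivAt).fderiv
  have e : (ψ ∘ h) = fun y => ψ (h y) := rfl
  rw [e] at this
  rw [this]; simp

lemma pd_normsq (a w : ℝ) (j : Fin 3) (x : R3) :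
    pd (fun y : R3 => (a - ‖y‖ ^ 2) / w) j x = - 2 / w * x j := by
  unfold pd
  have h1 := (((hasStrictFDerivAt_norm_sq x).hasFDerivAt.const_sub a).mul_const (w⁻¹)).fderiv
  have : (fun y : R3 => (a - ‖y‖ ^ 2) / w) = fun y : R3 => (a - ‖y‖ ^ 2) * w⁻¹ := by
    ext; rw [div_eq_mul_inv]
  rw [this, h1]
  simp [EuclideanSpace.inner_single_right]
  ring

lemma pd_coord (i j : Fin 3) (x : R3) : |pd (fun y : R3 => y i) j x| ≤ 1 := by
  have : pd (fun y : R3 => y i) j x = (EuclideanSpace.single j (1:ℝ)) i := by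
    unfold pd
    have h := (EuclideanSpace.proj i : R3 →L[ℝ] ℝ).hasFDerivAt (x := x)
    have h2 : HasFDerivAt (fun y : R3 => y i) (EuclideanSpace.proj i : R3 →L[ℝ] ℝ) x := h
    rw [h2.fderiv]; rfl
  rw [this, EuclideanSpace.single_apply]
  split_ifs <;> simp

lemma st_bd : ∃ C : ℝ, 0 ≤ C ∧ (∀ t, |deriv Real.smoothTransition t| ≤ C) ∧
    (∀ t, |deriv (deriv Real.smoothTransition) t| ≤ C) := by
  have hs : ContDiff ℝ (⊤ : ℕ∞) Real.smoothTransition := Real.smoothTransition.contDiff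
  have h1 : ContDiff ℝ (⊤ : ℕ∞) (deriv Real.smoothTransition) := ((contDiff_infty_iff_deriv (𝕜 := ℝ)).1 hs).2
  have h2 : ContDiff ℝ (⊤ : ℕ∞) (deriv (deriv Real.smoothTransition)) := ((contDiff_infty_iff_deriv (𝕜 := ℝ)).1 h1).2
  have z1 : ∀ t, t ∉ Set.Icc (0:ℝ) 1 → deriv Real.smoothTransition t = 0 := by
    intro t ht
    rw [Set.mem_Icc, not_and_or, not_le, not_le] at ht
    rcases ht with ht | ht
    · have : Real.smoothTransition =ᶠ[nhds t] fun _ => 0 := by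
        filter_upwards [Iio_mem_nhds ht] with y hy using Real.smoothTransition.zero_of_nonpos (le_of_lt hy)
      rw [this.deriv_eq]; simp
    · have : Real.smoothTransition =ᶠ[nhds t] fun _ => 1 := by
        filter_upwards [Ioi_mem_nhds ht] with y hy using Real.smoothTransition.one_of_one_le (le_of_lt hy)
      rw [this.deriv_eq]; simp
  have c1 : HasCompactSupport (deriv Real.smoothTransition) := HasCompactSupport.intro isCompact_Icc z1
  have c2 := c1.deriv
  obtain ⟨A, hA⟩ := c1.exists_bound_of_continuous h1.continuous
  obtain ⟨B, hB⟩ := c2.exists_bound_of_continuous h2.continuous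
  have := (norm_nonneg _).trans (hA 0)
  have := (norm_nonneg _).trans (hB 0)
  exact ⟨A + B, by linarith, fun t => (hA t).trans (by linarith), fun t => (hB t).trans (by linarith)⟩

structure Cut (C ρ d : ℝ) (φ : R3 → ℝ) : Prop where
  smooth : ContDiff ℝ (⊤ : ℕ∞) φ
  nonneg : ∀ x, 0 ≤ φ x
  le_one : ∀ x, φ x ≤ 1
  one : ∀ x, ‖x‖ ≤ ρ → φ x = 1
  zero : ∀ x, ρ + d / 2 ≤ ‖x‖ → φ x = 0
  d1 : ∀ j x, |pd φ j x| ≤ C / d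
  d2 : ∀ i j x, |pd (pd φ i) j x| ≤ C / d ^ 2

lemma cut_exists : ∃ C : ℝ, 0 < C ∧ ∀ (R ρ d : ℝ), 0 < R → 0 < d → 7 * R / 4 ≤ ρ → ρ + d ≤ 2 * R →
    ∃ φ, Cut C ρ d φ := by
  obtain ⟨A, hA0, hA1, hA2⟩ := st_bd
  refine ⟨20 * A + 1, by positivity, ?_⟩
  intro R ρ d hR hd h1 h2
  have hs : ContDiff ℝ (⊤ : ℕ∞) Real.smoothTransition := Real.smoothTransition.contDiff
  have hs1 : ContDiff ℝ (⊤ : ℕ∞) (deriv Real.smoothTransition) := ((contDiff_infty_iff_deriv (𝕜 := ℝ)).1 hs).2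
  set τ := ρ + d / 2 with hτ
  set w := τ ^ 2 - ρ ^ 2 with hw
  have hwR : d * R ≤ w := by rw [hw, hτ]; nlinarith
  have hw0 : 0 < w := by have := mul_pos hd hR; linarith
  have hdR : d ≤ R := by linarith
  have hτR : τ ≤ 2 * R := by rw [hτ]; linarith
  have hτ0 : 0 < τ := by rw [hτ]; linarith
  set h : R3 → ℝ := fun y => (τ ^ 2 - ‖y‖ ^ 2) / w with hh
  have hhs : ContDiff ℝ (⊤ : ℕ∞) h := by
    rw [hh]
    exact (contDiff_const.sub (contDiff_norm_sq ℝ)).div_const _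
  have hhd := smooth_diff hhs
  have e1 : ∀ i x, pd (fun y => Real.smoothTransition (h y)) i x = deriv Real.smoothTransition (h x) * (-2 / w * x i) := by
    intro i x
    rw [pd_comp (hs.differentiable (by simp)) hhd, hh, pd_normsq]
  have z : ∀ x, τ ≤ ‖x‖ → Real.smoothTransition (h x) = 0 := by
    intro x hx
    apply Real.smoothTransition.zero_of_nonpos
    apply div_nonpos_of_nonpos_of_nonneg _ hw0.le
    nlinarith
  have zz : ∀ x, x ∉ closedBall (0 : R3) τ → Real.smoothTransition (h x) = 0 := by
    intro x hx
    apply z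
    simp at hx
    exact hx.le
  have b2 : 2 / w ≤ 2 / (d * R) := by gcongr
  have b1 : ∀ x : R3, ‖x‖ ≤ τ → ∀ i, |(-2 / w * x i)| ≤ 4 / d := by
    intro x hx i
    have h5 : |x i| ≤ ‖x‖ := PiLp.norm_apply_le x i
    rw [abs_mul, neg_div, abs_neg, abs_of_pos (by positivity)]
    calc 2 / w * |x i| ≤ 2 / (d * R) * (2 * R) := by gcongr; linarith
      _ = 4 / d := by field_simp; norm_num
  refine ⟨fun y => Real.smoothTransition (h y), ⟨hs.comp hhs, fun x => Real.smoothTransition.nonneg _, fun x => Real.smoothTransition.le_one _, ?_, z, ?_, ?_⟩⟩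
  · intro x hx
    apply Real.smoothTransition.one_of_one_le
    rw [hh]
    simp only
    rw [le_div_iff₀ hw0, hw]
    have := norm_nonneg x
    nlinarith
  · intro j x
    by_cases hx : x ∈ closedBall (0 : R3) τ
    · rw [e1, abs_mul]
      have := b1 x (by simpa using hx) j
      calc _ ≤ A * (4 / d) := by gcongr; exact hA1 _
        _ = 4 * A / d := by ring
        _ ≤ _ := by gcongr; linarith
    · rw [pd_tsupport isClosed_closedBall zz j x hx]; simp; positivity
  · intro i j x
    by_cases hx : x ∈ closedBall (0 : R3) τ
    · have hx' : ‖x‖ ≤ τ := by simpa using hx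
      rw [show pd (fun y => Real.smoothTransition (h y)) i = fun x => deriv Real.smoothTransition (h x) * (-2 / w * x i) from funext (e1 i)]
      rw [pd_mul' (f := fun x => deriv Real.smoothTransition (h x)) (g := fun x : R3 => -2 / w * x i) ((hs1.differentiable (by simp)).comp hhd) (by fun_prop), pd_comp (hs1.differentiable (by simp)) hhd,
        pd_mul' (f := fun _ => -2 / w) (by fun_prop) (by fun_prop), pd_const', zero_mul, zero_add, hh, pd_normsq]
      have q1 := b1 x hx' i
      have q2 := b1 x hx' j
      have q3 := pd_coord i j x
      have q4 : |(-2 / w)| ≤ 2 / d ^ 2 := by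
        rw [neg_div, abs_neg, abs_of_pos (by positivity)]
        refine b2.trans ?_
        gcongr
        nlinarith
      have q5 := hA1 (h x)
      have q6 := hA2 (h x)
      have gen : ∀ a b c e f g : ℝ, |a * b * c + e * (f * g)| ≤ |a| * |b| * |c| + |e| * (|f| * |g|) := by
        intro a b c e f g
        simp only [← abs_mul]
        exact abs_add_le _ _
      refine (gen _ _ _ _ _ _).trans ?_
      calc _ ≤ A * (4 / d) * (4 / d) + A * (2 / d ^ 2 * 1) := by gcongr
        _ = 18 * A / d ^ 2 := by field_simp; ring
        _ ≤ _ := by gcongr; linarith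
    · rw [pd_tsupport isClosed_closedBall (pd_tsupport isClosed_closedBall zz i) j x hx]; simp; positivity

/-- thin shell -/
def SS (ρ d : ℝ) : Set R3 := {x | ρ ≤ ‖x‖ ∧ ‖x‖ ≤ ρ + d / 2}

lemma SS_closed (ρ d : ℝ) : IsClosed (SS ρ d) :=
  (isClosed_le continuous_const continuous_norm).inter (isClosed_le continuous_norm continuous_const)

lemma mem_sh {R τ : ℝ} {x : R3} : x ∈ sh R τ ↔ ‖x‖ < τ ∧ R ≤ ‖x‖ := by
  simp [sh]

lemma Cut.hasCS {C ρ d : ℝ} {φ : R3 → ℝ} (h : Cut C ρ d φ) : HasCompactSupport φ :=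
  HasCompactSupport.intro (isCompact_closedBall (0 : R3) (ρ + d / 2)) fun x hx => h.zero x (by
    simp at hx; exact hx.le)

lemma Cut.pd_zero {C ρ d : ℝ} {φ : R3 → ℝ} (h : Cut C ρ d φ) (j : Fin 3) (x : R3) (hx : x ∉ SS ρ d) :
    pd φ j x = 0 := by
  simp only [SS, Set.mem_setOf_eq, not_and_or, not_le] at hx
  rcases hx with hx | hx
  · unfold pd
    have : φ =ᶠ[nhds x] fun _ => 1 := by
      filter_upwards [(isOpen_lt continuous_norm continuous_const).mem_nhds hx] with y hy using h.one y (le_of_lt hy)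
    rw [this.fderiv_eq]; simp
  · apply pd_tsupport (isClosed_closedBall (x := (0 : R3)) (ε := ρ + d / 2)) (fun y hy => h.zero y (by simp at hy; exact hy.le))
    simpa using hx

lemma geo_SS {R ρ d : ℝ} (hR : 0 < R) (hd : 0 < d) (h1 : 7 * R / 4 ≤ ρ) (h2 : ρ + d ≤ 2 * R) :
    Geo (SS ρ d) (sh R (ρ + d)) (d / 4) where
  cS := SS_closed _ _
  mD := sh_meas _ _
  bD := sh_bdd _ _
  sub := by
    rintro x ⟨hx1, hx2⟩
    rw [mem_sh]
    constructor <;> linarith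
  tr := by
    rintro x ⟨hx1, hx2⟩ z hz s hs hs2
    have hz' : ‖z‖ ≤ 1 := by simpa using hz
    have h3 : ‖s • z‖ ≤ d / 4 := by
      rw [norm_smul, Real.norm_eq_abs, abs_of_pos hs]
      nlinarith [norm_nonneg z]
    rw [mem_sh]
    have h4 := norm_sub_le x (s • z)
    have h5 := norm_sub_norm_le x (s • z)
    constructor <;> linarith

lemma seg_sh {R ρ d : ℝ} (hR : 0 < R) (hd : 0 < d) (h1 : 7 * R / 4 ≤ ρ) (h2 : ρ + d ≤ 2 * R)
    {x y : R3} (hx : x ∈ SS ρ d) (hy : y ∈ SS ρ d) (hxy : 0 ≤ inner ℝ x y) (t : ℝ) (ht0 : 0 ≤ t) (ht1 : t ≤ 1)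
    (z : R3) (hz : z ∈ closedBall (0 : R3) 1) : y + t • (x - y) - (d / 4) • z ∈ sh R (ρ + d) := by
  have hz' : ‖z‖ ≤ 1 := by simpa using hz
  obtain ⟨hx1, hx2⟩ := hx
  obtain ⟨hy1, hy2⟩ := hy
  have h3 : ‖(d / 4) • z‖ ≤ d / 4 := by
    rw [norm_smul, Real.norm_eq_abs, abs_of_pos (by linarith)]
    nlinarith [norm_nonneg z]
  have e : y + t • (x - y) = (1 - t) • y + t • x := by
    rw [smul_sub, sub_smul, one_smul]; abel
  set m := y + t • (x - y)
  have h4 := norm_sub_le m ((d / 4) • z)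
  have h5 := norm_sub_norm_le m ((d / 4) • z)
  have h6 : ‖m‖ ≤ ρ + d / 2 := by
    rw [e]
    refine (norm_add_le _ _).trans ?_
    rw [norm_smul, norm_smul, Real.norm_eq_abs, Real.norm_eq_abs, abs_of_nonneg ht0, abs_of_nonneg (by linarith)]
    nlinarith
  have h7 : ρ ^ 2 / 2 ≤ ‖m‖ ^ 2 := by
    rw [e, norm_add_sq_real, norm_smul, norm_smul, Real.norm_eq_abs, Real.norm_eq_abs, abs_of_nonneg ht0, abs_of_nonneg (by linarith : 0 ≤ 1 - t),
      inner_smul_left, inner_smul_right, real_inner_comm]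
    simp only [conj_trivial]
    have i1 : 0 ≤ (1 - t) * (t * inner ℝ x y) := mul_nonneg (by linarith) (mul_nonneg ht0 hxy)
    have i2 : (1 - t) ^ 2 * ρ ^ 2 ≤ ((1 - t) * ‖y‖) ^ 2 := by rw [mul_pow]; gcongr; linarith
    have i3 : t ^ 2 * ρ ^ 2 ≤ (t * ‖x‖) ^ 2 := by rw [mul_pow]; gcongr; linarith
    nlinarith [mul_nonneg (sq_nonneg (2 * t - 1)) (sq_nonneg ρ)]
  have h8 : 6 / 5 * R ≤ ‖m‖ := by
    by_contra hcon
    push Not at hcon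
    have : ‖m‖ ^ 2 < (6 / 5 * R) ^ 2 := by gcongr
    nlinarith
  rw [mem_sh]
  constructor <;> linarith

lemma low_osc : ∃ C : ℝ, 0 ≤ C ∧ ∀ (P : R3 → ℝ) (F : Fin 3 → Fin 3 → R3 → ℝ) (R ρ d : ℝ),
    ContDiff ℝ (⊤ : ℕ∞) P → (∀ i j, ContDiff ℝ (⊤ : ℕ∞) (F i j)) →
    (∀ i x, pd P i x = ∑ j, pd (F i j) j x) →
    0 < R → 0 < d → 7 * R / 4 ≤ ρ → ρ + d ≤ 2 * R →
    ∃ c : ℝ, ∀ x ∈ SS ρ d, |Pm P (d / 4) x - c| ≤ C / d ^ 4 * R * ∑ i, ∑ j, lpS (F i j) 1 (sh R (ρ + d)) := by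
  obtain ⟨C, hC0, hC⟩ := Pm_diff
  refine ⟨C * 256 * 8, by positivity, ?_⟩
  intro P F R ρ d hP hF hPF hR hd h1 h2
  have hρ : 0 < ρ := by linarith
  set N := ∑ i, ∑ j, lpS (F i j) 1 (sh R (ρ + d)) with hN
  have hN0 : 0 ≤ N := Finset.sum_nonneg fun i _ => Finset.sum_nonneg fun j _ => lpS_nonneg _ _ _
  have key : ∀ x ∈ SS ρ d, ∀ y ∈ SS ρ d, 0 ≤ inner ℝ x y → |Pm P (d / 4) x - Pm P (d / 4) y| ≤
      C * 256 * 4 / d ^ 4 * R * N := by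
    intro x hx y hy hxy
    have := hC P F x y (sh R (ρ + d)) (d / 4) hP hF hPF (by linarith) (sh_meas _ _) (sh_bdd _ _)
      (fun t ht0 ht1 z hz => seg_sh hR hd h1 h2 hx hy hxy t ht0 ht1 z hz)
    refine this.trans ?_
    have h3 : ‖x - y‖ ≤ 4 * R := by
      have := norm_sub_le x y
      have := hx.2
      have := hy.2
      linarith
    calc _ ≤ C / (d / 4) ^ 4 * (4 * R) * N := by gcongr
      _ = _ := by field_simp; ring
  have sgl : ∀ (k : Fin 3) (b : ℝ), |b| = 1 → (EuclideanSpace.single k (ρ * b) : R3) ∈ SS ρ d := by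
    intro k b hb
    simp only [SS, Set.mem_setOf_eq, EuclideanSpace.norm_single, norm_mul, Real.norm_eq_abs, hb, mul_one, abs_of_pos hρ]
    constructor <;> linarith
  refine ⟨Pm P (d / 4) (EuclideanSpace.single 0 (ρ * 1)), fun x hx => ?_⟩
  obtain ⟨b, hb, hbx⟩ : ∃ b : ℝ, |b| = 1 ∧ 0 ≤ x 1 * b := by
    rcases le_total 0 (x 1) with h | h
    · exact ⟨1, by simp, by simpa⟩
    · exact ⟨-1, by simp, by simpa⟩
  have k1 := key x hx _ (sgl 1 b hb) (by
    rw [EuclideanSpace.inner_single_right]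
    simp
    nlinarith)
  have k2 := key _ (sgl 1 b hb) _ (sgl 0 1 (by simp)) (by
    rw [EuclideanSpace.inner_single_right]
    simp)
  have k3 := abs_sub_le (Pm P (d / 4) x) (Pm P (d / 4) (EuclideanSpace.single 1 (ρ * b))) (Pm P (d / 4) (EuclideanSpace.single 0 (ρ * 1)))
  calc _ ≤ _ := k3
    _ ≤ C * 256 * 4 / d ^ 4 * R * N + C * 256 * 4 / d ^ 4 * R * N := add_le_add k1 k2
    _ = _ := by ring

lemma JJ_eta_zero {g P : R3 → ℝ} : JJ g eta P 0 = ∫ x, g x * P x := by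
  unfold JJ
  have : ∀ z x, g x * eta z * P (x - (0:ℝ) • z) = eta z * (g x * P x) := by
    intro z x; rw [zero_smul, sub_zero]; ring
  simp_rw [this, integral_const_mul, integral_mul_const, eta_int, one_mul]

lemma JJ_eta {g P : R3 → ℝ} (hg : Continuous g) (hP : Continuous P) (hgc : HasCompactSupport g) (δ : ℝ) :
    JJ g eta P δ = ∫ x, g x * Pm P δ x := by
  rw [JJ_swap hg eta_smooth.continuous hP hgc eta_supp]
  unfold Pm
  simp_rw [mul_assoc, integral_const_mul]

lemma Pm_cont {P : R3 → ℝ} (hP : Continuous P) (δ : ℝ) : Continuous (Pm P δ) := by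
  have : Pm P δ = fun x => ∫ z in closedBall (0 : R3) 1, eta z * P (x - δ • z) := by
    ext x
    exact (setIntegral_eq_integral_of_forall_compl_eq_zero (fun z hz => by simp [eta_zero z hz])).symm
  rw [this]
  have := eta_smooth.continuous
  exact continuous_parametric_integral_of_continuous (f := fun (x : R3) (z : R3) => eta z * P (x - δ • z))
    (by unfold Function.uncurry; fun_prop) (isCompact_closedBall _ _)

lemma low_bd : ∃ C : ℝ, 0 ≤ C ∧ ∀ (P g : R3 → ℝ) (F : Fin 3 → Fin 3 → R3 → ℝ) (R ρ d : ℝ),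
    ContDiff ℝ (⊤ : ℕ∞) P → (∀ i j, ContDiff ℝ (⊤ : ℕ∞) (F i j)) →
    (∀ i x, pd P i x = ∑ j, pd (F i j) j x) →
    0 < R → 0 < d → 7 * R / 4 ≤ ρ → ρ + d ≤ 2 * R →
    Continuous g → HasCompactSupport g → (∀ x, x ∉ SS ρ d → g x = 0) → ∫ x, g x = 0 →
    |JJ g eta P (d / 4)| ≤ C / d ^ 4 * R * (∑ i, ∑ j, lpS (F i j) 1 (sh R (ρ + d))) * lpS g 1 (sh R (ρ + d)) := by
  obtain ⟨C, hC0, hC⟩ := low_osc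
  refine ⟨C, hC0, ?_⟩
  intro P g F R ρ d hP hF hPF hR hd h1 h2 hg hgc hgS hg0
  obtain ⟨c, hc⟩ := hC P F R ρ d hP hF hPF hR hd h1 h2
  set N := C / d ^ 4 * R * ∑ i, ∑ j, lpS (F i j) 1 (sh R (ρ + d)) with hN
  have hl : lpS g 1 (sh R (ρ + d)) = ∫ x, |g x| := by
    simp [lpS]
    apply setIntegral_eq_integral_of_forall_compl_eq_zero
    intro x hx
    rw [hgS x (fun h => hx ((geo_SS hR hd h1 h2).sub h))]; simp
  have hPc := Pm_cont hP.continuous (d / 4)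
  have e : JJ g eta P (d / 4) = ∫ x, g x * (Pm P (d / 4) x - c) := by
    rw [JJ_eta hg hP.continuous hgc]
    simp_rw [mul_sub]
    rw [integral_sub, integral_mul_const, hg0]
    · simp
    · exact (hg.mul hPc).integrable_of_hasCompactSupport hgc.mul_right
    · exact (hg.integrable_of_hasCompactSupport hgc).mul_const c
  rw [e, hl, ← integral_const_mul]
  apply norm_integral_le_of_norm_le (f := fun x => g x * (Pm P (d / 4) x - c))
  · exact (hg.abs.integrable_of_hasCompactSupport hgc.norm).const_mul _
  · refine Eventually.of_forall fun x => ?_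
    by_cases hx : x ∈ SS ρ d
    · rw [norm_mul, mul_comm, Real.norm_eq_abs, Real.norm_eq_abs]
      have := hc x hx
      gcongr
    · simp [hgS x hx]


lemma fderiv_sq_le (f : R3 → ℝ) (x : R3) : ‖fderiv ℝ f x‖ ^ 2 ≤ ∑ j, pd f j x ^ 2 := by
  have h0 : 0 ≤ ∑ j, pd f j x ^ 2 := Finset.sum_nonneg fun j _ => sq_nonneg _
  have : ‖fderiv ℝ f x‖ ≤ Real.sqrt (∑ j, pd f j x ^ 2) := by
    apply ContinuousLinearMap.opNorm_le_bound _ (Real.sqrt_nonneg _)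
    intro z
    rw [fderiv_sum3, Real.norm_eq_abs, EuclideanSpace.norm_eq, ← Real.sqrt_mul h0]
    apply Real.abs_le_sqrt
    simp only [Real.norm_eq_abs, sq_abs]
    rw [mul_comm]
    exact Finset.sum_mul_sq_le_sq_mul_sq _ _ _
  calc _ ≤ Real.sqrt (∑ j, pd f j x ^ 2) ^ 2 := by gcongr
    _ = _ := Real.sq_sqrt h0

lemma sob : ∃ C : ℝ, 0 ≤ C ∧ ∀ (f : R3 → ℝ) (E : Set R3), ContDiff ℝ (⊤ : ℕ∞) f → HasCompactSupport f →
    Bornology.IsBounded E → lpS f 6 E ^ 2 ≤ C * ∫ x, ∑ j, pd f j x ^ 2 := by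
  refine ⟨(SNormLESNormFDerivOfEqConst ℝ (volume : Measure R3) 2 : ℝ) ^ 2, by positivity, ?_⟩
  intro f E hf hc hE
  set K := SNormLESNormFDerivOfEqConst ℝ (volume : Measure R3) 2
  have h := eLpNorm_le_eLpNorm_fderiv_of_eq (volume : Measure R3) (u := f) (p := 2) (p' := 6) (hf.of_le (by exact_mod_cast le_top)) hc
    (by norm_num) (by simp) (by simp; norm_num)
  have h2 : ENNReal.ofReal (lpS f 6 E) ≤ eLpNorm f 6 volume := by
    rw [ofReal_lpS hf.continuous (by norm_num) hE]
    refine le_trans (le_of_eq ?_) (eLpNorm_restrict_le f 6 volume E)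
    rw [eLpNorm_eq_lintegral_rpow_enorm_toReal (by norm_num) (by norm_num)]
    norm_num
  have hpi := fun j => (pd_smooth hf j).continuous
  have hint : Integrable (fun x => ∑ j, pd f j x ^ 2) := by
    refine integrable_finsetSum _ fun j _ => ?_
    have h8 : HasCompactSupport (fun x => pd f j x ^ 2) := by
      exact (pd_supp hc j).comp_left (g := fun t : ℝ => t ^ 2) (by simp)
    have := hpi j
    exact (by fun_prop : Continuous _).integrable_of_hasCompactSupport h8
  have h3 : eLpNorm (fderiv ℝ f) 2 volume ≤ ENNReal.ofReal ((∫ x, ∑ j, pd f j x ^ 2) ^ (1 / 2 : ℝ)) := by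
    rw [eLpNorm_eq_lintegral_rpow_enorm_toReal (by norm_num) (by norm_num)]
    rw [← ENNReal.ofReal_rpow_of_nonneg (integral_nonneg fun x => Finset.sum_nonneg fun j _ => sq_nonneg _) (by norm_num),
      ofReal_integral_eq_lintegral_ofReal hint (Eventually.of_forall fun x => Finset.sum_nonneg fun j _ => sq_nonneg _)]
    norm_num
    gcongr with x
    rw [← ofReal_norm_eq_enorm, ← ENNReal.ofReal_pow (norm_nonneg _)]
    exact ENNReal.ofReal_le_ofReal (fderiv_sq_le f x)
  have h4 : ENNReal.ofReal (lpS f 6 E) ≤ ENNReal.ofReal (K * (∫ x, ∑ j, pd f j x ^ 2) ^ (1 / 2 : ℝ)) := by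
    rw [ENNReal.ofReal_mul (by positivity), ENNReal.ofReal_coe_nnreal]
    refine h2.trans (h.trans ?_)
    exact mul_le_mul' (le_of_eq rfl) h3
  have hI0 : 0 ≤ ∫ x, ∑ j, pd f j x ^ 2 := integral_nonneg fun x => Finset.sum_nonneg fun j _ => sq_nonneg _
  rw [ENNReal.ofReal_le_ofReal_iff (by positivity)] at h4
  calc lpS f 6 E ^ 2 ≤ (K * (∫ x, ∑ j, pd f j x ^ 2) ^ (1 / 2 : ℝ)) ^ 2 := by
        have := lpS_nonneg f 6 E
        gcongr
    _ = _ := by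
      rw [mul_pow, ← Real.sqrt_eq_rpow, Real.sq_sqrt hI0]

lemma lpS_sq (f : R3 → ℝ) (E : Set R3) : lpS f 2 E ^ 2 = ∫ x in E, f x ^ 2 := by
  have := lpS_rpow (f := f) (p := 2) (by norm_num) E
  rw [Real.rpow_two] at this
  rw [this]; simp

lemma sob_cut {C₁ : ℝ} : ∃ C : ℝ, 0 ≤ C ∧ ∀ (f φ : R3 → ℝ) (R ρ d : ℝ), 
    0 < R → 0 < d → 7 * R / 4 ≤ ρ → ρ + d ≤ 2 * R → ContDiff ℝ (⊤ : ℕ∞) f → Cut C₁ ρ d φ →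
    lpS f 6 (ball 0 ρ) ^ 2 ≤ C * ((∫ x, φ x * ∑ j, pd f j x ^ 2) + (d ^ 2)⁻¹ * lpS f 2 (sh R (ρ + d)) ^ 2) := by
  obtain ⟨C, hC0, hC⟩ := sob
  refine ⟨C * (2 + 6 * C₁ ^ 2), by positivity, ?_⟩
  intro f φ R ρ d hR hd h1 h2 hf hφ
  have hs := hφ.smooth
  have hfφ : ContDiff ℝ (⊤ : ℕ∞) (fun x => φ x * f x) := hs.mul hf
  have hcs : HasCompactSupport (fun x => φ x * f x) := hφ.hasCS.mul_right
  have k1 : lpS f 6 (ball 0 ρ) ≤ lpS (fun x => φ x * f x) 6 (ball 0 ρ) := by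
    apply lpS_mono hf.continuous hfφ.continuous (by norm_num) measurableSet_ball isBounded_ball
    intro x hx
    rw [hφ.one x (by simp at hx; exact hx.le), one_mul]
  have k2 := hC _ (ball 0 ρ) hfφ hcs isBounded_ball
  have hD := geo_SS hR hd h1 h2
  set D := sh R (ρ + d)
  have c1 := fun j => (pd_smooth hf j).continuous
  have c2 := hf.continuous
  have c3 := hs.continuous
  have i1 : Integrable (fun x => φ x * ∑ j, pd f j x ^ 2) := 
    (by fun_prop : Continuous _).integrable_of_hasCompactSupport hφ.hasCS.mul_right
  have i2 : Integrable (D.indicator fun x => f x ^ 2) := by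
    rw [integrable_indicator_iff hD.mD]
    exact integrableOn_cont (by fun_prop) hD.bD
  have k3 : ∫ x, ∑ j, pd (fun x => φ x * f x) j x ^ 2 ≤
      ∫ x, (2 * (φ x * ∑ j, pd f j x ^ 2) + 6 * (C₁ / d) ^ 2 * D.indicator (fun x => f x ^ 2) x) := by
    apply integral_mono_of_nonneg
    · exact Eventually.of_forall fun x => Finset.sum_nonneg fun j _ => sq_nonneg _
    · exact (i1.const_mul 2).add (i2.const_mul _)
    · refine Eventually.of_forall fun x => ?_
      simp only [pd_mul' (smooth_diff hs) (smooth_diff hf)]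
      have p0 := hφ.nonneg x
      have p1 := hφ.le_one x
      by_cases hx : x ∈ SS ρ d
      · rw [Set.indicator_of_mem (hD.sub hx)]
        have q : ∀ j, (pd φ j x * f x + φ x * pd f j x) ^ 2 ≤ 2 * (C₁ / d) ^ 2 * f x ^ 2 + 2 * (φ x * pd f j x ^ 2) := by
          intro j
          have a1 : pd φ j x ^ 2 ≤ (C₁ / d) ^ 2 := by
            rw [← sq_abs]; gcongr; exact hφ.d1 j x
          have a2 : φ x ^ 2 * pd f j x ^ 2 ≤ φ x * pd f j x ^ 2 := by
            gcongr; nlinarith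
          have a3 : pd φ j x ^ 2 * f x ^ 2 ≤ (C₁ / d) ^ 2 * f x ^ 2 := by gcongr
          nlinarith [sq_nonneg (pd φ j x * f x - φ x * pd f j x)]
        have := q 0
        have := q 1
        have := q 2
        simp only [Fin.sum_univ_three]
        nlinarith
      · have q : ∀ j, (pd φ j x * f x + φ x * pd f j x) ^ 2 ≤ 2 * (φ x * pd f j x ^ 2) := by
          intro j
          rw [hφ.pd_zero j x hx]
          have a2 : φ x ^ 2 * pd f j x ^ 2 ≤ φ x * pd f j x ^ 2 := by
            gcongr; nlinarith
          have : 0 ≤ φ x * pd f j x ^ 2 := by positivity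
          nlinarith
        have := q 0
        have := q 1
        have := q 2
        have : 0 ≤ 6 * (C₁ / d) ^ 2 * D.indicator (fun x => f x ^ 2) x :=
          mul_nonneg (by positivity) (Set.indicator_nonneg (fun _ _ => sq_nonneg _) _)
        simp only [Fin.sum_univ_three] at *
        nlinarith
  rw [integral_add (i1.const_mul 2) (i2.const_mul _), integral_const_mul, integral_const_mul,
    integral_indicator hD.mD, ← lpS_sq] at k3
  have hI : 0 ≤ ∫ x, φ x * ∑ j, pd f j x ^ 2 := integral_nonneg fun x => mul_nonneg (hφ.nonneg x) (Finset.sum_nonneg fun j _ => sq_nonneg _)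
  have k0 := lpS_nonneg f 6 (ball 0 ρ)
  calc _ ≤ lpS (fun x => φ x * f x) 6 (ball 0 ρ) ^ 2 := by gcongr
    _ ≤ _ := k2
    _ ≤ C * (2 * (∫ x, φ x * ∑ j, pd f j x ^ 2) + 6 * (C₁ / d) ^ 2 * lpS f 2 D ^ 2) := by gcongr
    _ = C * (2 * (∫ x, φ x * ∑ j, pd f j x ^ 2) + 6 * C₁ ^ 2 * ((d ^ 2)⁻¹ * lpS f 2 D ^ 2)) := by
      rw [div_pow]; field_simp
    _ ≤ _ := by
      rw [mul_assoc C (2 + 6 * C₁ ^ 2)]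
      have : 0 ≤ (d ^ 2)⁻¹ * lpS f 2 D ^ 2 := by positivity
      apply mul_le_mul_of_nonneg_left _ hC0
      nlinarith [mul_nonneg (sq_nonneg C₁) hI]

lemma lpS_vec6 {u : R3 → R3} (hu : Continuous u) {E : Set R3} (hE : Bornology.IsBounded E) :
    lpS (fun x => ‖u x‖) 6 E ^ 2 ≤ 3 * ∑ i, lpS (fun x => u x i) 6 E ^ 2 := by
  have hui : ∀ i, Continuous fun x => u x i := fun i => by fun_prop
  have h1 : ∀ f : R3 → ℝ, lpS f 6 E ^ 6 = ∫ x in E, |f x| ^ 6 := by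
    intro f
    have := lpS_rpow (f := f) (p := 6) (by norm_num) E
    exact_mod_cast this
  have h2 : lpS (fun x => ‖u x‖) 6 E ^ 6 ≤ 9 * ∑ i, lpS (fun x => u x i) 6 E ^ 6 := by
    simp only [h1]
    rw [← integral_finsetSum, ← integral_const_mul]
    · have hn : ∀ x, |‖u x‖| ^ 6 ≤ 9 * ∑ i, |u x i| ^ 6 := by
        intro x
        have e : |‖u x‖| ^ 6 = (∑ i, u x i ^ 2) ^ 3 := by
          rw [abs_of_nonneg (norm_nonneg _), ← EuclideanSpace.real_norm_sq_eq]; ring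
        have e2 : ∀ i, |u x i| ^ 6 = (u x i ^ 2) ^ 3 := fun i => by rw [← sq_abs]; ring
        rw [e]
        simp only [e2, Fin.sum_univ_three]
        have := sq_nonneg (u x 0)
        have := sq_nonneg (u x 1)
        have := sq_nonneg (u x 2)
        generalize (u x 0) ^ 2 = a at *
        generalize (u x 1) ^ 2 = b at *
        generalize (u x 2) ^ 2 = c at *
        nlinarith [mul_nonneg (add_nonneg ‹0 ≤ a› ‹0 ≤ b›) (sq_nonneg (a - b)), mul_nonneg (add_nonneg ‹0 ≤ b› ‹0 ≤ c›) (sq_nonneg (b - c)), mul_nonneg (add_nonneg ‹0 ≤ a› ‹0 ≤ c›) (sq_nonneg (a - c)), mul_nonneg ‹0 ≤ a› (sq_nonneg (b - c)), mul_nonneg ‹0 ≤ b› (sq_nonneg (a - c)), mul_nonneg ‹0 ≤ c› (sq_nonneg (a - b))]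
      apply integral_mono
      · exact integrableOn_cont (by fun_prop) hE
      · exact (integrableOn_cont (f := fun x => 9 * ∑ i, |u x i| ^ 6) (by fun_prop) hE)
      · exact hn
    · exact fun i _ => integrableOn_cont (f := fun x => |u x i| ^ 6) (by fun_prop) hE
  have h3 : (lpS (fun x => ‖u x‖) 6 E ^ 2) ^ 3 ≤ (3 * ∑ i, lpS (fun x => u x i) 6 E ^ 2) ^ 3 := by
    calc _ = lpS (fun x => ‖u x‖) 6 E ^ 6 := by ring
      _ ≤ _ := h2
      _ = 9 * ∑ i, (lpS (fun x => u x i) 6 E ^ 2) ^ 3 := by congr 1; exact Finset.sum_congr rfl fun i _ => by ring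
      _ ≤ _ := by
        simp only [Fin.sum_univ_three]
        have := sq_nonneg (lpS (fun x => u x 0) 6 E)
        have := sq_nonneg (lpS (fun x => u x 1) 6 E)
        have := sq_nonneg (lpS (fun x => u x 2) 6 E)
        generalize (lpS (fun x => u x 0) 6 E) ^ 2 = a at *
        generalize (lpS (fun x => u x 1) 6 E) ^ 2 = b at *
        generalize (lpS (fun x => u x 2) 6 E) ^ 2 = c at *
        have : a ^ 3 + b ^ 3 + c ^ 3 ≤ (a + b + c) ^ 3 := by
          have e : (a + b + c) ^ 3 = a ^ 3 + b ^ 3 + c ^ 3 + (3 * a ^ 2 * b + 3 * a ^ 2 * c + 3 * b ^ 2 * a + 3 * b ^ 2 * c + 3 * c ^ 2 * a + 3 * c ^ 2 * b + 6 * a * b * c) := by ring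
          rw [e]; apply le_add_of_nonneg_right; positivity
        have : 0 ≤ (a + b + c) ^ 3 := by positivity
        nlinarith
  exact le_of_pow_le_pow_left₀ (by norm_num) (by positivity) h3


lemma coord_le (a : R3) (j : Fin 3) : |a j| ≤ ‖a‖ := by
  have := PiLp.norm_apply_le a j
  simpa using this

lemma grads_nonneg (u v : R3 → R3) (θ : R3 → ℝ) (x : R3) : 0 ≤ grads u v θ x := by
  unfold grads; positivity

lemma grads_cont {u v : R3 → R3} {θ : R3 → ℝ} (hu : ContDiff ℝ (⊤ : ℕ∞) u) (hv : ContDiff ℝ (⊤ : ℕ∞) v)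
    (hθ : ContDiff ℝ (⊤ : ℕ∞) θ) : Continuous (grads u v θ) := by
  have h1 := fun i j => (pd_smooth (comp_smooth hu i) j).continuous
  have h2 := fun i j => (pd_smooth (comp_smooth hv i) j).continuous
  have h3 := fun j => (pd_smooth hθ j).continuous
  unfold grads
  fun_prop

lemma cs_sqrt (a : R3) (b : Fin 3 → ℝ) (G : ℝ) (h : ∑ i, b i ^ 2 ≤ G) : |∑ i, a i * b i| ≤ ‖a‖ * Real.sqrt G := by
  have h0 : 0 ≤ ∑ i, b i ^ 2 := by positivity
  calc |∑ i, a i * b i| ≤ Real.sqrt ((∑ i, a i ^ 2) * ∑ i, b i ^ 2) :=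
        Real.abs_le_sqrt (Finset.sum_mul_sq_le_sq_mul_sq _ _ _)
    _ = ‖a‖ * Real.sqrt (∑ i, b i ^ 2) := by
        rw [Real.sqrt_mul (by positivity), EuclideanSpace.norm_eq]; simp
    _ ≤ _ := by gcongr

lemma col_u (u v : R3 → R3) (θ : R3 → ℝ) (x : R3) (j : Fin 3) : ∑ i, pd (fun y => u y i) j x ^ 2 ≤ grads u v θ x := by
  unfold grads
  have : ∑ i, pd (fun y => u y i) j x ^ 2 ≤ ∑ i, ∑ j, pd (fun y => u y i) j x ^ 2 :=
    Finset.sum_le_sum fun i _ => Finset.single_le_sum (f := fun j => pd (fun y => u y i) j x ^ 2) (fun _ _ => sq_nonneg _) (Finset.mem_univ j)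
  have : 0 ≤ (∑ i, ∑ j, pd (fun y => v y i) j x ^ 2) := by positivity
  have : 0 ≤ ∑ j, pd θ j x ^ 2 := by positivity
  linarith

lemma col_v (u v : R3 → R3) (θ : R3 → ℝ) (x : R3) (j : Fin 3) : ∑ i, pd (fun y => v y i) j x ^ 2 ≤ grads u v θ x := by
  have := col_u v u θ x j
  unfold grads at *
  linarith

lemma col_θ (u v : R3 → R3) (θ : R3 → ℝ) (x : R3) (j : Fin 3) : |pd θ j x| ≤ Real.sqrt (grads u v θ x) := by
  apply Real.abs_le_sqrt
  unfold grads
  have : pd θ j x ^ 2 ≤ ∑ j, pd θ j x ^ 2 := 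
    Finset.single_le_sum (f := fun j => pd θ j x ^ 2) (fun _ _ => sq_nonneg _) (Finset.mem_univ j)
  have : 0 ≤ (∑ i, ∑ j, pd (fun y => v y i) j x ^ 2) := by positivity
  have : 0 ≤ (∑ i, ∑ j, pd (fun y => u y i) j x ^ 2) := by positivity
  linarith

def hh (u v : R3 → R3) (θ : R3 → ℝ) (x : R3) : ℝ :=
  (‖u x‖ + ‖v x‖ + |θ x|) * Real.sqrt (grads u v θ x) + ‖u x‖ ^ 3 + ‖u x‖ * ‖v x‖ ^ 2 + ‖u x‖ * θ x ^ 2 + |θ x| * ‖v x‖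

lemma hh_nonneg (u v : R3 → R3) (θ : R3 → ℝ) (x : R3) : 0 ≤ hh u v θ x := by
  unfold hh; positivity

lemma flux_bd (u v : R3 → R3) (pr θ : R3 → ℝ) (j : Fin 3) (x : R3) :
    |flux u v pr θ j x + pr x * u x j| ≤ 2 * hh u v θ x := by
  have a1 := cs_sqrt (u x) (fun i => pd (fun y => u y i) j x) _ (col_u u v θ x j)
  have a2 := cs_sqrt (v x) (fun i => pd (fun y => v y i) j x) _ (col_v u v θ x j)
  have a3 : |θ x * pd θ j x| ≤ |θ x| * Real.sqrt (grads u v θ x) := by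
    rw [abs_mul]; exact mul_le_mul_of_nonneg_left (col_θ u v θ x j) (abs_nonneg _)
  have e : ∀ a : R3, ∑ i, a i * a i = ‖a‖ ^ 2 := fun a => by
    rw [EuclideanSpace.real_norm_sq_eq]; exact Finset.sum_congr rfl fun i _ => by ring
  have a4 : |(2⁻¹ * ((∑ i, u x i * u x i) + (∑ i, v x i * v x i) + θ x * θ x)) * u x j| ≤
      2⁻¹ * (‖u x‖ ^ 2 + ‖v x‖ ^ 2 + θ x ^ 2) * ‖u x‖ := by
    rw [e, e, abs_mul, ← sq, abs_of_nonneg (by positivity)]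
    exact mul_le_mul_of_nonneg_left (coord_le _ _) (by positivity)
  have a5 : |(∑ i, u x i * v x i) * v x j| ≤ ‖u x‖ * ‖v x‖ * ‖v x‖ := by
    have := cs_sqrt (u x) (fun i => v x i) (‖v x‖ ^ 2) (by rw [EuclideanSpace.real_norm_sq_eq])
    rw [Real.sqrt_sq (norm_nonneg _)] at this
    rw [abs_mul]
    exact mul_le_mul this (coord_le _ _) (abs_nonneg _) (by positivity)
  have a6 : |θ x * v x j| ≤ |θ x| * ‖v x‖ := by
    rw [abs_mul]; exact mul_le_mul_of_nonneg_left (coord_le _ _) (abs_nonneg _)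
  unfold flux hh
  have b0 : 0 ≤ Real.sqrt (grads u v θ x) := Real.sqrt_nonneg _
  have n1 := norm_nonneg (u x)
  have n2 := norm_nonneg (v x)
  have n3 := abs_nonneg (θ x)
  have p1 := mul_nonneg n1 b0
  have p2 := mul_nonneg n2 b0
  have p3 := mul_nonneg n3 b0
  have p4 := pow_nonneg n1 3
  have p5 := mul_nonneg n1 (sq_nonneg ‖v x‖)
  have p6 := mul_nonneg n1 (sq_nonneg (θ x))
  have p7 := mul_nonneg n3 n2
  rw [abs_le] at *
  constructor <;> nlinarith

lemma lpS_sqrt {u v : R3 → R3} {θ : R3 → ℝ} {D : Set R3} :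
    lpS (fun x => Real.sqrt (grads u v θ x)) 2 D ^ 2 = ∫ x in D, grads u v θ x := by
  rw [lpS_sq]
  congr 1; ext x
  exact Real.sq_sqrt (grads_nonneg u v θ x)

lemma lpS_sqrt_le {u v : R3 → R3} {θ : R3 → ℝ} {D : Set R3} {M : ℝ} (hM : 0 ≤ M) (h : ∫ x in D, grads u v θ x ≤ M ^ 2) :
    lpS (fun x => Real.sqrt (grads u v θ x)) 2 D ≤ M := by
  rw [← lpS_sqrt] at h
  exact le_of_pow_le_pow_left₀ (by norm_num) hM h

lemma Q_bd {C₁ : ℝ} {u v : R3 → R3} {pr θ : R3 → ℝ} {φ : R3 → ℝ} {R ρ d M : ℝ}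
    (hu : ContDiff ℝ (⊤ : ℕ∞) u) (hv : ContDiff ℝ (⊤ : ℕ∞) v)
    (hpr : ContDiff ℝ (⊤ : ℕ∞) pr) (hθ : ContDiff ℝ (⊤ : ℕ∞) θ)
    (hsol : TCM u v pr θ) (hR : 0 < R) (hd : 0 < d) (h1 : 7 * R / 4 ≤ ρ) (h2 : ρ + d ≤ 2 * R)
    (hφ : Cut C₁ ρ d φ) (hM : 0 ≤ M) (hG : ∫ x in sh R (ρ + d), grads u v θ x ≤ M ^ 2) :
    ∫ x, φ x * grads u v θ x ≤ (∫ x, gfun u φ x * pr x) + 6 * C₁ / d *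
     ((lpS (fun x => ‖u x‖) 2 (sh R (ρ + d)) + lpS (fun x => ‖v x‖) 2 (sh R (ρ + d)) + lpS θ 2 (sh R (ρ + d))) * M
      + (∫ x in sh R (ρ + d), ‖u x‖ ^ 3) + (∫ x in sh R (ρ + d), ‖u x‖ * ‖v x‖ ^ 2)
      + (∫ x in sh R (ρ + d), ‖u x‖ * θ x ^ 2) + ∫ x in sh R (ρ + d), |θ x| * ‖v x‖) := by
  have hD := geo_SS hR hd h1 h2
  have hC1 : 0 ≤ C₁ / d := (abs_nonneg _).trans (hφ.d1 0 0)
  rw [energy_id hu hv hpr hθ hsol hφ.smooth hφ.hasCS]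
  set D := sh R (ρ + d)
  have cu := hu.continuous
  have cv := hv.continuous
  have cθ := hθ.continuous
  have cg : Continuous (fun x => Real.sqrt (grads u v θ x)) := (grads_cont hu hv hθ).sqrt
  have ch : Continuous (hh u v θ) := by unfold hh; fun_prop
  have cf := fun j => (flux_smooth hu hv hpr hθ j).continuous
  have cp := fun j => (pd_smooth hφ.smooth j).continuous
  have cpr := hpr.continuous
  have ig : Integrable (fun x => gfun u φ x * pr x) := by
    apply ((gfun_smooth hu hφ.smooth).continuous.mul cpr).integrable_of_hasCompactSupport
    apply HasCompactSupport.mul_right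
    refine HasCompactSupport.intro (isCompact_closedBall (0:R3) (ρ + d)) fun x hx => ?_
    unfold gfun
    apply Finset.sum_eq_zero; intro j _
    rw [hφ.pd_zero j x, mul_zero]
    intro hx2
    have := hD.sub hx2
    rw [mem_sh] at this
    simp at hx; linarith [this.1]
  have ifl : Integrable (fun x => ∑ j, pd φ j x * flux u v pr θ j x) :=
    integrable_finsetSum _ fun j _ => ((cp j).mul (cf j)).integrable_of_hasCompactSupport
      ((pd_supp hφ.hasCS j).mul_right)
  have key : - (∫ x, ∑ j, pd φ j x * flux u v pr θ j x) - (∫ x, gfun u φ x * pr x) ≤ 6 * C₁ / d * ∫ x in D, hh u v θ x := by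
    have ifn : Integrable (fun x => -∑ j, pd φ j x * flux u v pr θ j x) := ifl.neg
    rw [← integral_neg, ← integral_sub ifn ig, ← integral_const_mul, ← integral_indicator hD.mD]
    apply integral_mono (ifn.sub ig)
    · rw [integrable_indicator_iff hD.mD]
      exact integrableOn_cont (by fun_prop) hD.bD
    · intro x
      have e : -(∑ j, pd φ j x * flux u v pr θ j x) - gfun u φ x * pr x =
          ∑ j, - (pd φ j x * (flux u v pr θ j x + pr x * u x j)) := by
        unfold gfun; simp only [Fin.sum_univ_three]; ring
      refine (le_of_eq e).trans ?_
      by_cases hx : x ∈ SS ρ d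
      · rw [Set.indicator_of_mem (hD.sub hx)]
        have : ∀ j ∈ Finset.univ, - (pd φ j x * (flux u v pr θ j x + pr x * u x j)) ≤ C₁ / d * (2 * hh u v θ x) := by
          intro j _
          refine (neg_le_abs _).trans ?_
          rw [abs_mul]
          exact mul_le_mul (hφ.d1 j x) (flux_bd u v pr θ j x) (abs_nonneg _) hC1
        refine (Finset.sum_le_sum this).trans (le_of_eq ?_)
        simp; ring
      · have : ∀ j ∈ Finset.univ, - (pd φ j x * (flux u v pr θ j x + pr x * u x j)) = 0 := by
          intro j _
          rw [hφ.pd_zero j x hx]; ring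
        rw [Finset.sum_eq_zero this]
        apply Set.indicator_nonneg
        intro y _
        have := hh_nonneg u v θ y
        rw [mul_div_assoc]; positivity
  have hsq := lpS_sqrt_le hM hG
  have hol : ∀ f : R3 → ℝ, Continuous f → ∫ x in D, |f x| * Real.sqrt (grads u v θ x) ≤ lpS f 2 D * M := by
    intro f hf
    have := holder2 hf cg Real.HolderConjugate.two_two hD.bD
    have e : ∀ x, |Real.sqrt (grads u v θ x)| = Real.sqrt (grads u v θ x) := fun x => abs_of_nonneg (Real.sqrt_nonneg _)
    simp only [e] at this
    exact this.trans (mul_le_mul_of_nonneg_left hsq (lpS_nonneg _ _ _))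
  have o1 := hol _ cu.norm
  have o2 := hol _ cv.norm
  have o3 := hol _ cθ
  simp only [abs_norm] at o1 o2
  have sp : ∫ x in D, hh u v θ x = (∫ x in D, ‖u x‖ * Real.sqrt (grads u v θ x)) + (∫ x in D, ‖v x‖ * Real.sqrt (grads u v θ x))
      + (∫ x in D, |θ x| * Real.sqrt (grads u v θ x)) + (∫ x in D, ‖u x‖ ^ 3) + (∫ x in D, ‖u x‖ * ‖v x‖ ^ 2)
      + (∫ x in D, ‖u x‖ * θ x ^ 2) + ∫ x in D, |θ x| * ‖v x‖ := by
    have I : ∀ {f : R3 → ℝ}, Continuous f → Integrable f (volume.restrict D) := fun hf => integrableOn_cont hf hD.bD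
    rw [← integral_add (I (by fun_prop)) (I (by fun_prop)), ← integral_add (I (by fun_prop)) (I (by fun_prop)), ← integral_add (I (by fun_prop)) (I (by fun_prop)), ← integral_add (I (by fun_prop)) (I (by fun_prop)), ← integral_add (I (by fun_prop)) (I (by fun_prop)), ← integral_add (I (by fun_prop)) (I (by fun_prop))]
    congr 1; ext x; unfold hh; ring
  have : 6 * C₁ / d * ∫ x in D, hh u v θ x ≤ 6 * C₁ / d * ((lpS (fun x => ‖u x‖) 2 D + lpS (fun x => ‖v x‖) 2 D + lpS θ 2 D) * M
      + (∫ x in D, ‖u x‖ ^ 3) + (∫ x in D, ‖u x‖ * ‖v x‖ ^ 2)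
      + (∫ x in D, ‖u x‖ * θ x ^ 2) + ∫ x in D, |θ x| * ‖v x‖) := by
    apply mul_le_mul_of_nonneg_left _ (by rw [mul_div_assoc]; positivity)
    rw [sp]; linarith
  linarith


lemma gfun_cs {C₁ : ℝ} {u : R3 → R3} {φ : R3 → ℝ} {ρ d : ℝ} (hφ : Cut C₁ ρ d φ) : HasCompactSupport (gfun u φ) := by
  refine HasCompactSupport.intro (K := closedBall (0:R3) (ρ + d / 2)) (isCompact_closedBall _ _) fun x hx => ?_
  unfold gfun
  apply Finset.sum_eq_zero; intro j _
  rw [hφ.pd_zero j x, mul_zero]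
  intro hx2
  simp at hx
  have := hx2.2
  linarith

lemma gfun_SS {C₁ : ℝ} {u : R3 → R3} {φ : R3 → ℝ} {ρ d : ℝ} (hφ : Cut C₁ ρ d φ) (x : R3) (hx : x ∉ SS ρ d) : gfun u φ x = 0 := by
  unfold gfun
  apply Finset.sum_eq_zero; intro j _
  rw [hφ.pd_zero j x hx, mul_zero]

lemma lpS_const_mul {c : ℝ} (hc : 0 ≤ c) (f : R3 → ℝ) {s : ℝ} (hs : 0 < s) (E : Set R3) :
    lpS (fun x => c * f x) s E = c * lpS f s E := by
  unfold lpS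
  have : ∀ x, |c * f x| ^ s = c ^ s * |f x| ^ s := fun x => by
    rw [abs_mul, abs_of_nonneg hc, Real.mul_rpow hc (abs_nonneg _)]
  simp_rw [this, integral_const_mul]
  rw [Real.mul_rpow (by positivity) (by positivity), ← Real.rpow_mul hc, mul_one_div_cancel hs.ne', Real.rpow_one]

lemma gfun_lp {C₁ : ℝ} {u : R3 → R3} (hu : ContDiff ℝ (⊤ : ℕ∞) u) {φ : R3 → ℝ} {ρ d : ℝ} (hφ : Cut C₁ ρ d φ)
    {s : ℝ} (hs : 0 < s) {E : Set R3} (hE : MeasurableSet E) (hb : Bornology.IsBounded E) :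
    lpS (gfun u φ) s E ≤ 3 * (C₁ / d) * lpS (fun x => ‖u x‖) s E := by
  have hC1 : 0 ≤ C₁ / d := (abs_nonneg _).trans (hφ.d1 0 0)
  have cu := hu.continuous
  rw [← lpS_const_mul (by positivity) _ hs]
  apply lpS_mono (gfun_smooth hu hφ.smooth).continuous (by fun_prop) hs hE hb
  intro x _
  rw [abs_of_nonneg (a := 3 * (C₁ / d) * ‖u x‖) (by positivity)]
  unfold gfun
  have : ∀ j, |u x j * pd φ j x| ≤ ‖u x‖ * (C₁ / d) := fun j => by
    rw [abs_mul]; exact mul_le_mul (coord_le _ _) (hφ.d1 j x) (abs_nonneg _) (norm_nonneg _)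
  refine (Finset.abs_sum_le_sum_abs _ _).trans ((Finset.sum_le_sum fun j _ => this j).trans (le_of_eq ?_))
  simp; ring

lemma gfun_grad {C₁ : ℝ} {u v : R3 → R3} {θ : R3 → ℝ} (hu : ContDiff ℝ (⊤ : ℕ∞) u) (hv : ContDiff ℝ (⊤ : ℕ∞) v)
    (hθ : ContDiff ℝ (⊤ : ℕ∞) θ) {φ : R3 → ℝ} {ρ d M : ℝ} (hd : 0 < d) (hφ : Cut C₁ ρ d φ)
    {E : Set R3} (hb : Bornology.IsBounded E) (hM : 0 ≤ M) (hG : ∫ x in E, grads u v θ x ≤ M ^ 2) (j : Fin 3) :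
    lpS (pd (gfun u φ) j) 2 E ≤ 5 * (C₁ / d) * (M + lpS (fun x => ‖u x‖) 2 E / d) := by
  have hC1 : 0 ≤ C₁ / d := (abs_nonneg _).trans (hφ.d1 0 0)
  have hC1' : 0 ≤ C₁ := by
    have := mul_nonneg hC1 hd.le
    rwa [div_mul_cancel₀ _ hd.ne'] at this
  have cu := hu.continuous
  have cg := grads_cont hu hv hθ
  have n1 := lpS_nonneg (fun x => ‖u x‖) 2 E
  have e : ∀ x, pd (gfun u φ) j x = ∑ k, (pd (fun y => u y k) j x * pd φ k x + u x k * pd (pd φ k) j x) := by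
    intro x
    have d1 := fun k => smooth_diff (comp_smooth hu k)
    have d2 := fun k => smooth_diff (pd_smooth hφ.smooth k)
    have e1 : gfun u φ = fun x => (u x 0 * pd φ 0 x + u x 1 * pd φ 1 x) + u x 2 * pd φ 2 x := by
      ext y; unfold gfun; simp only [Fin.sum_univ_three]
    have d3 := fun k => smooth_diff ((comp_smooth hu k).mul (pd_smooth hφ.smooth k))
    rw [e1, pd_add' (smooth_diff (((comp_smooth hu 0).mul (pd_smooth hφ.smooth 0)).add ((comp_smooth hu 1).mul (pd_smooth hφ.smooth 1)))) (d3 2),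
      pd_add' (d3 0) (d3 1), pd_mul' (d1 0) (d2 0), pd_mul' (d1 1) (d2 1), pd_mul' (d1 2) (d2 2)]
    simp only [Fin.sum_univ_three]
  have pw : ∀ x, pd (gfun u φ) j x ^ 2 ≤ 18 * (C₁ / d) ^ 2 * grads u v θ x + 18 * (C₁ / d ^ 2) ^ 2 * ‖u x‖ ^ 2 := by
    intro x
    have h := col_u u v θ x j
    have hb : ∀ k, |pd (fun y => u y k) j x| ≤ Real.sqrt (grads u v θ x) := fun k => by
      apply Real.abs_le_sqrt
      exact (Finset.single_le_sum (f := fun k => pd (fun y => u y k) j x ^ 2) (fun _ _ => sq_nonneg _) (Finset.mem_univ k)).trans h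
    have h3 : |pd (gfun u φ) j x| ≤ 3 * (C₁ / d * Real.sqrt (grads u v θ x) + C₁ / d ^ 2 * ‖u x‖) := by
      rw [e]
      have : ∀ k, |pd (fun y => u y k) j x * pd φ k x + u x k * pd (pd φ k) j x| ≤ C₁ / d * Real.sqrt (grads u v θ x) + C₁ / d ^ 2 * ‖u x‖ := by
        intro k
        refine (abs_add_le _ _).trans ?_
        rw [abs_mul, abs_mul, mul_comm (C₁ / d), mul_comm (C₁ / d ^ 2)]
        exact add_le_add (mul_le_mul (hb k) (hφ.d1 k x) (abs_nonneg _) (Real.sqrt_nonneg _))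
          (mul_le_mul (coord_le _ _) (hφ.d2 k j x) (abs_nonneg _) (norm_nonneg _))
      refine (Finset.abs_sum_le_sum_abs _ _).trans ((Finset.sum_le_sum fun k _ => this k).trans (le_of_eq ?_))
      simp; ring
    have h4 : pd (gfun u φ) j x ^ 2 ≤ (3 * (C₁ / d * Real.sqrt (grads u v θ x) + C₁ / d ^ 2 * ‖u x‖)) ^ 2 := by
      rw [← sq_abs]
      exact pow_le_pow_left₀ (abs_nonneg _) h3 2
    have h5 := Real.sq_sqrt (grads_nonneg u v θ x)
    have h6 : 18 * (C₁ / d) ^ 2 * grads u v θ x = 18 * (C₁ / d * Real.sqrt (grads u v θ x)) ^ 2 := by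
      rw [mul_pow, h5]; ring
    rw [h6]
    nlinarith [sq_nonneg (C₁ / d * Real.sqrt (grads u v θ x) - C₁ / d ^ 2 * ‖u x‖)]
  have sm := (pd_smooth (gfun_smooth hu hφ.smooth) j).continuous
  have h7 : lpS (pd (gfun u φ) j) 2 E ^ 2 ≤ 18 * (C₁ / d) ^ 2 * M ^ 2 + 18 * (C₁ / d ^ 2) ^ 2 * lpS (fun x => ‖u x‖) 2 E ^ 2 := by
    rw [lpS_sq, lpS_sq]
    calc _ ≤ ∫ x in E, (18 * (C₁ / d) ^ 2 * grads u v θ x + 18 * (C₁ / d ^ 2) ^ 2 * ‖u x‖ ^ 2) :=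
          integral_mono (integrableOn_cont (by fun_prop) hb) (integrableOn_cont (by fun_prop) hb) pw
      _ = 18 * (C₁ / d) ^ 2 * (∫ x in E, grads u v θ x) + 18 * (C₁ / d ^ 2) ^ 2 * ∫ x in E, ‖u x‖ ^ 2 := by
          rw [integral_add (integrableOn_cont (by fun_prop) hb) (integrableOn_cont (by fun_prop) hb), integral_const_mul, integral_const_mul]
      _ ≤ _ := by
          have := mul_le_mul_of_nonneg_left hG (show 0 ≤ 18 * (C₁ / d) ^ 2 by positivity)
          linarith
  refine le_of_pow_le_pow_left₀ (n := 2) (by norm_num) (by positivity) (h7.trans ?_)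
  have e2 : C₁ / d ^ 2 = C₁ / d * (1 / d) := by field_simp
  rw [e2]
  set N := lpS (fun x => ‖u x‖) 2 E
  have : 0 ≤ N / d := by positivity
  have e3 : 18 * (C₁ / d) ^ 2 * M ^ 2 + 18 * (C₁ / d * (1 / d)) ^ 2 * N ^ 2 = (C₁ / d) ^ 2 * (18 * (M ^ 2 + (N / d) ^ 2)) := by ring
  have e4 : (5 * (C₁ / d) * (M + N / d)) ^ 2 = (C₁ / d) ^ 2 * (25 * (M + N / d) ^ 2) := by ring
  rw [e3, e4]
  apply mul_le_mul_of_nonneg_left _ (by positivity)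
  nlinarith [mul_nonneg hM this]

lemma lpS_prod {w : R3 → R3} (hw : Continuous w) {E : Set R3} (hE : MeasurableSet E) (hb : Bornology.IsBounded E)
    {a : ℝ} (ha : 0 < a) (i j : Fin 3) :
    lpS (fun y => w y i * w y j) a E ≤ lpS (fun x => ‖w x‖) (2 * a) E ^ 2 := by
  have : lpS (fun x => ‖w x‖) (2 * a) E ^ 2 = lpS (fun x => ‖w x‖ ^ 2) a E := by
    unfold lpS
    have e : ∀ x, |‖w x‖| ^ (2 * a) = |‖w x‖ ^ 2| ^ a := fun x => by
      rw [Real.rpow_mul (abs_nonneg _), abs_pow]; norm_cast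
    simp_rw [e]
    rw [← Real.rpow_natCast, ← Real.rpow_mul (by positivity)]
    congr 1; push_cast; field_simp
  rw [this]
  apply lpS_mono (by fun_prop) (by fun_prop) ha hE hb
  intro x _
  rw [abs_mul, abs_of_nonneg (sq_nonneg ‖w x‖), sq]
  exact mul_le_mul (coord_le _ _) (coord_le _ _) (abs_nonneg _) (norm_nonneg _)

lemma lpS_pd_le {u v : R3 → R3} {θ : R3 → ℝ} (hu : ContDiff ℝ (⊤ : ℕ∞) u) (hv : ContDiff ℝ (⊤ : ℕ∞) v)
    (hθ : ContDiff ℝ (⊤ : ℕ∞) θ) {M : ℝ}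
    {E : Set R3} (hE : MeasurableSet E) (hb : Bornology.IsBounded E) (hM : 0 ≤ M) (hG : ∫ x in E, grads u v θ x ≤ M ^ 2) (i j : Fin 3) :
    lpS (pd (fun y => u y i) j) 2 E ≤ M := by
  refine le_trans ?_ (lpS_sqrt_le hM hG)
  have := grads_cont hu hv hθ
  apply lpS_mono (pd_smooth (comp_smooth hu i) j).continuous (by fun_prop) (by norm_num) hE hb
  intro x _
  rw [abs_of_nonneg (Real.sqrt_nonneg _)]
  apply Real.abs_le_sqrt
  exact (Finset.single_le_sum (f := fun k => pd (fun y => u y k) j x ^ 2) (fun _ _ => sq_nonneg _) (Finset.mem_univ i)).trans (col_u u v θ x j)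

/-- pressure decomposition -/
lemma press_split {C₁ : ℝ} {u v : R3 → R3} {pr θ : R3 → ℝ} {φ : R3 → ℝ} {ρ d : ℝ}
    (hu : ContDiff ℝ (⊤ : ℕ∞) u) (hv : ContDiff ℝ (⊤ : ℕ∞) v)
    (hpr : ContDiff ℝ (⊤ : ℕ∞) pr)
    (hsol : TCM u v pr θ) (hφ : Cut C₁ ρ d φ) (δ : ℝ) :
    |∫ x, gfun u φ x * pr x| ≤ (∑ i, ∑ j, (|∫ s in (0:ℝ)..δ, JJ (gfun u φ) (kk i) (pd (pd (fun y => u y i) j) j) s|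
      + |∫ s in (0:ℝ)..δ, JJ (gfun u φ) (kk i) (pd (fun y => u y i * u y j) j) s|
      + |∫ s in (0:ℝ)..δ, JJ (gfun u φ) (kk i) (pd (fun y => v y j * v y i) j) s|)) + |JJ (gfun u φ) eta pr δ| := by
  have hg := (gfun_smooth hu hφ.smooth).continuous
  have hgc := gfun_cs (u := u) hφ
  have r := rep hg eta_smooth.continuous hpr hgc eta_supp δ
  rw [JJ_eta_zero] at r
  have k0 : ∀ i, (fun z => eta z * z i) = kk i := fun i => rfl
  simp only [k0] at r
  have kc := fun i => (kk_smooth i).continuous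
  have ks := fun i => kk_supp i
  have s1 := fun i j => (pd_smooth (pd_smooth (comp_smooth hu i) j) j).continuous
  have s2 := fun i j => (pd_smooth ((comp_smooth hu i).mul (comp_smooth hu j)) j).continuous
  have s3 := fun i j => (pd_smooth ((comp_smooth hv j).mul (comp_smooth hv i)) j).continuous
  have e : ∀ i s, JJ (gfun u φ) (kk i) (pd pr i) s = ∑ j, (JJ (gfun u φ) (kk i) (pd (pd (fun y => u y i) j) j) s
     - JJ (gfun u φ) (kk i) (pd (fun y => u y i * u y j) j) s - JJ (gfun u φ) (kk i) (pd (fun y => v y j * v y i) j) s) := by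
    intro i s
    have t12 : ∀ j, Continuous (fun x => pd (pd (fun y => u y i) j) j x - pd (fun y => u y i * u y j) j x) := fun j => (s1 i j).sub (s2 i j)
    have t : ∀ j, Continuous (fun x => pd (pd (fun y => u y i) j) j x - pd (fun y => u y i * u y j) j x - pd (fun y => v y j * v y i) j x) := fun j => (t12 j).sub (s3 i j)
    have : pd pr i = fun x => ∑ j, (pd (pd (fun y => u y i) j) j x - pd (fun y => u y i * u y j) j x
      - pd (fun y => v y j * v y i) j x) := funext fun x => pd_pr hu hsol i x
    rw [this, JJ_sum (f := fun j x => pd (pd (fun y => u y i) j) j x - pd (fun y => u y i * u y j) j x - pd (fun y => v y j * v y i) j x) _ hg (kc i) t hgc (ks i)]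
    refine Finset.sum_congr rfl fun j _ => ?_
    rw [JJ_sub hg (kc i) (t12 j) (s3 i j) hgc (ks i), JJ_sub hg (kc i) (s1 i j) (s2 i j) hgc (ks i)]
  have c1 := fun i j => JJ_cont hg (kc i) (s1 i j) hgc (ks i)
  have c2 := fun i j => JJ_cont hg (kc i) (s2 i j) hgc (ks i)
  have c3 := fun i j => JJ_cont hg (kc i) (s3 i j) hgc (ks i)
  have e2 : ∀ i, ∫ s in (0:ℝ)..δ, JJ (gfun u φ) (kk i) (pd pr i) s = ∑ j, ((∫ s in (0:ℝ)..δ, JJ (gfun u φ) (kk i) (pd (pd (fun y => u y i) j) j) s)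
      - (∫ s in (0:ℝ)..δ, JJ (gfun u φ) (kk i) (pd (fun y => u y i * u y j) j) s)
      - ∫ s in (0:ℝ)..δ, JJ (gfun u φ) (kk i) (pd (fun y => v y j * v y i) j) s) := by
    intro i
    simp_rw [e]
    rw [intervalIntegral.integral_finsetSum]
    · refine Finset.sum_congr rfl fun j _ => ?_
      have c12 : Continuous fun s => JJ (gfun u φ) (kk i) (pd (pd (fun y => u y i) j) j) s
        - JJ (gfun u φ) (kk i) (pd (fun y => u y i * u y j) j) s := (c1 i j).sub (c2 i j)
      rw [intervalIntegral.integral_sub (c12.intervalIntegrable _ _) ((c3 i j).intervalIntegrable _ _),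
        intervalIntegral.integral_sub ((c1 i j).intervalIntegrable _ _) ((c2 i j).intervalIntegrable _ _)]
    · intro j _
      exact (((c1 i j).sub (c2 i j)).sub (c3 i j)).intervalIntegrable _ _
  simp_rw [e2] at r
  have r2 : ∫ x, gfun u φ x * pr x = (∑ i, ∑ j, ((∫ s in (0:ℝ)..δ, JJ (gfun u φ) (kk i) (pd (pd (fun y => u y i) j) j) s)
      - (∫ s in (0:ℝ)..δ, JJ (gfun u φ) (kk i) (pd (fun y => u y i * u y j) j) s)
      - ∫ s in (0:ℝ)..δ, JJ (gfun u φ) (kk i) (pd (fun y => v y j * v y i) j) s)) + JJ (gfun u φ) eta pr δ := by linarith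
  rw [r2]
  refine (abs_add_le _ _).trans ?_
  gcongr
  refine (Finset.abs_sum_le_sum_abs _ _).trans (Finset.sum_le_sum fun i _ => (Finset.abs_sum_le_sum_abs _ _).trans (Finset.sum_le_sum fun j _ => ?_))
  refine (abs_sub _ _).trans ?_
  gcongr
  exact abs_sub _ _


structure NB (u v : R3 → R3) (θ : R3 → ℝ) (p l lam K σ R τ M Xb W : ℝ) : Prop where
  M0 : 0 < M
  X0 : 0 < Xb
  W_eq : W = Xb ^ (1 - l) * M ^ l
  W_le : W ^ 3 ≤ K * (R * M ^ (3 * l))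
  G : ∫ x in sh R τ, grads u v θ x ≤ M ^ 2
  up : lpS (fun x => ‖u x‖) p (sh R τ) ≤ Xb
  u3 : lpS (fun x => ‖u x‖) 3 (sh R τ) ≤ W
  u2 : lpS (fun x => ‖u x‖) 2 (sh R τ) ≤ K * (R ^ (5 / 6 : ℝ) * M ^ l)
  u2s : lpS (fun x => ‖u x‖) 2 (sh R τ) ≤ K * (R * M)
  v2 : lpS (fun x => ‖v x‖) 2 (sh R τ) ≤ K * R
  v2s : lpS (fun x => ‖v x‖) 2 (sh R τ) ≤ K * (R * M)
  t2 : lpS θ 2 (sh R τ) ≤ K * R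
  t2s : lpS θ 2 (sh R τ) ≤ K * (R * M)
  v3 : lpS (fun x => ‖v x‖) 3 (sh R τ) ^ 2 ≤ K * R
  uv : lpS (fun x => ‖u x‖) p (sh R τ) * lpS (fun x => ‖v x‖) (2 * (p / (p - 1))) (sh R τ) ^ 2 ≤ K * R ^ (1 - σ)
  u1 : lpS (fun x => ‖u x‖) 1 (sh R τ) ≤ K * (R ^ (3 / 2 : ℝ) * lpS (fun x => ‖u x‖) 2 (sh R τ))
  vol : volume.real (sh R τ) ^ (1 / 2 : ℝ) ≤ K * R ^ (3 / 2 : ℝ)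
  uuu : lpS (fun x => ‖u x‖) 1 (sh R τ) * lpS (fun x => ‖u x‖) 2 (sh R τ) ^ 2 ≤ K * (R ^ 4 * M ^ (3 * l))
  uvv : lpS (fun x => ‖u x‖) 1 (sh R τ) * lpS (fun x => ‖v x‖) 2 (sh R τ) ^ 2 ≤ K * R ^ (4 - σ)
  ut : ∫ x in sh R τ, ‖u x‖ * θ x ^ 2 ≤ K * (R * M ^ (2 * lam))
  tv : ∫ x in sh R τ, |θ x| * ‖v x‖ ≤ K * R ^ (1 - σ)

structure CX (C₁ : ℝ) (u v : R3 → R3) (pr θ φ : R3 → ℝ) (p l lam K σ R ρ d M Xb W : ℝ) : Prop where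
  hu : ContDiff ℝ (⊤ : ℕ∞) u
  hv : ContDiff ℝ (⊤ : ℕ∞) v
  hpr : ContDiff ℝ (⊤ : ℕ∞) pr
  hθ : ContDiff ℝ (⊤ : ℕ∞) θ
  hsol : TCM u v pr θ
  hR : 4 ≤ R
  hd : 0 < d
  h1 : 7 * R / 4 ≤ ρ
  h2 : ρ + d ≤ 2 * R
  hφ : Cut C₁ ρ d φ
  nb : NB u v θ p l lam K σ R (ρ + d) M Xb W
  p1 : 3 / 2 < p
  p2 : p < 3
  hl : l = 2 * (3 - p) / (6 - p)
  K1 : 1 ≤ K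
  C1 : 0 ≤ C₁

namespace CX
variable {C₁ : ℝ} {u v : R3 → R3} {pr θ φ : R3 → ℝ} {p l lam K σ R ρ d M Xb W : ℝ}

lemma geo (h : CX C₁ u v pr θ φ p l lam K σ R ρ d M Xb W) : Geo (SS ρ d) (sh R (ρ + d)) (d / 4) :=
  geo_SS (by linarith [h.hR]) h.hd h.h1 h.h2

lemma dR (h : CX C₁ u v pr θ φ p l lam K σ R ρ d M Xb W) : d ≤ R / 4 := by
  linarith [h.h1, h.h2]

lemma L4 (h : CX C₁ u v pr θ φ p l lam K σ R ρ d M Xb W) : 4 ≤ R / d := by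
  have := h.hd
  rw [le_div_iff₀ this]; linarith [h.dR]

/-- gradient of g : general -/
lemma gg (h : CX C₁ u v pr θ φ p l lam K σ R ρ d M Xb W) (j : Fin 3) :
    lpS (pd (gfun u φ) j) 2 (sh R (ρ + d)) ≤ 5 * (C₁ / d) * (M + lpS (fun x => ‖u x‖) 2 (sh R (ρ + d)) / d) :=
  gfun_grad h.hu h.hv h.hθ h.hd h.hφ h.geo.bD h.nb.M0.le h.nb.G j

lemma gg' (h : CX C₁ u v pr θ φ p l lam K σ R ρ d M Xb W) (j : Fin 3) :
    lpS (pd (gfun u φ) j) 2 (sh R (ρ + d)) ≤ 10 * C₁ * K * (R / d) * M / d := by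
  refine (h.gg j).trans ?_
  have h1 : lpS (fun x => ‖u x‖) 2 (sh R (ρ + d)) / d ≤ K * (R / d) * M := by
    have := h.nb.u2s
    have hd := h.hd
    rw [div_le_iff₀ hd]
    calc _ ≤ _ := this
      _ = _ := by field_simp
  have h2 : M ≤ K * (R / d) * M := by
    have a := h.L4
    have b := h.K1
    have c := h.nb.M0
    have : 1 ≤ K * (R / d) := by nlinarith
    nlinarith
  have hd := h.hd
  have := h.C1
  calc _ ≤ 5 * (C₁ / d) * (K * (R / d) * M + K * (R / d) * M) := by gcongr
    _ = _ := by ring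

lemma gl (h : CX C₁ u v pr θ φ p l lam K σ R ρ d M Xb W) {s : ℝ} (hs : 0 < s) :
    lpS (gfun u φ) s (sh R (ρ + d)) ≤ 3 * (C₁ / d) * lpS (fun x => ‖u x‖) s (sh R (ρ + d)) :=
  gfun_lp h.hu h.hφ hs h.geo.mD h.geo.bD

end CX

lemma split_int {g f : R3 → ℝ} {i j : Fin 3} (hg : ContDiff ℝ (⊤ : ℕ∞) g) (hf : ContDiff ℝ (⊤ : ℕ∞) f) (hgc : HasCompactSupport g)
    (ε δ : ℝ) : |∫ s in (0:ℝ)..δ, JJ g (kk i) (pd f j) s| ≤ |∫ s in (0:ℝ)..ε, JJ g (kk i) (pd f j) s| + |∫ s in ε..δ, JJ g (kk i) (pd f j) s| := by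
  have c := JJ_cont hg.continuous (kk_smooth i).continuous (pd_smooth hf j).continuous hgc (kk_supp i)
  rw [← intervalIntegral.integral_add_adjacent_intervals (b := ε) (c.intervalIntegrable _ _) (c.intervalIntegrable _ _)]
  exact abs_add_le _ _

lemma press1 (C₁ K : ℝ) : ∃ C : ℝ, 0 ≤ C ∧ ∀ (u v : R3 → R3) (pr θ φ : R3 → ℝ) (p l lam σ R ρ d M Xb W : ℝ),
    CX C₁ u v pr θ φ p l lam K σ R ρ d M Xb W → ∀ i j,
    |∫ s in (0:ℝ)..(d / 4), JJ (gfun u φ) (kk i) (pd (pd (fun y => u y i) j) j) s| ≤ C * (R⁻¹ * M ^ 2 + R / d * M ^ (1 + l)) := by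
  obtain ⟨Cn, hn0, hn⟩ := near_bd
  obtain ⟨Cf, hf0, hf⟩ := far_log
  refine ⟨Cn * 5 * |C₁| * (1 + |K|) + Cf * 18 * |C₁| * |K|, by positivity, ?_⟩
  intro u v pr θ φ p l lam σ R ρ d M Xb W h i j
  have hR := h.hR
  have hd := h.hd
  have hM := h.nb.M0
  have hK := h.K1
  have hC := h.C1
  rw [abs_of_nonneg hC, abs_of_nonneg (by linarith : 0 ≤ K)]
  have hR0 : 0 < R := by linarith
  have hg := gfun_smooth h.hu h.hφ.smooth
  have hgc := gfun_cs (u := u) h.hφ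
  have hF := pd_smooth (comp_smooth h.hu i) j
  have hε : d / R ≤ d / 4 := by gcongr
  have a1 := hn i j (gfun u φ) (pd (fun y => u y i) j) (SS ρ d) (sh R (ρ + d)) (d / 4) (d / R) 2 2 0 hg hF hgc h.geo (gfun_SS h.hφ)
    (by positivity) hε (by norm_num) (by norm_num) (by norm_num) le_rfl (by norm_num)
  have a2 := hf i j (gfun u φ) (pd (fun y => u y i) j) (SS ρ d) (sh R (ρ + d)) (d / 4) (d / R) 2 2 hg hF hgc h.geo (gfun_SS h.hφ)
    (by positivity) hε (by norm_num) (by norm_num) (by norm_num)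
  have b1 := lpS_pd_le h.hu h.hv h.hθ h.geo.mD h.geo.bD hM.le h.nb.G i j
  have b2 := h.gg j
  have b3 := h.gl (s := 2) (by norm_num)
  have n0 := lpS_nonneg (fun x => ‖u x‖) 2 (sh R (ρ + d))
  have u2 := h.nb.u2
  have hMl : 0 < M ^ l := by positivity
  have e1 : M ^ (1 + l) = M * M ^ l := by rw [Real.rpow_add hM, Real.rpow_one]
  have r1 : R ^ (5 / 6 : ℝ) ≤ R := by
    calc R ^ (5 / 6 : ℝ) ≤ R ^ (1 : ℝ) := Real.rpow_le_rpow_of_exponent_le (by linarith) (by norm_num)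
      _ = R := Real.rpow_one R
  simp only [mul_zero, sub_zero, div_one, Real.rpow_one] at a1
  have c1 : |∫ s in (0:ℝ)..(d / R), JJ (gfun u φ) (kk i) (pd (pd (fun y => u y i) j) j) s| ≤
      Cn * 5 * C₁ * (1 + K) * (R⁻¹ * M ^ 2 + R / d * M ^ (1 + l)) := by
    calc _ ≤ _ := a1
      _ ≤ Cn * (d / R) * (5 * (C₁ / d) * (M + lpS (fun x => ‖u x‖) 2 (sh R (ρ + d)) / d) * M) := by
        apply mul_le_mul_of_nonneg_left _ (by positivity)
        exact mul_le_mul b2 b1 (lpS_nonneg _ _ _) (by positivity)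
      _ ≤ Cn * (d / R) * (5 * (C₁ / d) * (M + (K * (R * M ^ l)) / d) * M) := by
        have : lpS (fun x => ‖u x‖) 2 (sh R (ρ + d)) ≤ K * (R * M ^ l) := u2.trans (by gcongr)
        gcongr
      _ = Cn * 5 * C₁ * (R⁻¹ * M ^ 2 + K * ((1 / d) * (M * M ^ l))) := by field_simp
      _ ≤ Cn * 5 * C₁ * ((1 + K) * (R⁻¹ * M ^ 2 + R / d * (M * M ^ l))) := by
        apply mul_le_mul_of_nonneg_left _ (by positivity)
        have q1 : 0 ≤ R⁻¹ * M ^ 2 := by positivity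
        have q2 : 0 ≤ (1 / d) * (M * M ^ l) := by positivity
        have q3 : (1 / d) * (M * M ^ l) ≤ R / d * (M * M ^ l) := by gcongr; linarith
        nlinarith
      _ = _ := by rw [e1]; ring
  have lg : Real.log (d / 4 / (d / R)) ≤ 6 * R ^ (1 / 6 : ℝ) := by
    have e : d / 4 / (d / R) = R / 4 := by field_simp
    rw [e]
    calc Real.log (R / 4) ≤ Real.log R := Real.log_le_log (by positivity) (by linarith)
      _ ≤ R ^ (1 / 6 : ℝ) / (1 / 6) := Real.log_le_rpow_div hR0.le (by norm_num)
      _ = _ := by ring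
  have c2 : |∫ s in (d / R)..(d / 4), JJ (gfun u φ) (kk i) (pd (pd (fun y => u y i) j) j) s| ≤
      Cf * 18 * C₁ * K * (R⁻¹ * M ^ 2 + R / d * M ^ (1 + l)) := by
    calc _ ≤ _ := a2
      _ ≤ Cf * (6 * R ^ (1 / 6 : ℝ)) * (3 * (C₁ / d) * (K * (R ^ (5 / 6 : ℝ) * M ^ l)) * M) := by
        have lp : 0 ≤ lpS (gfun u φ) 2 (sh R (ρ + d)) * lpS (pd (fun y => u y i) j) 2 (sh R (ρ + d)) := mul_nonneg (lpS_nonneg _ _ _) (lpS_nonneg _ _ _)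
        apply mul_le_mul _ _ lp (by positivity)
        · exact mul_le_mul_of_nonneg_left lg hf0
        · exact mul_le_mul (b3.trans (mul_le_mul_of_nonneg_left u2 (by positivity))) b1 (lpS_nonneg _ _ _) (by positivity)
      _ = Cf * 18 * C₁ * K * ((R ^ (1 / 6 : ℝ) * R ^ (5 / 6 : ℝ)) / d * (M * M ^ l)) := by ring
      _ = Cf * 18 * C₁ * K * (R / d * M ^ (1 + l)) := by
        rw [← Real.rpow_add hR0, e1]; norm_num
      _ ≤ _ := by
        apply mul_le_mul_of_nonneg_left _ (by positivity)
        have q1 : 0 ≤ R⁻¹ * M ^ 2 := by positivity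
        linarith
  have := split_int (i := i) (j := j) hg hF hgc (d / R) (d / 4)
  linarith


lemma press3 (C₁ K p σ : ℝ) (hσ : 0 < σ) : ∃ C : ℝ, 0 ≤ C ∧ ∀ (u v : R3 → R3) (pr θ φ : R3 → ℝ) (l lam R ρ d M Xb W : ℝ),
    CX C₁ u v pr θ φ p l lam K σ R ρ d M Xb W → ∀ i j,
    |∫ s in (0:ℝ)..(d / 4), JJ (gfun u φ) (kk i) (pd (fun y => v y j * v y i) j) s| ≤ C * ((R / d) ^ 2 * M + R / d * R ^ (-(σ / 2))) := by
  obtain ⟨Cn, hn0, hn⟩ := near_bd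
  obtain ⟨Cf, hf0, hf⟩ := far_log
  refine ⟨2 * Cn * (10 * |C₁| * |K| * |K|) + Cf * (2 / σ) * 3 * |C₁| * |K|, by positivity, ?_⟩
  intro u v pr θ φ l lam R ρ d M Xb W h i j
  have hR := h.hR
  have hd := h.hd
  have hM := h.nb.M0
  have hK := h.K1
  have hC := h.C1
  have hp1 := h.p1
  rw [abs_of_nonneg hC, abs_of_nonneg (by linarith : 0 ≤ K)]
  have hR0 : 0 < R := by linarith
  have hg := gfun_smooth h.hu h.hφ.smooth
  have hgc := gfun_cs (u := u) h.hφ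
  have hF := (comp_smooth h.hv j).mul (comp_smooth h.hv i)
  have hε : d / R ≤ d / 4 := by gcongr
  have hpp : 0 < p / (p - 1) := div_pos (by linarith) (by linarith)
  have a1 := hn i j (gfun u φ) (fun y => v y j * v y i) (SS ρ d) (sh R (ρ + d)) (d / 4) (d / R) (3 / 2) 2 (1 / 6) hg hF hgc h.geo (gfun_SS h.hφ)
    (by positivity) hε (by norm_num) (by norm_num) (by norm_num) (by norm_num) (by norm_num)
  have a2 := hf i j (gfun u φ) (fun y => v y j * v y i) (SS ρ d) (sh R (ρ + d)) (d / 4) (d / R) (p / (p - 1)) p hg hF hgc h.geo (gfun_SS h.hφ)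
    (by positivity) hε (by rw [le_div_iff₀ (by linarith)]; linarith) (by linarith) (by
      have : p - 1 ≠ 0 := by linarith
      field_simp; ring)
  have b1 := lpS_prod h.hv.continuous h.geo.mD h.geo.bD (a := 3 / 2) (by norm_num) j i
  rw [show (2 * (3 / 2) : ℝ) = 3 by norm_num] at b1
  have b1' := lpS_prod h.hv.continuous h.geo.mD h.geo.bD hpp j i
  have b2 := h.gg' j
  have b3 := h.gl (s := p) (by linarith)
  have n0 := lpS_nonneg (fun x => ‖u x‖) p (sh R (ρ + d))
  have v3 := h.nb.v3
  have uv := h.nb.uv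
  have hRs : 0 < R ^ (-(σ / 2)) := by positivity
  have c1 : |∫ s in (0:ℝ)..(d / R), JJ (gfun u φ) (kk i) (pd (fun y => v y j * v y i) j) s| ≤
      2 * Cn * (10 * C₁ * K * K) * ((R / d) ^ 2 * M + R / d * R ^ (-(σ / 2))) := by
    have ep : (d / R) ^ (1 - 3 * (1 / 6) : ℝ) ≤ 1 := by
      apply Real.rpow_le_one (by positivity) _ (by norm_num)
      rw [div_le_one hR0]; linarith [h.dR]
    calc _ ≤ _ := a1
      _ ≤ Cn / (1 - 3 * (1 / 6)) * 1 * (10 * C₁ * K * (R / d) * M / d * (K * R)) := by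
        apply mul_le_mul _ _ (mul_nonneg (lpS_nonneg _ _ _) (lpS_nonneg _ _ _)) (by norm_num; positivity)
        · exact mul_le_mul_of_nonneg_left ep (by norm_num; positivity)
        · exact mul_le_mul b2 (b1.trans v3) (lpS_nonneg _ _ _) (by positivity)
      _ = 2 * Cn * (10 * C₁ * K * K) * ((R / d) ^ 2 * M) := by ring
      _ ≤ _ := by
        apply mul_le_mul_of_nonneg_left _ (by positivity)
        have : 0 ≤ R / d * R ^ (-(σ / 2)) := by positivity
        linarith
  have lg : Real.log (d / 4 / (d / R)) ≤ 2 / σ * R ^ (σ / 2) := by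
    have e : d / 4 / (d / R) = R / 4 := by field_simp
    rw [e]
    calc Real.log (R / 4) ≤ Real.log R := Real.log_le_log (by positivity) (by linarith)
      _ ≤ R ^ (σ / 2) / (σ / 2) := Real.log_le_rpow_div hR0.le (by positivity)
      _ = _ := by field_simp
  have c2 : |∫ s in (d / R)..(d / 4), JJ (gfun u φ) (kk i) (pd (fun y => v y j * v y i) j) s| ≤
      Cf * (2 / σ) * 3 * C₁ * K * ((R / d) ^ 2 * M + R / d * R ^ (-(σ / 2))) := by
    calc _ ≤ _ := a2
      _ ≤ Cf * (2 / σ * R ^ (σ / 2)) * (3 * (C₁ / d) * lpS (fun x => ‖u x‖) p (sh R (ρ + d)) * lpS (fun x => ‖v x‖) (2 * (p / (p - 1))) (sh R (ρ + d)) ^ 2) := by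
        apply mul_le_mul _ _ (mul_nonneg (lpS_nonneg _ _ _) (lpS_nonneg _ _ _)) (by positivity)
        · exact mul_le_mul_of_nonneg_left lg hf0
        · exact mul_le_mul b3 b1' (lpS_nonneg _ _ _) (by positivity)
      _ ≤ Cf * (2 / σ * R ^ (σ / 2)) * (3 * (C₁ / d) * (K * R ^ (1 - σ))) := by
        apply mul_le_mul_of_nonneg_left _ (by positivity)
        rw [mul_assoc (3 * (C₁ / d))]
        exact mul_le_mul_of_nonneg_left uv (by positivity)
      _ = Cf * (2 / σ) * 3 * C₁ * K * (1 / d * (R ^ (σ / 2) * R ^ (1 - σ))) := by ring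
      _ = Cf * (2 / σ) * 3 * C₁ * K * (R / d * R ^ (-(σ / 2))) := by
        rw [← Real.rpow_add hR0, show σ / 2 + (1 - σ) = 1 + -(σ / 2) by ring, Real.rpow_add hR0, Real.rpow_one]; ring
      _ ≤ _ := by
        apply mul_le_mul_of_nonneg_left _ (by positivity)
        have : 0 ≤ (R / d) ^ 2 * M := by positivity
        linarith
  have := split_int (i := i) (j := j) hg hF hgc (d / R) (d / 4)
  linarith

lemma press2 (C₁ K p : ℝ) : ∃ C : ℝ, 0 ≤ C ∧ ∀ (u v : R3 → R3) (pr θ φ : R3 → ℝ) (l lam σ R ρ d M Xb W : ℝ),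
    CX C₁ u v pr θ φ p l lam K σ R ρ d M Xb W → ∀ i j,
    |∫ s in (0:ℝ)..(d / 4), JJ (gfun u φ) (kk i) (pd (fun y => u y i * u y j) j) s| ≤ C * ((R / d) ^ 2 * M ^ (3 * l)) := by
  obtain ⟨Cn, hn0, hn⟩ := near_bd
  obtain ⟨Cf, hf0, hf⟩ := far_pos
  refine ⟨2 * Cn * 10 * |C₁| * |K| * |K| + Cf * |(3 * (1 / p - 1 / 3))|⁻¹ * 3 * |C₁| * |K|, by positivity, ?_⟩
  intro u v pr θ φ l lam σ R ρ d M Xb W h i j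
  have hR := h.hR
  have hd := h.hd
  have hM := h.nb.M0
  have hX := h.nb.X0
  have hK := h.K1
  have hC := h.C1
  have hp1 := h.p1
  have hp2 := h.p2
  have hp0 : 0 < p := by linarith
  have ht : 0 < 1 / p - 1 / 3 := by
    have : 1 / 3 < 1 / p := one_div_lt_one_div_of_lt hp0 hp2
    linarith
  rw [abs_of_nonneg hC, abs_of_nonneg (by linarith : 0 ≤ K), abs_of_nonneg (by positivity : 0 ≤ 3 * (1 / p - 1 / 3))]
  have hR0 : 0 < R := by linarith
  have hW : 0 < W := by rw [h.nb.W_eq]; positivity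
  have hg := gfun_smooth h.hu h.hφ.smooth
  have hgc := gfun_cs (u := u) h.hφ
  have hF := (comp_smooth h.hu i).mul (comp_smooth h.hu j)
  obtain ⟨ε0, hε0⟩ : ∃ ε0, ε0 = (W / M) ^ 2 := ⟨_, rfl⟩
  have he0 : 0 < ε0 := by rw [hε0]; positivity
  have es : ε0 ^ (1 - 3 * (1 / 6) : ℝ) = W / M := by
    rw [hε0, ← Real.rpow_natCast, ← Real.rpow_mul (by positivity)]; norm_num
  have ef : ε0 ^ (-3 * (1 / p - 1 / 3)) * Xb = W := by
    have hWM : W / M = (Xb / M) ^ (1 - l) := by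
      rw [h.nb.W_eq, Real.div_rpow hX.le hM.le, Real.rpow_sub hM, Real.rpow_one]
      field_simp
    rw [hε0, hWM, ← Real.rpow_natCast, ← Real.rpow_mul (by positivity), ← Real.rpow_mul (by positivity)]
    have : (1 - l) * ((2:ℕ) * (-3 * (1 / p - 1 / 3))) = - l := by
      rw [h.hl]
      have : 6 - p ≠ 0 := by linarith
      push_cast
      field_simp; ring
    rw [this, Real.div_rpow hX.le hM.le, h.nb.W_eq, Real.rpow_sub hX, Real.rpow_one, Real.rpow_neg hX.le, Real.rpow_neg hM.le]
    field_simp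
  have b1 := lpS_prod h.hu.continuous h.geo.mD h.geo.bD (a := 3 / 2) (by norm_num) i j
  rw [show (2 * (3 / 2) : ℝ) = 3 by norm_num] at b1
  have b1' : lpS (fun y => u y i * u y j) (3 / 2) (sh R (ρ + d)) ≤ W ^ 2 :=
    b1.trans (pow_le_pow_left₀ (lpS_nonneg _ _ _) h.nb.u3 2)
  have b2 := h.gg' j
  have b3 := (h.gl (s := p) (by linarith)).trans (mul_le_mul_of_nonneg_left h.nb.up (by positivity))
  have hL := h.L4
  have near : ∀ ε, 0 < ε → ε ≤ d / 4 → ε ≤ ε0 → |∫ s in (0:ℝ)..ε, JJ (gfun u φ) (kk i) (pd (fun y => u y i * u y j) j) s| ≤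
      2 * Cn * 10 * C₁ * K * K * ((R / d) ^ 2 * M ^ (3 * l)) := by
    intro ε h0 h1 h2
    have a1 := hn i j (gfun u φ) (fun y => u y i * u y j) (SS ρ d) (sh R (ρ + d)) (d / 4) ε (3 / 2) 2 (1 / 6) hg hF hgc h.geo (gfun_SS h.hφ)
      h0 h1 (by norm_num) (by norm_num) (by norm_num) (by norm_num) (by norm_num)
    calc _ ≤ _ := a1
      _ ≤ Cn / (1 - 3 * (1 / 6)) * (W / M) * (10 * C₁ * K * (R / d) * M / d * W ^ 2) := by
        apply mul_le_mul _ _ (mul_nonneg (lpS_nonneg _ _ _) (lpS_nonneg _ _ _)) (by norm_num; positivity)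
        · apply mul_le_mul_of_nonneg_left _ (by norm_num; positivity)
          rw [← es]
          exact Real.rpow_le_rpow h0.le h2 (by norm_num)
        · exact mul_le_mul b2 b1' (lpS_nonneg _ _ _) (by positivity)
      _ = 2 * Cn * 10 * C₁ * K * ((R / d) / d * W ^ 3) := by field_simp; ring
      _ ≤ 2 * Cn * 10 * C₁ * K * ((R / d) / d * (K * (R * M ^ (3 * l)))) := by
        have := h.nb.W_le
        gcongr
      _ = _ := by ring
  rcases le_total ε0 (d / 4) with hc | hc
  · have a2 := hf i j (gfun u φ) (fun y => u y i * u y j) (SS ρ d) (sh R (ρ + d)) (d / 4) ε0 (3 / 2) p (1 / p - 1 / 3) hg hF hgc h.geo (gfun_SS h.hφ)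
      he0 hc (by norm_num) (by linarith) (by ring) ht
    have c1 := near ε0 he0 hc le_rfl
    have c2 : |∫ s in ε0..(d / 4), JJ (gfun u φ) (kk i) (pd (fun y => u y i * u y j) j) s| ≤
        Cf * (3 * (1 / p - 1 / 3))⁻¹ * 3 * C₁ * K * ((R / d) ^ 2 * M ^ (3 * l)) := by
      obtain ⟨t, ht'⟩ : ∃ t, t = 1 / p - 1 / 3 := ⟨_, rfl⟩
      rw [← ht'] at a2 ht ef ⊢
      calc _ ≤ _ := a2
        _ ≤ Cf / (3 * t) * ε0 ^ (-3 * t) * (3 * (C₁ / d) * Xb * W ^ 2) := by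
          apply mul_le_mul_of_nonneg_left _ (by positivity)
          exact mul_le_mul b3 b1' (lpS_nonneg _ _ _) (by positivity)
        _ = Cf * (3 * t)⁻¹ * 3 * C₁ * ((1 / d) * ((ε0 ^ (-3 * t) * Xb) * W ^ 2)) := by
          rw [div_eq_mul_inv]; ring
        _ = Cf * (3 * t)⁻¹ * 3 * C₁ * ((1 / d) * (W ^ 3)) := by rw [ef]; ring
        _ ≤ Cf * (3 * t)⁻¹ * 3 * C₁ * ((1 / d) * (K * (R * M ^ (3 * l)))) := by
          have := h.nb.W_le
          gcongr
        _ = Cf * (3 * t)⁻¹ * 3 * C₁ * K * ((R / d) * M ^ (3 * l)) := by ring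
        _ ≤ _ := by
          apply mul_le_mul_of_nonneg_left _ (by positivity)
          apply mul_le_mul_of_nonneg_right _ (by positivity)
          nlinarith
    have := split_int (i := i) (j := j) hg hF hgc ε0 (d / 4)
    linarith
  · have := near (d / 4) (by positivity) le_rfl hc
    have h9 : 0 ≤ Cf * (3 * (1 / p - 1 / 3))⁻¹ * 3 * C₁ * K * ((R / d) ^ 2 * M ^ (3 * l)) := by positivity
    linarith


lemma lpS_one (f : R3 → ℝ) (E : Set R3) : lpS f 1 E = ∫ x in E, |f x| := by
  simp [lpS]

lemma lpS_tri {f g h : R3 → ℝ} (hf : Continuous f) (hg : Continuous g) (hh : Continuous h) {E : Set R3} (hb : Bornology.IsBounded E) :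
    lpS (fun x => f x - g x - h x) 1 E ≤ lpS f 1 E + lpS g 1 E + lpS h 1 E := by
  simp only [lpS_one]
  have I : ∀ {f : R3 → ℝ}, Continuous f → Integrable f (volume.restrict E) := fun hf => integrableOn_cont hf hb
  rw [← integral_add (I (by fun_prop)) (I (by fun_prop)), ← integral_add (I (by fun_prop)) (I (by fun_prop))]
  apply integral_mono (I (by fun_prop)) (I (by fun_prop))
  intro x
  exact (abs_sub _ _).trans (add_le_add_left (abs_sub _ _) _)

lemma press4 (C₁ K : ℝ) : ∃ C : ℝ, 0 ≤ C ∧ ∀ (u v : R3 → R3) (pr θ φ : R3 → ℝ) (p l lam σ R ρ d M Xb W : ℝ),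
    CX C₁ u v pr θ φ p l lam K σ R ρ d M Xb W → 
    |JJ (gfun u φ) eta pr (d / 4)| ≤ C * ((R / d) ^ 5 * (M ^ (1 + l) + M ^ (3 * l) + R ^ (-σ))) := by
  obtain ⟨C, hC0, hC⟩ := low_bd
  refine ⟨C * 27 * |C₁| * (|K| ^ 3), by positivity, ?_⟩
  intro u v pr θ φ p l lam σ R ρ d M Xb W h
  have hR := h.hR
  have hd := h.hd
  have hM := h.nb.M0
  have hK := h.K1
  have hC1 := h.C1
  have hR0 : 0 < R := by linarith
  rw [abs_of_nonneg hC1, abs_of_nonneg (by linarith : 0 ≤ K)]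
  have s1 := fun i j => pd_smooth (comp_smooth h.hu i) j
  have s2 := fun i j => (comp_smooth h.hu i).mul (comp_smooth h.hu j)
  have s3 := fun i j => (comp_smooth h.hv j).mul (comp_smooth h.hv i)
  have s12 : ∀ i j, ContDiff ℝ (⊤ : ℕ∞) (fun x => pd (fun y => u y i) j x - u x i * u x j) := fun i j => (s1 i j).sub (s2 i j)
  have s123 : ∀ i j, ContDiff ℝ (⊤ : ℕ∞) (fun x => pd (fun y => u y i) j x - u x i * u x j - v x j * v x i) := fun i j => (s12 i j).sub (s3 i j)
  have a := hC pr (gfun u φ) (fun i j x => pd (fun y => u y i) j x - u x i * u x j - v x j * v x i) R ρ d h.hpr s123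
    (by
      intro i x
      rw [pd_pr h.hu h.hsol i x]
      refine Finset.sum_congr rfl fun j _ => ?_
      rw [pd_sub' (smooth_diff (s12 i j)) (smooth_diff (s3 i j)), pd_sub' (smooth_diff (s1 i j)) (smooth_diff (s2 i j))])
    hR0 hd h.h1 h.h2 (gfun_smooth h.hu h.hφ.smooth).continuous (gfun_cs h.hφ) (gfun_SS h.hφ)
    (gfun_integral h.hu h.hφ.smooth h.hφ.hasCS h.hsol.2.2.2)
  have hD := h.geo
  have b3 := h.gl (s := 1) (by norm_num)
  have u1 := h.nb.u1
  have u2 := h.nb.u2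
  have uuu := h.nb.uuu
  have uvv := h.nb.uvv
  have vol := h.nb.vol
  have bF : ∀ i j, lpS (fun x => pd (fun y => u y i) j x - u x i * u x j - v x j * v x i) 1 (sh R (ρ + d)) ≤
      K * R ^ (3 / 2 : ℝ) * M + lpS (fun x => ‖u x‖) 2 (sh R (ρ + d)) ^ 2 + lpS (fun x => ‖v x‖) 2 (sh R (ρ + d)) ^ 2 := by
    intro i j
    refine (lpS_tri (s1 i j).continuous (s2 i j).continuous (s3 i j).continuous hD.bD).trans ?_
    have t1 := lpS_lower (s1 i j).continuous (s := 1) (a := 2) (by norm_num) (by norm_num) hD.bD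
    have t2 := lpS_prod h.hu.continuous hD.mD hD.bD (a := 1) (by norm_num) i j
    have t3 := lpS_prod h.hv.continuous hD.mD hD.bD (a := 1) (by norm_num) j i
    rw [mul_one] at t2 t3
    have t4 := lpS_pd_le h.hu h.hv h.hθ hD.mD hD.bD hM.le h.nb.G i j
    rw [show (1 / 1 - 1 / 2 : ℝ) = 1 / 2 by norm_num] at t1
    have t5 := t1.trans (mul_le_mul vol t4 (lpS_nonneg _ _ _) (by positivity))
    exact add_le_add (add_le_add t5 t2) t3
  have n1 := lpS_nonneg (fun x => ‖u x‖) 1 (sh R (ρ + d))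
  have n2 := lpS_nonneg (fun x => ‖u x‖) 2 (sh R (ρ + d))
  have n3 := lpS_nonneg (fun x => ‖v x‖) 2 (sh R (ρ + d))
  generalize lpS (fun x => ‖u x‖) 1 (sh R (ρ + d)) = U1 at *
  generalize lpS (fun x => ‖u x‖) 2 (sh R (ρ + d)) = U2 at *
  generalize lpS (fun x => ‖v x‖) 2 (sh R (ρ + d)) = V2 at *
  have hMl : 0 < M ^ l := by positivity
  have e1 : M ^ (1 + l) = M * M ^ l := by rw [Real.rpow_add hM, Real.rpow_one]
  have q1 : U1 * (K * R ^ (3 / 2 : ℝ) * M) ≤ K ^ 3 * (R ^ 4 * M ^ (1 + l)) := by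
    calc U1 * (K * R ^ (3 / 2 : ℝ) * M) ≤ (K * (R ^ (3 / 2 : ℝ) * (K * (R ^ (5 / 6 : ℝ) * M ^ l)))) * (K * R ^ (3 / 2 : ℝ) * M) := by
          apply mul_le_mul_of_nonneg_right _ (by positivity)
          refine u1.trans ?_
          gcongr
      _ = K ^ 3 * ((R ^ (3 / 2 : ℝ) * R ^ (5 / 6 : ℝ) * R ^ (3 / 2 : ℝ)) * (M * M ^ l)) := by ring
      _ ≤ K ^ 3 * (R ^ 4 * M ^ (1 + l)) := by
          rw [← Real.rpow_add hR0, ← Real.rpow_add hR0, e1, ← Real.rpow_natCast R 4]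
          gcongr
          · linarith
          · norm_num
  have q4 : K ≤ K ^ 3 := le_self_pow₀ hK (by norm_num)
  have e4 : R ^ (4 - σ) = R ^ 4 * R ^ (-σ) := by
    rw [sub_eq_add_neg, Real.rpow_add hR0]; norm_cast
  have q2 : U1 * U2 ^ 2 ≤ K ^ 3 * (R ^ 4 * M ^ (3 * l)) := uuu.trans (by gcongr)
  have q3 : U1 * V2 ^ 2 ≤ K ^ 3 * (R ^ 4 * R ^ (-σ)) := uvv.trans (by rw [e4]; gcongr)
  calc _ ≤ _ := a
    _ ≤ C / d ^ 4 * R * (∑ i : Fin 3, ∑ j : Fin 3, (K * R ^ (3 / 2 : ℝ) * M + U2 ^ 2 + V2 ^ 2)) * (3 * (C₁ / d) * U1) := by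
      apply mul_le_mul _ b3 (lpS_nonneg _ _ _) (by positivity)
      apply mul_le_mul_of_nonneg_left _ (by positivity)
      exact Finset.sum_le_sum fun i _ => Finset.sum_le_sum fun j _ => bF i j
    _ = C * 27 * C₁ * (R / d ^ 5) * (U1 * (K * R ^ (3 / 2 : ℝ) * M) + U1 * U2 ^ 2 + U1 * V2 ^ 2) := by
      simp; field_simp; ring
    _ ≤ C * 27 * C₁ * (R / d ^ 5) * (K ^ 3 * (R ^ 4 * M ^ (1 + l)) + K ^ 3 * (R ^ 4 * M ^ (3 * l)) + K ^ 3 * (R ^ 4 * R ^ (-σ))) := by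
      apply mul_le_mul_of_nonneg_left _ (by positivity)
      linarith
    _ = _ := by rw [div_pow]; field_simp

def ff (u v : R3 → R3) (θ : R3 → ℝ) (ρ : ℝ) : ℝ := (∫ x in ball 0 ρ, grads u v θ x) + lpS (fun x => ‖u x‖) 6 (ball 0 ρ) ^ 2
  + lpS (fun x => ‖v x‖) 6 (ball 0 ρ) ^ 2 + lpS θ 6 (ball 0 ρ) ^ 2

lemma ff_Q (C₁ : ℝ) : ∃ C : ℝ, 0 ≤ C ∧ ∀ (u v : R3 → R3) (pr θ φ : R3 → ℝ) (p l lam K σ R ρ d M Xb W : ℝ),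
    CX C₁ u v pr θ φ p l lam K σ R ρ d M Xb W → 
    ff u v θ ρ ≤ C * ((∫ x, φ x * grads u v θ x) + (d ^ 2)⁻¹ * (lpS (fun x => ‖u x‖) 2 (sh R (ρ + d)) ^ 2
      + lpS (fun x => ‖v x‖) 2 (sh R (ρ + d)) ^ 2 + lpS θ 2 (sh R (ρ + d)) ^ 2)) := by
  obtain ⟨C, hC0, hC⟩ := sob_cut (C₁ := C₁)
  refine ⟨1 + 9 * C, by positivity, ?_⟩
  intro u v pr θ φ p l lam K σ R ρ d M Xb W h
  have hR0 : 0 < R := by linarith [h.hR]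
  have hd := h.hd
  have hs := fun f hf => hC f φ R ρ d hR0 hd h.h1 h.h2 hf h.hφ
  have hD := h.geo
  have cs := h.hφ.hasCS
  have cφ := h.hφ.smooth.continuous
  have c1 := fun i j => (pd_smooth (comp_smooth h.hu i) j).continuous
  have c2 := fun i j => (pd_smooth (comp_smooth h.hv i) j).continuous
  have c3 := fun j => (pd_smooth h.hθ j).continuous
  have cg := grads_cont h.hu h.hv h.hθ
  have I : ∀ {f : R3 → ℝ}, Continuous f → Integrable (fun x => φ x * f x) := fun hf => 
    (cφ.mul hf).integrable_of_hasCompactSupport cs.mul_right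
  have g1 : ∫ x in ball 0 ρ, grads u v θ x ≤ ∫ x, φ x * grads u v θ x := by
    rw [← integral_indicator measurableSet_ball]
    apply integral_mono
    · rw [integrable_indicator_iff measurableSet_ball]
      exact integrableOn_cont cg isBounded_ball
    · exact I cg
    · intro x
      by_cases hx : x ∈ ball (0:R3) ρ
      · rw [Set.indicator_of_mem hx]
        simp only
        rw [h.hφ.one x (by simp at hx; exact hx.le), one_mul]
      · rw [Set.indicator_of_notMem hx]
        exact mul_nonneg (h.hφ.nonneg x) (grads_nonneg _ _ _ _)
  have g2 : ∫ x, φ x * grads u v θ x = (∑ i, ∫ x, φ x * ∑ j, pd (fun y => u y i) j x ^ 2) + (∑ i, ∫ x, φ x * ∑ j, pd (fun y => v y i) j x ^ 2)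
      + ∫ x, φ x * ∑ j, pd θ j x ^ 2 := by
    have I1 : ∀ i, Integrable (fun x => φ x * ∑ j, pd (fun y => u y i) j x ^ 2) := fun i => I (by have := c1 i; fun_prop)
    have I2 : ∀ i, Integrable (fun x => φ x * ∑ j, pd (fun y => v y i) j x ^ 2) := fun i => I (by have := c2 i; fun_prop)
    have I3 : Integrable (fun x => φ x * ∑ j, pd θ j x ^ 2) := I (by fun_prop)
    have I12 : Integrable (fun x => (∑ i, φ x * ∑ j, pd (fun y => u y i) j x ^ 2) + ∑ i, φ x * ∑ j, pd (fun y => v y i) j x ^ 2) :=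
      (integrable_finsetSum _ fun i _ => I1 i).add (integrable_finsetSum _ fun i _ => I2 i)
    rw [← integral_finsetSum _ fun i _ => I1 i, ← integral_finsetSum _ fun i _ => I2 i, 
      ← integral_add (integrable_finsetSum _ fun i _ => I1 i) (integrable_finsetSum _ fun i _ => I2 i), 
      ← integral_add I12 I3]
    congr 1; ext x
    unfold grads
    simp only [Fin.sum_univ_three, Pi.add_apply]; ring
  have cl : ∀ {w : R3 → R3}, Continuous w → ∀ i, lpS (fun x => w x i) 2 (sh R (ρ + d)) ^ 2 ≤ lpS (fun x => ‖w x‖) 2 (sh R (ρ + d)) ^ 2 := by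
    intro w hw i
    apply pow_le_pow_left₀ (lpS_nonneg _ _ _)
    apply lpS_mono (by fun_prop) (by fun_prop) (by norm_num) hD.mD hD.bD
    intro x _
    rw [abs_norm]; exact coord_le _ _
  have vecb : ∀ {w : R3 → R3}, ContDiff ℝ (⊤ : ℕ∞) w → lpS (fun x => ‖w x‖) 6 (ball 0 ρ) ^ 2 ≤
      3 * C * ((∑ i, ∫ x, φ x * ∑ j, pd (fun y => w y i) j x ^ 2) + 3 * ((d ^ 2)⁻¹ * lpS (fun x => ‖w x‖) 2 (sh R (ρ + d)) ^ 2)) := by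
    intro w hw
    refine (lpS_vec6 hw.continuous isBounded_ball).trans ?_
    have : ∀ i, lpS (fun x => w x i) 6 (ball 0 ρ) ^ 2 ≤ C * ((∫ x, φ x * ∑ j, pd (fun y => w y i) j x ^ 2) + (d ^ 2)⁻¹ * lpS (fun x => ‖w x‖) 2 (sh R (ρ + d)) ^ 2) := by
      intro i
      refine (hs _ (comp_smooth hw i)).trans ?_
      apply mul_le_mul_of_nonneg_left _ hC0
      have := mul_le_mul_of_nonneg_left (cl hw.continuous i) (show 0 ≤ (d ^ 2)⁻¹ by positivity)
      linarith
    have k0 := this 0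
    have k1 := this 1
    have k2 := this 2
    rw [Fin.sum_univ_three (fun i => lpS (fun x => w x i) 6 (ball 0 ρ) ^ 2), Fin.sum_univ_three (fun i => ∫ x, φ x * ∑ j, pd (fun y => w y i) j x ^ 2)]
    generalize (∫ x, φ x * ∑ j, pd (fun y => w y 0) j x ^ 2) = a0 at *
    generalize (∫ x, φ x * ∑ j, pd (fun y => w y 1) j x ^ 2) = a1 at *
    generalize (∫ x, φ x * ∑ j, pd (fun y => w y 2) j x ^ 2) = a2 at *
    linarith
  have vu := vecb h.hu
  have vv := vecb h.hv
  have vθ := hs _ h.hθ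
  have N : ∀ {f : R3 → ℝ}, (∀ x, 0 ≤ f x) → 0 ≤ ∫ x, φ x * f x := fun hf => integral_nonneg fun x => mul_nonneg (h.hφ.nonneg x) (hf x)
  have N1 : 0 ≤ ∑ i, ∫ x, φ x * ∑ j, pd (fun y => u y i) j x ^ 2 := Finset.sum_nonneg fun i _ => N fun x => by positivity
  have N2 : 0 ≤ ∑ i, ∫ x, φ x * ∑ j, pd (fun y => v y i) j x ^ 2 := Finset.sum_nonneg fun i _ => N fun x => by positivity
  have N3 : 0 ≤ ∫ x, φ x * ∑ j, pd θ j x ^ 2 := N fun x => by positivity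
  have N4 : 0 ≤ (d ^ 2)⁻¹ * lpS (fun x => ‖u x‖) 2 (sh R (ρ + d)) ^ 2 := by positivity
  have N5 : 0 ≤ (d ^ 2)⁻¹ * lpS (fun x => ‖v x‖) 2 (sh R (ρ + d)) ^ 2 := by positivity
  have N6 : 0 ≤ (d ^ 2)⁻¹ * lpS θ 2 (sh R (ρ + d)) ^ 2 := by positivity
  unfold ff
  rw [mul_add ((d ^ 2)⁻¹), mul_add ((d ^ 2)⁻¹)]
  rw [g2] at g1 ⊢
  generalize (∑ i, ∫ x, φ x * ∑ j, pd (fun y => u y i) j x ^ 2) = a1 at *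
  generalize (∑ i, ∫ x, φ x * ∑ j, pd (fun y => v y i) j x ^ 2) = a2 at *
  generalize (∫ x, φ x * ∑ j, pd θ j x ^ 2) = a3 at *
  generalize (d ^ 2)⁻¹ * lpS (fun x => ‖u x‖) 2 (sh R (ρ + d)) ^ 2 = b1 at *
  generalize (d ^ 2)⁻¹ * lpS (fun x => ‖v x‖) 2 (sh R (ρ + d)) ^ 2 = b2 at *
  generalize (d ^ 2)⁻¹ * lpS θ 2 (sh R (ρ + d)) ^ 2 = b3 at *
  have m1 := mul_nonneg hC0 N1
  have m2 := mul_nonneg hC0 N2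
  have m3 := mul_nonneg hC0 N3
  have m4 := mul_nonneg hC0 N4
  have m5 := mul_nonneg hC0 N5
  have m6 := mul_nonneg hC0 N6
  linarith


def Psi (l lam σ R M : ℝ) : ℝ := M ^ (1 + l) + M ^ (3 * l) + M + M ^ (3 / 2 : ℝ) + M ^ (2 * l) + M ^ (2 * lam) + R ^ (-(σ / 2))

lemma press_all (C₁ K p σ : ℝ) (hσ : 0 < σ) : ∃ C : ℝ, 0 ≤ C ∧ ∀ (u v : R3 → R3) (pr θ φ : R3 → ℝ) (l lam R ρ d M Xb W : ℝ),
    CX C₁ u v pr θ φ p l lam K σ R ρ d M Xb W → 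
    |∫ x, gfun u φ x * pr x| ≤ C * ((R / d) ^ 5 * Psi l lam σ R M + R⁻¹ * M ^ 2) := by
  obtain ⟨c1, n1, p1⟩ := press1 C₁ K
  obtain ⟨c2, n2, p2⟩ := press2 C₁ K p
  obtain ⟨c3, n3, p3⟩ := press3 C₁ K p σ hσ
  obtain ⟨c4, n4, p4⟩ := press4 C₁ K
  refine ⟨9 * (c1 + c2 + c3) + c4, by positivity, ?_⟩
  intro u v pr θ φ l lam R ρ d M Xb W h
  have hM := h.nb.M0
  have hR0 : 0 < R := by linarith [h.hR]
  have hL := h.L4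
  have hd := h.hd
  have rs : R ^ (-σ) ≤ R ^ (-(σ / 2)) := Real.rpow_le_rpow_of_exponent_le (by linarith [h.hR]) (by linarith)
  have P0 : 0 ≤ R⁻¹ * M ^ 2 := by positivity
  obtain ⟨B, hB⟩ : ∃ B, B = (R / d) ^ 5 * Psi l lam σ R M + R⁻¹ * M ^ 2 := ⟨_, rfl⟩
  have m1 : 0 < M ^ (1 + l) := by positivity
  have m2 : 0 < M ^ (3 * l) := by positivity
  have m3 : 0 < M ^ (3 / 2 : ℝ) := by positivity
  have m4 : 0 < M ^ (2 * l) := by positivity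
  have m5 : 0 < M ^ (2 * lam) := by positivity
  have m6 : 0 < R ^ (-(σ / 2)) := by positivity
  have q1 : R / d ≤ (R / d) ^ 5 := le_self_pow₀ (by linarith) (by norm_num)
  have q2 : (R / d) ^ 2 ≤ (R / d) ^ 5 := pow_le_pow_right₀ (by linarith) (by norm_num)
  have q0 : 0 ≤ (R / d) ^ 5 := by positivity
  have bound : ∀ {a x : ℝ}, a ≤ (R / d) ^ 5 → 0 ≤ x → x ≤ Psi l lam σ R M → a * x ≤ (R / d) ^ 5 * Psi l lam σ R M :=
    fun h1 h2 h3 => mul_le_mul h1 h3 h2 q0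
  have B1 : R⁻¹ * M ^ 2 + R / d * M ^ (1 + l) ≤ B := by
    have := bound q1 m1.le (by unfold Psi; linarith)
    linarith
  have B2 : (R / d) ^ 2 * M ^ (3 * l) ≤ B := by
    have := bound q2 m2.le (by unfold Psi; linarith)
    linarith
  have B3 : (R / d) ^ 2 * M + R / d * R ^ (-(σ / 2)) ≤ B := by
    have t : R / d * R ^ (-(σ / 2)) ≤ (R / d) ^ 5 * R ^ (-(σ / 2)) := mul_le_mul_of_nonneg_right q1 m6.le
    have t2 : (R / d) ^ 2 * M ≤ (R / d) ^ 5 * M := mul_le_mul_of_nonneg_right q2 hM.le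
    have := bound (x := M + R ^ (-(σ / 2))) le_rfl (by positivity) (by unfold Psi; linarith)
    linarith
  have B4 : (R / d) ^ 5 * (M ^ (1 + l) + M ^ (3 * l) + R ^ (-σ)) ≤ B := by
    have := bound (x := M ^ (1 + l) + M ^ (3 * l) + R ^ (-σ)) le_rfl (by positivity) (by unfold Psi; linarith)
    linarith
  have sp := press_split h.hu h.hv h.hpr h.hsol h.hφ (d / 4)
  have r1 := fun i j => (p1 _ _ _ _ _ _ _ _ _ _ _ _ _ _ _ h i j).trans (mul_le_mul_of_nonneg_left B1 n1)
  have r2 := fun i j => (p2 _ _ _ _ _ _ _ _ _ _ _ _ _ _ h i j).trans (mul_le_mul_of_nonneg_left B2 n2)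
  have r3 := fun i j => (p3 _ _ _ _ _ _ _ _ _ _ _ _ _ h i j).trans (mul_le_mul_of_nonneg_left B3 n3)
  have r4 := (p4 _ _ _ _ _ _ _ _ _ _ _ _ _ _ _ h).trans (mul_le_mul_of_nonneg_left B4 n4)
  rw [← hB]
  calc _ ≤ _ := sp
    _ ≤ (∑ i : Fin 3, ∑ j : Fin 3, (c1 * B + c2 * B + c3 * B)) + c4 * B := by
      refine add_le_add (Finset.sum_le_sum fun i _ => Finset.sum_le_sum fun j _ => ?_) r4
      exact add_le_add (add_le_add (r1 i j) (r2 i j)) (r3 i j)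
    _ = _ := by simp; ring

lemma master (C₁ K p σ : ℝ) (hσ : 0 < σ) : ∃ C : ℝ, 0 ≤ C ∧ ∀ (u v : R3 → R3) (pr θ φ : R3 → ℝ) (l lam R ρ d M Xb W : ℝ),
    CX C₁ u v pr θ φ p l lam K σ R ρ d M Xb W → 
    ff u v θ ρ ≤ C * ((R / d) ^ 5 * Psi l lam σ R M + R⁻¹ * M ^ 2) := by
  obtain ⟨c1, n1, p1⟩ := press_all C₁ K p σ hσ
  obtain ⟨c2, n2, p2⟩ := ff_Q C₁
  refine ⟨c2 * (c1 + 6 * |C₁| * (5 * |K|) + |K| ^ 2 * 2), by positivity, ?_⟩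
  intro u v pr θ φ l lam R ρ d M Xb W h
  have hM := h.nb.M0
  have hR0 : 0 < R := by linarith [h.hR]
  have hR1 : 1 ≤ R := by linarith [h.hR]
  have hL := h.L4
  have hd := h.hd
  have hK := h.K1
  have hC1 := h.C1
  have hD := h.geo
  have hp1 := h.p1
  rw [abs_of_nonneg hC1, abs_of_nonneg (by linarith : 0 ≤ K)]
  have q := Q_bd h.hu h.hv h.hpr h.hθ h.hsol hR0 hd h.h1 h.h2 h.hφ hM.le h.nb.G
  have pr1 := (le_abs_self _).trans (p1 _ _ _ _ _ _ _ _ _ _ _ _ _ h)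
  have e3 : ∫ x in sh R (ρ + d), ‖u x‖ ^ 3 ≤ K * (R * M ^ (3 * l)) := by
    refine le_trans ?_ h.nb.W_le
    have := lpS_rpow (f := fun x => ‖u x‖) (p := 3) (by norm_num) (sh R (ρ + d))
    simp only [abs_norm] at this
    have e : ∀ x, ‖u x‖ ^ (3:ℝ) = ‖u x‖ ^ 3 := fun x => by norm_cast
    simp only [e] at this
    rw [← this]
    have := pow_le_pow_left₀ (lpS_nonneg _ _ _) h.nb.u3 3
    exact_mod_cast this
  have euv : ∫ x in sh R (ρ + d), ‖u x‖ * ‖v x‖ ^ 2 ≤ K * R ^ (1 - σ) := by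
    refine le_trans ?_ h.nb.uv
    have hc : p.HolderConjugate (p / (p - 1)) := Real.HolderConjugate.conjExponent (by linarith)
    have cu := h.hu.continuous
    have cv := h.hv.continuous
    have := holder2 (f := fun x => ‖u x‖) (g := fun x => ‖v x‖ ^ 2) (by fun_prop) (by fun_prop) hc hD.bD
    simp only [abs_norm, abs_pow] at this
    refine this.trans ?_
    apply mul_le_mul_of_nonneg_left _ (lpS_nonneg _ _ _)
    apply le_of_eq
    have hpp : 0 < p / (p - 1) := div_pos (by linarith) (by linarith)
    generalize p / (p - 1) = a at *
    unfold lpS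
    have e : ∀ x, |‖v x‖| ^ (2 * a) = |‖v x‖ ^ 2| ^ a := fun x => by
      rw [Real.rpow_mul (abs_nonneg _), abs_pow]; norm_cast
    simp_rw [e]
    rw [← Real.rpow_natCast _ 2, ← Real.rpow_mul (by positivity)]
    congr 1; push_cast; field_simp
  have eut := h.nb.ut
  have etv := h.nb.tv
  have half : ∀ x : ℝ, 0 ≤ x → x ≤ K * R → x ≤ K * (R * M) → x ^ 2 ≤ K ^ 2 * R ^ 2 * M ∧ x * M ≤ K * (R * M ^ (3 / 2 : ℝ)) := by
    intro x h0 h1 h2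
    have a1 : x ^ 2 ≤ K ^ 2 * R ^ 2 * M := by
      calc x ^ 2 = x * x := sq x
        _ ≤ (K * R) * (K * (R * M)) := mul_le_mul h1 h2 h0 (by positivity)
        _ = _ := by ring
    refine ⟨a1, ?_⟩
    refine le_of_pow_le_pow_left₀ (n := 2) (by norm_num) (by positivity) ?_
    have e : (M ^ (3 / 2 : ℝ)) ^ 2 = M ^ 3 := by
      rw [← Real.rpow_natCast, ← Real.rpow_mul hM.le]; norm_num
    calc (x * M) ^ 2 = x ^ 2 * M ^ 2 := by ring
      _ ≤ K ^ 2 * R ^ 2 * M * M ^ 2 := by gcongr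
      _ = K ^ 2 * R ^ 2 * M ^ 3 := by ring
      _ = _ := by rw [mul_pow, mul_pow, e]; ring
  have nu2 := lpS_nonneg (fun x => ‖u x‖) 2 (sh R (ρ + d))
  obtain ⟨v1, v2⟩ := half _ (lpS_nonneg (fun x => ‖v x‖) 2 (sh R (ρ + d))) h.nb.v2 h.nb.v2s
  obtain ⟨t1, t2⟩ := half _ (lpS_nonneg θ 2 (sh R (ρ + d))) h.nb.t2 h.nb.t2s
  have r56 : R ^ (5 / 6 : ℝ) ≤ R := by
    calc R ^ (5 / 6 : ℝ) ≤ R ^ (1 : ℝ) := Real.rpow_le_rpow_of_exponent_le (by linarith) (by norm_num)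
      _ = R := Real.rpow_one R
  have ub : lpS (fun x => ‖u x‖) 2 (sh R (ρ + d)) ≤ K * (R * M ^ l) := h.nb.u2.trans (by gcongr)
  have ub1 : lpS (fun x => ‖u x‖) 2 (sh R (ρ + d)) * M ≤ K * (R * M ^ (1 + l)) := by
    rw [Real.rpow_add hM, Real.rpow_one]
    calc _ ≤ K * (R * M ^ l) * M := by gcongr
      _ = _ := by ring
  have ub2 : lpS (fun x => ‖u x‖) 2 (sh R (ρ + d)) ^ 2 ≤ K ^ 2 * R ^ 2 * M ^ (2 * l) := by
    have e : M ^ (2 * l) = (M ^ l) ^ 2 := by rw [← Real.rpow_natCast, ← Real.rpow_mul hM.le]; congr 1; push_cast; ring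
    rw [e]
    calc _ ≤ (K * (R * M ^ l)) ^ 2 := by gcongr
      _ = _ := by ring
  have rs : R ^ (1 - σ) ≤ R * R ^ (-(σ / 2)) := by
    calc R ^ (1 - σ) ≤ R ^ (1 + (-(σ / 2))) := Real.rpow_le_rpow_of_exponent_le hR1 (by linarith)
      _ = _ := by rw [Real.rpow_add hR0, Real.rpow_one]
  have rs' : K * R ^ (1 - σ) ≤ K * (R * R ^ (-(σ / 2))) := by gcongr
  have m1 : 0 < M ^ (1 + l) := by positivity
  have m2 : 0 < M ^ (3 * l) := by positivity
  have m3 : 0 < M ^ (3 / 2 : ℝ) := by positivity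
  have m4 : 0 < M ^ (2 * l) := by positivity
  have m5 : 0 < M ^ (2 * lam) := by positivity
  have m6 : 0 < R ^ (-(σ / 2)) := by positivity
  have q1 : R / d ≤ (R / d) ^ 5 := le_self_pow₀ (by linarith) (by norm_num)
  have q2 : (R / d) ^ 2 ≤ (R / d) ^ 5 := pow_le_pow_right₀ (by linarith) (by norm_num)
  have q0 : 0 ≤ (R / d) ^ 5 := by positivity
  obtain ⟨B, hB⟩ : ∃ B, B = (R / d) ^ 5 * Psi l lam σ R M + R⁻¹ * M ^ 2 := ⟨_, rfl⟩
  have hP0 : 0 ≤ Psi l lam σ R M := by unfold Psi; positivity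
  have P0 : 0 ≤ R⁻¹ * M ^ 2 := by positivity
  have bd1 : (lpS (fun x => ‖u x‖) 2 (sh R (ρ + d)) + lpS (fun x => ‖v x‖) 2 (sh R (ρ + d)) + lpS θ 2 (sh R (ρ + d))) * M
      + (∫ x in sh R (ρ + d), ‖u x‖ ^ 3) + (∫ x in sh R (ρ + d), ‖u x‖ * ‖v x‖ ^ 2)
      + (∫ x in sh R (ρ + d), ‖u x‖ * θ x ^ 2) + (∫ x in sh R (ρ + d), |θ x| * ‖v x‖) ≤ 5 * K * R * Psi l lam σ R M := by
    have : 5 * K * R * Psi l lam σ R M = 5 * (K * (R * M ^ (1 + l))) + 5 * (K * (R * M ^ (3 * l))) + 5 * (K * R * M)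
      + 5 * (K * (R * M ^ (3 / 2 : ℝ))) + 5 * (K * R * M ^ (2 * l)) + 5 * (K * (R * M ^ (2 * lam))) + 5 * (K * (R * R ^ (-(σ / 2)))) := by
      unfold Psi; ring
    rw [this]
    have z1 : 0 ≤ K * (R * M ^ (1 + l)) := by positivity
    have z2 : 0 ≤ K * (R * M ^ (3 * l)) := by positivity
    have z3 : 0 ≤ K * R * M := by positivity
    have z4 : 0 ≤ K * (R * M ^ (3 / 2 : ℝ)) := by positivity
    have z5 : 0 ≤ K * R * M ^ (2 * l) := by positivity
    have z6 : 0 ≤ K * (R * M ^ (2 * lam)) := by positivity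
    have z7 : 0 ≤ K * (R * R ^ (-(σ / 2))) := by positivity
    linarith
  have bd1' : 6 * C₁ / d * ((lpS (fun x => ‖u x‖) 2 (sh R (ρ + d)) + lpS (fun x => ‖v x‖) 2 (sh R (ρ + d)) + lpS θ 2 (sh R (ρ + d))) * M
      + (∫ x in sh R (ρ + d), ‖u x‖ ^ 3) + (∫ x in sh R (ρ + d), ‖u x‖ * ‖v x‖ ^ 2)
      + (∫ x in sh R (ρ + d), ‖u x‖ * θ x ^ 2) + (∫ x in sh R (ρ + d), |θ x| * ‖v x‖)) ≤ 6 * C₁ * (5 * K) * B := by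
    calc _ ≤ 6 * C₁ / d * (5 * K * R * Psi l lam σ R M) := mul_le_mul_of_nonneg_left bd1 (by positivity)
      _ = 6 * C₁ * (5 * K) * (R / d * Psi l lam σ R M) := by ring
      _ ≤ _ := by
        apply mul_le_mul_of_nonneg_left _ (by positivity)
        have := mul_le_mul_of_nonneg_right q1 hP0
        linarith
  have bd2 : (d ^ 2)⁻¹ * (lpS (fun x => ‖u x‖) 2 (sh R (ρ + d)) ^ 2
      + lpS (fun x => ‖v x‖) 2 (sh R (ρ + d)) ^ 2 + lpS θ 2 (sh R (ρ + d)) ^ 2) ≤ K ^ 2 * B * 2 := by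
    calc _ ≤ (d ^ 2)⁻¹ * (K ^ 2 * R ^ 2 * (2 * Psi l lam σ R M)) := by
          apply mul_le_mul_of_nonneg_left _ (by positivity)
          have : K ^ 2 * R ^ 2 * M ^ (2 * l) + K ^ 2 * R ^ 2 * M + K ^ 2 * R ^ 2 * M ≤ K ^ 2 * R ^ 2 * (2 * Psi l lam σ R M) := by
            rw [← mul_add, ← mul_add]
            apply mul_le_mul_of_nonneg_left _ (by positivity)
            unfold Psi; linarith
          linarith
      _ = K ^ 2 * ((R / d) ^ 2 * Psi l lam σ R M) * 2 := by rw [div_pow]; field_simp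
      _ ≤ _ := by
        have := mul_le_mul_of_nonneg_right q2 hP0
        have : (R / d) ^ 2 * Psi l lam σ R M ≤ B := by linarith
        gcongr
  have fq := p2 _ _ _ _ _ _ _ _ _ _ _ _ _ _ _ _ h
  rw [← hB] at pr1 ⊢
  refine fq.trans ?_
  rw [mul_assoc]
  apply mul_le_mul_of_nonneg_left _ n2
  linarith


lemma vol_sh : ∃ c : ℝ, 1 ≤ c ∧ ∀ R τ : ℝ, 0 < R → τ ≤ 2 * R → volume.real (sh R τ) ≤ c * R ^ (3 : ℝ) := by
  refine ⟨1 + 8 * volume.real (ball (0 : R3) 1), by linarith [measureReal_nonneg (μ := volume) (s := ball (0 : R3) 1)], ?_⟩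
  intro R τ hR hτ
  have h1 : volume.real (sh R τ) ≤ volume.real (ball (0 : R3) (2 * R)) := by
    apply measureReal_mono _ measure_ball_lt_top.ne
    intro x hx
    exact ball_subset_ball hτ hx.1
  have h2 : volume.real (ball (0 : R3) (2 * R)) = (2 * R) ^ 3 * volume.real (ball (0 : R3) 1) := by
    have := Measure.addHaar_ball (μ := (volume : Measure R3)) (0 : R3) (r := 2 * R) (by positivity)
    unfold Measure.real
    rw [this, ENNReal.toReal_mul, ENNReal.toReal_ofReal (by positivity)]; simp
  have e : R ^ (3 : ℝ) = R ^ 3 := by norm_cast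
  rw [e]
  have : 0 < R ^ 3 := by positivity
  nlinarith

lemma low_vol {f : R3 → ℝ} (hf : Continuous f) {c R s a A : ℝ} {D : Set R3} (hD : Bornology.IsBounded D) (hc : 1 ≤ c)
    (hR : 1 ≤ R) (hv : volume.real D ≤ c * R ^ (3 : ℝ)) (hs : 1 ≤ s) (hsa : s ≤ a) (hA : lpS f a D ≤ A) :
    lpS f s D ≤ c * R ^ (3 * (1 / s - 1 / a)) * A := by
  refine (lpS_lower hf (by linarith) hsa hD).trans ?_
  have hR0 : 0 < R := by linarith
  have s0 : 0 < s := by linarith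
  have a0 : 0 < a := by linarith
  have e0 : 0 ≤ 1 / s - 1 / a := sub_nonneg.2 (one_div_le_one_div_of_le s0 hsa)
  have e1 : 1 / s - 1 / a ≤ 1 := by
    have : 1 / s ≤ 1 := by rw [div_le_one s0]; exact hs
    have : 0 < 1 / a := by positivity
    linarith
  refine mul_le_mul ?_ hA (lpS_nonneg _ _ _) (by positivity)
  calc _ ≤ (c * R ^ (3 : ℝ)) ^ (1 / s - 1 / a) := Real.rpow_le_rpow measureReal_nonneg hv e0
    _ = c ^ (1 / s - 1 / a) * R ^ (3 * (1 / s - 1 / a)) := by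
      rw [Real.mul_rpow (by positivity) (by positivity), ← Real.rpow_mul hR0.le]
    _ ≤ _ := by
      apply mul_le_mul_of_nonneg_right _ (by positivity)
      calc c ^ (1 / s - 1 / a) ≤ c ^ (1 : ℝ) := Real.rpow_le_rpow_of_exponent_le hc e1
        _ = c := Real.rpow_one c

lemma low_pow {f : R3 → ℝ} (hf : Continuous f) {c R s a K0 e : ℝ} {D : Set R3} (hD : Bornology.IsBounded D) (hc : 1 ≤ c)
    (hR : 1 ≤ R) (hv : volume.real D ≤ c * R ^ (3 : ℝ)) (hs : 1 ≤ s) (hsa : s ≤ a) (hA : lpS f a D ≤ K0 * R ^ e) :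
    lpS f s D ≤ c * K0 * R ^ (3 * (1 / s - 1 / a) + e) := by
  refine (low_vol hf hD hc hR hv hs hsa hA).trans (le_of_eq ?_)
  rw [Real.rpow_add (by linarith)]; ring

lemma lpS_dbl (f : R3 → ℝ) {a : ℝ} (ha : 0 < a) (E : Set R3) : lpS (fun x => f x ^ 2) a E = lpS f (2 * a) E ^ 2 := by
  symm
  unfold lpS
  have e : ∀ x, |f x| ^ (2 * a) = |f x ^ 2| ^ a := fun x => by
    rw [Real.rpow_mul (abs_nonneg _), abs_pow]; norm_cast
  simp_rw [e]
  rw [← Real.rpow_natCast _ 2, ← Real.rpow_mul (by positivity)]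
  congr 1; push_cast; field_simp

def lOf (p : ℝ) : ℝ := 2 * (3 - p) / (6 - p)
def lamOf (p r : ℝ) : ℝ := 1 - (2 * p - 3) * r / (p * (6 - r))

structure PR (p q r α β γ : ℝ) : Prop where
  hp1 : 3 / 2 < p
  hp2 : p < 3
  hq1 : 2 * (p / (p - 1)) ≤ q
  hq2 : q ≤ 6
  hr1 : 2 ≤ r
  hr2 : r < 2 * (p / (p - 1))
  hα1 : 0 ≤ α
  hα2 : α ≤ 2 / p - 1 / 3
  hβ1 : 0 ≤ β
  hβ2 : β ≤ 3 / q - 1 / 2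
  hγ1 : 0 ≤ γ
  hγ2 : γ ≤ 3 / r - 1 / 2
  hc1 : α + 2 * β < 3 / p + 6 / q - 2
  hc2 : α + ((4 * p - 6) * r / ((6 - r) * p)) * γ ≤ 1
  hc3 : β + γ < 3 / q + 3 / r - 2

def sgOf (p q r α β γ : ℝ) : ℝ := min (3 / p + 6 / q - 2 - α - 2 * β) (3 / q + 3 / r - 2 - β - γ)

lemma PR.sg {p q r α β γ : ℝ} (h : PR p q r α β γ) : 0 < sgOf p q r α β γ := by
  unfold sgOf
  exact lt_min (by linarith [h.hc1]) (by linarith [h.hc3])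

lemma PR.pc3 {p q r α β γ : ℝ} (h : PR p q r α β γ) : 3 < 2 * (p / (p - 1)) ∧ 2 * (p / (p - 1)) < 6 := by
  have := h.hp1
  have := h.hp2
  have h0 : 0 < p - 1 := by linarith
  constructor
  · rw [mul_div_assoc', lt_div_iff₀ h0]; linarith
  · rw [mul_div_assoc', div_lt_iff₀ h0]; linarith

lemma PR.l01 {p q r α β γ : ℝ} (h : PR p q r α β γ) : 0 < lOf p ∧ lOf p < 2 / 3 := by
  have := h.hp1
  have := h.hp2
  unfold lOf
  constructor
  · exact div_pos (by linarith) (by linarith)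
  · rw [div_lt_div_iff₀ (by linarith) (by norm_num)]; linarith

lemma PR.lam01 {p q r α β γ : ℝ} (h : PR p q r α β γ) : 0 < lamOf p r ∧ lamOf p r < 1 := by
  have h1 := h.hp1
  have h2 := h.hp2
  have h3 := h.hr1
  have h4 := h.pc3.2
  have h5 := h.hr2
  have h6 : 0 < p * (6 - r) := mul_pos (by linarith) (by linarith)
  unfold lamOf
  constructor
  · rw [sub_pos, div_lt_one h6]
    rw [mul_div_assoc', lt_div_iff₀ (by linarith)] at h5
    nlinarith
  · have : 0 < (2 * p - 3) * r / (p * (6 - r)) := div_pos (mul_pos (by linarith) (by linarith)) h6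
    linarith

set_option maxHeartbeats 2000000 in
lemma nb_make {p q r α β γ K0 : ℝ} (h : PR p q r α β γ) (hK0 : 1 ≤ K0) : ∃ K : ℝ, 1 ≤ K ∧
    ∀ (u v : R3 → R3) (θ : R3 → ℝ) (R τ M : ℝ), ContDiff ℝ (⊤ : ℕ∞) u → ContDiff ℝ (⊤ : ℕ∞) v → ContDiff ℝ (⊤ : ℕ∞) θ →
    1 ≤ R → τ ≤ 2 * R → 0 < M → 
    lpS (fun x => ‖u x‖) p (annulus R) ≤ K0 * R ^ α → lpS (fun x => ‖v x‖) q (annulus R) ≤ K0 * R ^ β →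
    lpS θ r (annulus R) ≤ K0 * R ^ γ → ∫ x in sh R τ, grads u v θ x ≤ M ^ 2 → 
    lpS (fun x => ‖u x‖) 6 (sh R τ) ≤ M → lpS (fun x => ‖v x‖) 6 (sh R τ) ≤ M → lpS θ 6 (sh R τ) ≤ M →
    NB u v θ p (lOf p) (lamOf p r) K (sgOf p q r α β γ) R τ M (K0 * R ^ α) ((K0 * R ^ α) ^ (1 - lOf p) * M ^ lOf p) := by
  obtain ⟨c, hc, hvol⟩ := vol_sh
  refine ⟨(c * K0) ^ 4, one_le_pow₀ (one_le_mul_of_one_le_of_one_le hc hK0), ?_⟩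
  intro u v θ R τ M hu hv hθ hR hτ hM hU hV hT hG hU6 hV6 hT6
  have hR0 : 0 < R := by linarith
  have c0 : 0 < c := by linarith
  have k0 : 0 < K0 := by linarith
  have cu : Continuous fun x => ‖u x‖ := hu.continuous.norm
  have cv : Continuous fun x => ‖v x‖ := hv.continuous.norm
  have cθ := hθ.continuous
  have kb : ∀ a b : ℕ, a ≤ 4 → b ≤ 4 → c ^ a * K0 ^ b ≤ (c * K0) ^ 4 := by
    intro a b ha hb
    rw [mul_pow]
    exact mul_le_mul (pow_le_pow_right₀ hc ha) (pow_le_pow_right₀ hK0 hb) (by positivity) (by positivity)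
  have hD : Bornology.IsBounded (sh R τ) := sh_bdd R τ
  have hvD := hvol R τ hR0 hτ
  have sub : sh R τ ⊆ annulus R := fun x hx => ⟨ball_subset_ball hτ hx.1, hx.2⟩
  have hab : Bornology.IsBounded (annulus R) := sh_bdd R (2 * R)
  have hp1 := h.hp1
  have hp2 := h.hp2
  obtain ⟨hpc, hpc6⟩ := h.pc3
  have hq1 := h.hq1
  have hq2 := h.hq2
  have hr1 := h.hr1
  have hr2 := h.hr2
  have U := (lpS_mono_set cu (by linarith : 0 < p) hab sub).trans hU
  have V := (lpS_mono_set cv (by linarith : 0 < q) hab sub).trans hV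
  have T := (lpS_mono_set cθ (by linarith : 0 < r) hab sub).trans hT
  have lowU := fun s (hs : 1 ≤ s) (hsa : s ≤ p) => low_pow cu hD hc hR hvD hs hsa U
  have lowV := fun s (hs : 1 ≤ s) (hsa : s ≤ q) => low_pow cv hD hc hR hvD hs hsa V
  have lowT := fun s (hs : 1 ≤ s) (hsa : s ≤ r) => low_pow cθ hD hc hR hvD hs hsa T
  have re : ∀ {a b : ℝ}, a ≤ b → R ^ a ≤ R ^ b := fun hab => Real.rpow_le_rpow_of_exponent_le hR hab
  obtain ⟨l0, l1⟩ := h.l01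
  obtain ⟨m0, m1⟩ := h.lam01
  have s1 : sgOf p q r α β γ ≤ 3 / p + 6 / q - 2 - α - 2 * β := min_le_left _ _
  have s2 : sgOf p q r α β γ ≤ 3 / q + 3 / r - 2 - β - γ := min_le_right _ _
  have p0 : 0 < p := by linarith
  have q0 : 0 < q := by linarith
  have r0 : 0 < r := by linarith
  have le1 : 1 - lOf p = p / (6 - p) := by
    unfold lOf; have : 6 - p ≠ 0 := by linarith
    rw [eq_div_iff this, sub_mul, div_mul_cancel₀ _ this]; ring
  have kp : ∀ {s : ℝ}, s ≤ 1 → K0 ^ s ≤ K0 := fun hs => by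
    calc _ ≤ K0 ^ (1 : ℝ) := Real.rpow_le_rpow_of_exponent_le hK0 hs
      _ = K0 := Real.rpow_one _
  have W1 : (K0 * R ^ α) ^ (1 - lOf p) ≤ K0 * R ^ (1 / 3 : ℝ) := by
    rw [Real.mul_rpow k0.le (by positivity), ← Real.rpow_mul hR0.le]
    refine mul_le_mul (kp (by linarith)) (re ?_) (by positivity) k0.le
    rw [le1]
    have := mul_le_mul_of_nonneg_right h.hα2 (show 0 ≤ p / (6 - p) from div_nonneg p0.le (by linarith))
    refine this.trans (le_of_eq ?_)
    have : 6 - p ≠ 0 := by linarith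
    field_simp; ring
  have Wb : (K0 * R ^ α) ^ (1 - lOf p) * M ^ lOf p ≤ K0 * R ^ (1 / 3 : ℝ) * M ^ lOf p := by gcongr
  have W3 : ((K0 * R ^ α) ^ (1 - lOf p) * M ^ lOf p) ^ 3 ≤ K0 ^ 3 * (R * M ^ (3 * lOf p)) := by
    have e : M ^ (3 * lOf p) = (M ^ lOf p) ^ 3 := by
      rw [← Real.rpow_natCast, ← Real.rpow_mul hM.le]; congr 1; push_cast; ring
    have e2 : (R ^ (1 / 3 : ℝ)) ^ 3 = R := by
      rw [← Real.rpow_natCast, ← Real.rpow_mul hR0.le]; norm_num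
    calc _ ≤ (K0 * R ^ (1 / 3 : ℝ) * M ^ lOf p) ^ 3 := pow_le_pow_left₀ (by positivity) Wb 3
      _ = _ := by rw [mul_pow, mul_pow, e2, e]; ring
  have u3 : lpS (fun x => ‖u x‖) 3 (sh R τ) ≤ (K0 * R ^ α) ^ (1 - lOf p) * M ^ lOf p := by
    refine (lpS_interp cu p0 (by norm_num : (0:ℝ) < 6) (by norm_num) l0.le (by linarith) ?_ hD).trans ?_
    · rw [le1]; unfold lOf; have : 6 - p ≠ 0 := by linarith
      field_simp; ring
    · exact mul_le_mul (Real.rpow_le_rpow (lpS_nonneg _ _ _) U (by linarith)) (Real.rpow_le_rpow (lpS_nonneg _ _ _) hU6 l0.le)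
        (Real.rpow_nonneg (lpS_nonneg _ _ _) _) (by positivity)
  have kb1 : c ^ 1 * K0 ^ 1 ≤ (c * K0) ^ 4 := kb 1 1 (by norm_num) (by norm_num)
  have kb0 : c ^ 1 * K0 ^ 0 ≤ (c * K0) ^ 4 := kb 1 0 (by norm_num) (by norm_num)
  simp only [pow_one, pow_zero, mul_one] at kb1 kb0
  have u2a := low_vol cu hD hc hR hvD (by norm_num : (1:ℝ) ≤ 2) (by norm_num) u3
  have six : ∀ {f : R3 → ℝ}, Continuous f → lpS f 6 (sh R τ) ≤ M → lpS f 2 (sh R τ) ≤ (c * K0) ^ 4 * (R * M) := by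
    intro f hf hh
    have := low_vol hf hD hc hR hvD (by norm_num : (1:ℝ) ≤ 2) (by norm_num) hh
    have e : R ^ (3 * (1 / 2 - 1 / 6) : ℝ) = R := by norm_num
    rw [e] at this
    refine this.trans ?_
    rw [mul_assoc]; gcongr
  have v2 : lpS (fun x => ‖v x‖) 2 (sh R τ) ≤ (c * K0) ^ 4 * R := by
    refine (lowV 2 (by norm_num) (by linarith)).trans ?_
    refine mul_le_mul kb1 ?_ (by positivity) (by positivity)
    calc _ ≤ R ^ (1 : ℝ) := re (by have := h.hβ2; ring_nf at this ⊢; linarith)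
      _ = R := Real.rpow_one R
  have t2 : lpS θ 2 (sh R τ) ≤ (c * K0) ^ 4 * R := by
    refine (lowT 2 (by norm_num) (by linarith)).trans ?_
    refine mul_le_mul kb1 ?_ (by positivity) (by positivity)
    calc _ ≤ R ^ (1 : ℝ) := re (by have := h.hγ2; ring_nf at this ⊢; linarith)
      _ = R := Real.rpow_one R
  have rsq : ∀ a : ℝ, (R ^ a) ^ 2 = R ^ (2 * a) := fun a => by
    rw [← Real.rpow_natCast, ← Real.rpow_mul hR0.le]; congr 1; push_cast; ring
  have v3 : lpS (fun x => ‖v x‖) 3 (sh R τ) ^ 2 ≤ (c * K0) ^ 4 * R := by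
    have := pow_le_pow_left₀ (lpS_nonneg _ _ _) (lowV 3 (by norm_num) (by linarith)) 2
    refine this.trans ?_
    rw [mul_pow, rsq, mul_pow]
    refine mul_le_mul (kb 2 2 (by norm_num) (by norm_num)) ?_ (by positivity) (by positivity)
    calc _ ≤ R ^ (1 : ℝ) := re (by have := h.hβ2; ring_nf at this ⊢; linarith)
      _ = R := Real.rpow_one R
  have hpp0 : 0 < p / (p - 1) := div_pos p0 (by linarith)
  have pinv : 1 / (2 * (p / (p - 1))) = (1 - 1 / p) / 2 := by
    have : p - 1 ≠ 0 := by linarith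
    field_simp
  have uv : lpS (fun x => ‖u x‖) p (sh R τ) * lpS (fun x => ‖v x‖) (2 * (p / (p - 1))) (sh R τ) ^ 2
      ≤ (c * K0) ^ 4 * R ^ (1 - sgOf p q r α β γ) := by
    have a := lowV (2 * (p / (p - 1))) (by linarith) hq1
    rw [pinv] at a
    have a := pow_le_pow_left₀ (lpS_nonneg _ _ _) a 2
    refine (mul_le_mul U a (by positivity) (by positivity)).trans ?_
    rw [mul_pow, rsq]
    calc _ = c ^ 2 * K0 ^ 3 * R ^ (α + 2 * (3 * ((1 - 1 / p) / 2 - 1 / q) + β)) := by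
          rw [Real.rpow_add hR0]; ring
      _ ≤ _ := mul_le_mul (kb 2 3 (by norm_num) (by norm_num)) (re (by ring_nf at s1 ⊢; linarith)) (by positivity) (by positivity)
  have u1 : lpS (fun x => ‖u x‖) 1 (sh R τ) ≤ c * (R ^ (3 / 2 : ℝ) * lpS (fun x => ‖u x‖) 2 (sh R τ)) := by
    have := low_vol cu hD hc hR hvD (le_refl (1:ℝ)) (by norm_num : (1:ℝ) ≤ 2) le_rfl
    have e : (3 * (1 / 1 - 1 / 2) : ℝ) = 3 / 2 := by norm_num
    rw [e] at this; rw [← mul_assoc]; exact this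
  have e12 : (3 * (1 / 2 - 1 / 3) : ℝ) = 1 / 2 := by norm_num
  rw [e12] at u2a
  constructor
  · exact hM
  · positivity
  · rfl
  · refine W3.trans ?_
    have := kb 0 3 (by norm_num) (by norm_num)
    simp only [pow_zero, one_mul] at this
    exact mul_le_mul_of_nonneg_right this (by positivity)
  · exact hG
  · exact U
  · exact u3
  · calc _ ≤ _ := u2a
      _ ≤ c * R ^ (1 / 2 : ℝ) * (K0 * R ^ (1 / 3 : ℝ) * M ^ lOf p) := by gcongr
      _ = (c * K0) * (R ^ (1 / 2 + 1 / 3 : ℝ) * M ^ lOf p) := by rw [Real.rpow_add hR0]; ring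
      _ = (c * K0) * (R ^ (5 / 6 : ℝ) * M ^ lOf p) := by norm_num
      _ ≤ _ := mul_le_mul_of_nonneg_right kb1 (by positivity)
  · exact six cu hU6
  · exact v2
  · exact six cv hV6
  · exact t2
  · exact six cθ hT6
  · exact v3
  · exact uv
  · refine u1.trans (mul_le_mul_of_nonneg_right kb0 (mul_nonneg (by positivity) (lpS_nonneg _ _ _)))
  · calc _ ≤ (c * R ^ (3:ℝ)) ^ (1 / 2 : ℝ) := Real.rpow_le_rpow measureReal_nonneg hvD (by norm_num)
      _ = c ^ (1 / 2 : ℝ) * R ^ (3 / 2 : ℝ) := by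
        rw [Real.mul_rpow c0.le (by positivity), ← Real.rpow_mul hR0.le]; norm_num
      _ ≤ _ := by
        apply mul_le_mul_of_nonneg_right _ (by positivity)
        refine le_trans ?_ kb0
        calc _ ≤ c ^ (1:ℝ) := Real.rpow_le_rpow_of_exponent_le hc (by norm_num)
          _ = c := Real.rpow_one c
  · have n2 := lpS_nonneg (fun x => ‖u x‖) 2 (sh R τ)
    have a3 := pow_le_pow_left₀ n2 u2a 3
    have e1 : (R ^ (1 / 2 : ℝ)) ^ 3 = R ^ (3 / 2 : ℝ) := by
      rw [← Real.rpow_natCast, ← Real.rpow_mul hR0.le]; norm_num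
    have e2 : R ^ (3 / 2 : ℝ) * R ^ (3 / 2 : ℝ) = R ^ 3 := by
      rw [← Real.rpow_add hR0]; norm_num
    calc _ ≤ c * (R ^ (3 / 2 : ℝ) * lpS (fun x => ‖u x‖) 2 (sh R τ)) * lpS (fun x => ‖u x‖) 2 (sh R τ) ^ 2 := by gcongr
      _ = c * R ^ (3 / 2 : ℝ) * lpS (fun x => ‖u x‖) 2 (sh R τ) ^ 3 := by ring
      _ ≤ c * R ^ (3 / 2 : ℝ) * (c * R ^ (1 / 2 : ℝ) * ((K0 * R ^ α) ^ (1 - lOf p) * M ^ lOf p)) ^ 3 := mul_le_mul_of_nonneg_left a3 (by positivity)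
      _ = c ^ 4 * (R ^ (3 / 2 : ℝ) * R ^ (3 / 2 : ℝ)) * ((K0 * R ^ α) ^ (1 - lOf p) * M ^ lOf p) ^ 3 := by rw [mul_pow (c * _), mul_pow c, e1]; ring
      _ ≤ c ^ 4 * R ^ 3 * (K0 ^ 3 * (R * M ^ (3 * lOf p))) := by rw [e2]; exact mul_le_mul_of_nonneg_left W3 (by positivity)
      _ = c ^ 4 * K0 ^ 3 * (R ^ 4 * M ^ (3 * lOf p)) := by ring
      _ ≤ _ := mul_le_mul_of_nonneg_right (kb 4 3 (by norm_num) (by norm_num)) (by positivity)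
  · have a := lowU 1 le_rfl (by linarith)
    have b := pow_le_pow_left₀ (lpS_nonneg _ _ _) (lowV 2 (by norm_num) (by linarith)) 2
    refine (mul_le_mul a b (by positivity) (by positivity)).trans ?_
    rw [mul_pow, rsq]
    calc _ = c ^ 3 * K0 ^ 3 * R ^ (3 * (1 / 1 - 1 / p) + α + 2 * (3 * (1 / 2 - 1 / q) + β)) := by
          rw [Real.rpow_add hR0 (3 * (1 / 1 - 1 / p) + α)]; ring
      _ ≤ _ := mul_le_mul (kb 3 3 (by norm_num) (by norm_num)) (re (by ring_nf at s1 ⊢; linarith)) (by positivity) (by positivity)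
  · have hcj : p.HolderConjugate (p / (p - 1)) := Real.HolderConjugate.conjExponent (by linarith)
    have a := holder2 (f := fun x => ‖u x‖) (g := fun x => θ x ^ 2) cu (by fun_prop) hcj hD
    rw [lpS_dbl _ hpp0] at a
    simp only [abs_norm, abs_pow, sq_abs] at a
    have r6 : 6 - r ≠ 0 := by linarith
    have b := lpS_interp cθ r0 (by norm_num : (0:ℝ) < 6) (by linarith : 0 < 2 * (p / (p - 1))) m0.le m1.le (by
      rw [pinv]; unfold lamOf; field_simp; ring) hD
    have b' : lpS θ (2 * (p / (p - 1))) (sh R τ) ≤ (K0 * R ^ γ) ^ (1 - lamOf p r) * M ^ lamOf p r :=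
      b.trans (mul_le_mul (Real.rpow_le_rpow (lpS_nonneg _ _ _) T (by linarith)) (Real.rpow_le_rpow (lpS_nonneg _ _ _) hT6 m0.le)
        (Real.rpow_nonneg (lpS_nonneg _ _ _) _) (by positivity))
    have b2 : lpS θ (2 * (p / (p - 1))) (sh R τ) ≤ K0 * R ^ (γ * (1 - lamOf p r)) * M ^ lamOf p r := by
      refine b'.trans (mul_le_mul_of_nonneg_right ?_ (by positivity))
      rw [Real.mul_rpow k0.le (by positivity), ← Real.rpow_mul hR0.le]
      exact mul_le_mul_of_nonneg_right (kp (by linarith)) (by positivity)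
    have b3 := pow_le_pow_left₀ (lpS_nonneg _ _ _) b2 2
    have em : (M ^ lamOf p r) ^ 2 = M ^ (2 * lamOf p r) := by
      rw [← Real.rpow_natCast, ← Real.rpow_mul hM.le]; congr 1; push_cast; ring
    have ex : α + 2 * (γ * (1 - lamOf p r)) ≤ 1 := by
      refine le_trans (le_of_eq ?_) h.hc2
      unfold lamOf; field_simp; ring
    refine a.trans ((mul_le_mul U b3 (by positivity) (by positivity)).trans ?_)
    rw [mul_pow, mul_pow, rsq, em]
    calc _ = c ^ 0 * K0 ^ 3 * (R ^ (α + 2 * (γ * (1 - lamOf p r))) * M ^ (2 * lamOf p r)) := by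
          rw [Real.rpow_add hR0]; ring
      _ ≤ _ := by
        refine mul_le_mul (kb 0 3 (by norm_num) (by norm_num)) ?_ (by positivity) (by positivity)
        apply mul_le_mul_of_nonneg_right _ (by positivity)
        calc _ ≤ R ^ (1:ℝ) := re ex
          _ = R := Real.rpow_one R
  · have hcj : q.HolderConjugate (q / (q - 1)) := Real.HolderConjugate.conjExponent (by linarith)
    have a := holder2 (f := fun x => θ x) (g := fun x => ‖v x‖) cθ cv hcj.symm hD
    simp only [abs_norm] at a
    have qi : 1 / (q / (q - 1)) = 1 - 1 / q := by
      have : q - 1 ≠ 0 := by linarith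
      field_simp
    have b := lowT (q / (q - 1)) (by rw [le_div_iff₀ (by linarith)]; linarith) (by rw [div_le_iff₀ (by linarith)]; nlinarith)
    rw [qi] at b
    refine a.trans ((mul_le_mul b V (lpS_nonneg _ _ _) (by positivity)).trans ?_)
    calc _ = c ^ 1 * K0 ^ 2 * R ^ (3 * (1 - 1 / q - 1 / r) + γ + β) := by
          rw [Real.rpow_add hR0 (3 * (1 - 1 / q - 1 / r) + γ)]; ring
      _ ≤ _ := mul_le_mul (kb 1 2 (by norm_num) (by norm_num)) (re (by ring_nf at s2 ⊢; linarith)) (by positivity) (by positivity)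


structure Good (u v : R3 → R3) (θ : R3 → ℝ) (p q r α β γ K0 R : ℝ) : Prop where
  hR : 4 ≤ R
  U : lpS (fun x => ‖u x‖) p (annulus R) ≤ K0 * R ^ α
  V : lpS (fun x => ‖v x‖) q (annulus R) ≤ K0 * R ^ β
  T : lpS θ r (annulus R) ≤ K0 * R ^ γ

lemma step {u v : R3 → R3} {pr θ : R3 → ℝ} {p q r α β γ K0 : ℝ} (hu : ContDiff ℝ (⊤ : ℕ∞) u) (hv : ContDiff ℝ (⊤ : ℕ∞) v)
    (hpr : ContDiff ℝ (⊤ : ℕ∞) pr) (hθ : ContDiff ℝ (⊤ : ℕ∞) θ) (hsol : TCM u v pr θ) (h : PR p q r α β γ) (hK0 : 1 ≤ K0) :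
    ∃ C : ℝ, 0 ≤ C ∧ ∀ R ρ τ M : ℝ, Good u v θ p q r α β γ K0 R → 7 * R / 4 ≤ ρ → ρ < τ → τ ≤ 2 * R → 0 < M →
      ∫ x in sh R τ, grads u v θ x ≤ M ^ 2 → 
      lpS (fun x => ‖u x‖) 6 (sh R τ) ≤ M → lpS (fun x => ‖v x‖) 6 (sh R τ) ≤ M → lpS θ 6 (sh R τ) ≤ M →
      ff u v θ ρ ≤ C * ((R / (τ - ρ)) ^ 5 * Psi (lOf p) (lamOf p r) (sgOf p q r α β γ) R M + R⁻¹ * M ^ 2) := by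
  obtain ⟨C₁, hC1, hcut⟩ := cut_exists
  obtain ⟨K, hK, hnb⟩ := nb_make h hK0
  obtain ⟨C, hC, hm⟩ := master C₁ K p (sgOf p q r α β γ) h.sg
  refine ⟨C, hC, ?_⟩
  intro R ρ τ M hG h1 h2 h3 hM g a b c
  have hR := hG.hR
  obtain ⟨φ, hφ⟩ := hcut R ρ (τ - ρ) (by linarith) (by linarith) h1 (by linarith)
  have e : ρ + (τ - ρ) = τ := by ring
  refine hm u v pr θ φ (lOf p) (lamOf p r) R ρ (τ - ρ) M (K0 * R ^ α) ((K0 * R ^ α) ^ (1 - lOf p) * M ^ lOf p) ?_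
  refine { hu := hu, hv := hv, hpr := hpr, hθ := hθ, hsol := hsol, hR := hR, hd := by linarith, h1 := h1, h2 := by linarith, hφ := hφ, nb := ?_, p1 := h.hp1, p2 := h.hp2, hl := rfl, K1 := hK, C1 := hC1.le }
  rw [e]
  exact hnb u v θ R τ M hu hv hθ (by linarith) h3 hM hG.U hG.V hG.T g a b c

lemma iter {κ C' : ℝ} (hκ0 : 0 < κ) (hκ1 : κ < 1) (hC : 0 ≤ C') : ∃ B ε : ℝ, 0 < ε ∧ ∀ (g : ℝ → ℝ) (R : ℝ), 0 < R → Monotone g → (∀ ρ, 1 ≤ g ρ) →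
    (∀ ρ τ, 7 * R / 4 ≤ ρ → ρ < τ → τ ≤ 2 * R → g ρ ≤ C' * (R / (τ - ρ)) ^ 5 * g τ ^ κ + ε * g τ) → g (7 * R / 4) ≤ B := by
  obtain ⟨m, hm⟩ : ∃ m, m = 5 / (1 - κ) := ⟨_, rfl⟩
  have hk : 0 < 1 - κ := by linarith
  have hm0 : 0 < m := by rw [hm]; positivity
  have hmk : m - 5 - m * κ = 0 := by rw [hm]; field_simp; ring
  obtain ⟨A, hA⟩ : ∃ A, A = C' * 2 ^ 5 * (2:ℝ) ^ (m * κ) := ⟨_, rfl⟩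
  have hA0 : 0 ≤ A := by rw [hA]; positivity
  refine ⟨(4:ℝ) ^ m * (2 * A) ^ (1 / (1 - κ)), (2:ℝ) ^ (-m) / 2, by positivity, ?_⟩
  intro g R hR hg g1 hstep
  obtain ⟨H, hH⟩ : ∃ H : ℝ → ℝ, H = fun ρ => ((2 * R - ρ) / R) ^ m * g ρ := ⟨_, rfl⟩
  obtain ⟨I, hI⟩ : ∃ I : Set ℝ, I = Set.Ico (7 * R / 4) (2 * R) := ⟨_, rfl⟩
  have mem0 : 7 * R / 4 ∈ I := by rw [hI]; constructor <;> linarith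
  have bdd : BddAbove (H '' I) := by
    refine ⟨g (2 * R), ?_⟩
    rintro _ ⟨ρ, hρ, rfl⟩
    rw [hI] at hρ
    rw [hH]
    simp only
    have a1 : 0 ≤ (2 * R - ρ) / R := div_nonneg (by linarith [hρ.2]) hR.le
    have a2 : (2 * R - ρ) / R ≤ 1 := by rw [div_le_one hR]; linarith [hρ.1]
    have a3 := Real.rpow_le_one a1 a2 hm0.le
    have a4 := hg (hρ.2.le)
    have a5 := g1 ρ
    calc _ ≤ 1 * g ρ := mul_le_mul_of_nonneg_right a3 (by linarith)
      _ ≤ _ := by linarith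
  obtain ⟨S, hS⟩ : ∃ S, S = sSup (H '' I) := ⟨_, rfl⟩
  have leS : ∀ ρ ∈ I, H ρ ≤ S := fun ρ hρ => hS ▸ le_csSup bdd ⟨ρ, hρ, rfl⟩
  have S0 : 0 < S := by
    refine lt_of_lt_of_le ?_ (leS _ mem0)
    rw [hH]
    have := g1 (7 * R / 4)
    have : 0 < (2 * R - 7 * R / 4) / R := div_pos (by linarith) hR
    simp only
    positivity
  have key : S ≤ A * S ^ κ + S / 2 := by
    conv_lhs => rw [hS]
    apply csSup_le (Set.Nonempty.image H ⟨_, mem0⟩)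
    rintro _ ⟨ρ, hρ, rfl⟩
    have hρ' := hρ
    rw [hI] at hρ
    obtain ⟨t, ht⟩ : ∃ t, t = (2 * R - ρ) / R := ⟨_, rfl⟩
    have t0 : 0 < t := by rw [ht]; exact div_pos (by linarith [hρ.2]) hR
    obtain ⟨τ, hτ⟩ : ∃ τ, τ = (ρ + 2 * R) / 2 := ⟨_, rfl⟩
    have τI : τ ∈ I := by rw [hI, hτ]; constructor <;> linarith [hρ.1, hρ.2]
    have st := hstep ρ τ hρ.1 (by rw [hτ]; linarith [hρ.2]) (by rw [hτ]; linarith [hρ.2])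
    have e1 : R / (τ - ρ) = 2 / t := by
      have : 2 * R - ρ ≠ 0 := by linarith [hρ.2]
      have h2 : τ - ρ = (2 * R - ρ) / 2 := by rw [hτ]; ring
      rw [h2, ht]; field_simp
    have e2 : (2 * R - τ) / R = t / 2 := by rw [hτ, ht]; field_simp; ring
    have gt : g τ ≤ S * (2 / t) ^ m := by
      have := leS τ τI
      rw [hH] at this
      simp only [e2] at this
      rw [Real.div_rpow (by norm_num) t0.le]
      rw [Real.div_rpow t0.le (by norm_num)] at this
      have w1 : 0 < t ^ m := by positivity
      have w2 : 0 < (2:ℝ) ^ m := by positivity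
      rw [div_mul_eq_mul_div, div_le_iff₀ w2] at this
      rw [mul_div_assoc', le_div_iff₀ w1]; linarith
    have gτ0 : 0 ≤ g τ := by linarith [g1 τ]
    rw [e1] at st
    have hHr : H ρ = t ^ m * g ρ := by rw [hH, ht]
    rw [hHr]
    have gk : g τ ^ κ ≤ S ^ κ * (2 / t) ^ (m * κ) := by
      calc _ ≤ (S * (2 / t) ^ m) ^ κ := Real.rpow_le_rpow gτ0 gt hκ0.le
        _ = _ := by rw [Real.mul_rpow S0.le (by positivity), ← Real.rpow_mul (by positivity)]
    have hε : 0 < (2:ℝ) ^ (-m) / 2 := by positivity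
    have : g ρ ≤ C' * (2 / t) ^ 5 * (S ^ κ * (2 / t) ^ (m * κ)) + (2:ℝ) ^ (-m) / 2 * (S * (2 / t) ^ m) := by
      refine st.trans (add_le_add (mul_le_mul_of_nonneg_left gk (by positivity)) (mul_le_mul_of_nonneg_left gt hε.le))
    calc t ^ m * g ρ ≤ t ^ m * (C' * (2 / t) ^ 5 * (S ^ κ * (2 / t) ^ (m * κ)) + (2:ℝ) ^ (-m) / 2 * (S * (2 / t) ^ m)) :=
          mul_le_mul_of_nonneg_left this (by positivity)
      _ = A * S ^ κ + S / 2 := by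
        have f1 : t ^ m = t ^ 5 * t ^ (m * κ) := by
          rw [← Real.rpow_natCast t 5, ← Real.rpow_add t0]; congr 1; push_cast; linarith
        have f2 : (2 / t) ^ (m * κ) = 2 ^ (m * κ) / t ^ (m * κ) := Real.div_rpow (by norm_num) t0.le _
        have f3 : (2 / t) ^ m = 2 ^ m / t ^ m := Real.div_rpow (by norm_num) t0.le _
        have f4 : (2:ℝ) ^ (-m) = (2 ^ m)⁻¹ := Real.rpow_neg (by norm_num) _
        have w1 : t ^ m ≠ 0 := by positivity
        have w2 : (2:ℝ) ^ m ≠ 0 := by positivity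
        have w3 : t ^ (m * κ) ≠ 0 := by positivity
        rw [mul_add]
        congr 1
        · rw [f1, f2, hA, div_pow]; field_simp
        · rw [f3, f4]; field_simp
  have SB : S ≤ (2 * A) ^ (1 / (1 - κ)) := by
    have h1 : S ^ (1 - κ) ≤ 2 * A := by
      have e : S = S ^ (1 - κ) * S ^ κ := by rw [← Real.rpow_add S0]; simp
      have w : 0 < S ^ κ := by positivity
      have : S ^ (1 - κ) * S ^ κ ≤ 2 * A * S ^ κ := by rw [← e]; linarith
      exact le_of_mul_le_mul_right this w
    calc S = (S ^ (1 - κ)) ^ (1 / (1 - κ)) := by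
          rw [← Real.rpow_mul S0.le, mul_one_div_cancel hk.ne', Real.rpow_one]
      _ ≤ _ := Real.rpow_le_rpow (by positivity) h1 (by positivity)
  have fin := (leS _ mem0).trans SB
  rw [hH] at fin
  have e : (2 * R - 7 * R / 4) / R = 1 / 4 := by field_simp; ring
  simp only [e] at fin
  rw [Real.div_rpow (by norm_num) (by norm_num), Real.one_rpow, div_mul_eq_mul_div, one_mul, div_le_iff₀ (by positivity)] at fin
  linarith

lemma ff_mono {u v : R3 → R3} {θ : R3 → ℝ} (hu : ContDiff ℝ (⊤ : ℕ∞) u) (hv : ContDiff ℝ (⊤ : ℕ∞) v)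
    (hθ : ContDiff ℝ (⊤ : ℕ∞) θ) : Monotone (ff u v θ) := by
  intro a b hab
  have hs : ball (0:R3) a ⊆ ball 0 b := ball_subset_ball hab
  unfold ff
  have m : ∀ {f : R3 → ℝ}, Continuous f → lpS f 6 (ball 0 a) ^ 2 ≤ lpS f 6 (ball 0 b) ^ 2 := fun hf =>
    pow_le_pow_left₀ (lpS_nonneg _ _ _) (lpS_mono_set hf (by norm_num) isBounded_ball hs) 2
  refine add_le_add (add_le_add (add_le_add ?_ (m hu.continuous.norm)) (m hv.continuous.norm)) (m hθ.continuous)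
  exact setIntegral_mono_set (integrableOn_cont (grads_cont hu hv hθ) isBounded_ball) 
    (Eventually.of_forall fun x => grads_nonneg _ _ _ _) hs.eventuallyLE

lemma ff_parts (u v : R3 → R3) (θ : R3 → ℝ) (ρ : ℝ) : 0 ≤ ∫ x in ball 0 ρ, grads u v θ x := 
  integral_nonneg fun x => grads_nonneg _ _ _ _

lemma ff_nonneg (u v : R3 → R3) (θ : R3 → ℝ) (ρ : ℝ) : 0 ≤ ff u v θ ρ := by
  have := ff_parts u v θ ρ
  unfold ff; positivity

lemma Psi_big {l lam σ R M s : ℝ} (hM : 1 ≤ M) (hR : 1 ≤ R) (hσ : 0 < σ) (h0 : 3 / 2 ≤ s) (h1 : 1 + l ≤ s) (h2 : 3 * l ≤ s) (h3 : 2 * l ≤ s) (h4 : 2 * lam ≤ s) :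
    Psi l lam σ R M ≤ 7 * M ^ s := by
  have e : ∀ {a : ℝ}, a ≤ s → M ^ a ≤ M ^ s := fun h => Real.rpow_le_rpow_of_exponent_le hM h
  have e1 := e (show (1:ℝ) ≤ s by linarith)
  have e0 := e (show (0:ℝ) ≤ s by linarith)
  rw [Real.rpow_one] at e1
  rw [Real.rpow_zero] at e0
  have e2 : R ^ (-(σ / 2)) ≤ 1 := Real.rpow_le_one_of_one_le_of_nonpos hR (by linarith)
  unfold Psi
  linarith [e h0, e h1, e h2, e h3, e h4]

lemma bounded {u v : R3 → R3} {pr θ : R3 → ℝ} {p q r α β γ K0 : ℝ} (hu : ContDiff ℝ (⊤ : ℕ∞) u) (hv : ContDiff ℝ (⊤ : ℕ∞) v)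
    (hpr : ContDiff ℝ (⊤ : ℕ∞) pr) (hθ : ContDiff ℝ (⊤ : ℕ∞) θ) (hsol : TCM u v pr θ) (h : PR p q r α β γ) (hK0 : 1 ≤ K0) 
    (hfr : ∃ᶠ R in atTop, Good u v θ p q r α β γ K0 R) : ∃ B, ∀ ρ, ff u v θ ρ ≤ B := by
  obtain ⟨C, hC, hst⟩ := step hu hv hpr hθ hsol h hK0
  obtain ⟨l0, l1⟩ := h.l01
  obtain ⟨m0, m1⟩ := h.lam01
  obtain ⟨s, hs⟩ : ∃ s, s = max (3 / 2) (max (1 + lOf p) (max (3 * lOf p) (2 * lamOf p r))) := ⟨_, rfl⟩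
  have hs2 : s < 2 := by rw [hs]; refine max_lt (by norm_num) (max_lt (by linarith) (max_lt (by linarith) (by linarith)))
  have s1 : 3 / 2 ≤ s := by rw [hs]; exact le_max_left _ _
  have s2 : 1 + lOf p ≤ s := by rw [hs]; exact (le_max_left _ _).trans (le_max_right _ _)
  have s3 : 3 * lOf p ≤ s := by rw [hs]; exact (le_max_left _ _).trans ((le_max_right _ _).trans (le_max_right _ _))
  have s4 : 2 * lamOf p r ≤ s := by rw [hs]; exact (le_max_right _ _).trans ((le_max_right _ _).trans (le_max_right _ _))
  obtain ⟨B, ε, hε, hit⟩ := iter (κ := s / 2) (C' := 1 + 7 * C) (by linarith) (by linarith) (by positivity)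
  refine ⟨B, fun ρ₀ => ?_⟩
  obtain ⟨R, hGd, hRρ, hRC⟩ := (hfr.and_eventually ((eventually_ge_atTop ρ₀).and (eventually_ge_atTop (C / ε)))).exists
  have hR4 := hGd.hR
  have hR0 : 0 < R := by linarith
  have fm := ff_mono hu hv hθ
  have := hit (fun ρ => ff u v θ ρ + 1) R hR0 (fun a b hab => by simp only; linarith [fm hab]) (fun ρ => by linarith [ff_nonneg u v θ ρ]) ?_
  · have := fm (show ρ₀ ≤ 7 * R / 4 by linarith)
    linarith
  · intro ρ τ h1 h2 h3
    obtain ⟨F, hF⟩ : ∃ F, F = ff u v θ τ + 1 := ⟨_, rfl⟩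
    have F1 : 1 ≤ F := by rw [hF]; linarith [ff_nonneg u v θ τ]
    have sub : sh R τ ⊆ ball 0 τ := fun x hx => hx.1
    have M1 : 1 ≤ Real.sqrt F := Real.one_le_sqrt.2 F1
    have n0 := ff_parts u v θ τ
    have n1 := sq_nonneg (lpS (fun x => ‖u x‖) 6 (ball 0 τ))
    have n2 := sq_nonneg (lpS (fun x => ‖v x‖) 6 (ball 0 τ))
    have n3 := sq_nonneg (lpS θ 6 (ball 0 τ))
    have hF' : F = (∫ x in ball 0 τ, grads u v θ x) + lpS (fun x => ‖u x‖) 6 (ball 0 τ) ^ 2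
      + lpS (fun x => ‖v x‖) 6 (ball 0 τ) ^ 2 + lpS θ 6 (ball 0 τ) ^ 2 + 1 := by rw [hF]; rfl
    have six : ∀ {f : R3 → ℝ}, Continuous f → lpS f 6 (ball 0 τ) ^ 2 ≤ F → lpS f 6 (sh R τ) ≤ Real.sqrt F := fun hf hh => 
      (lpS_mono_set hf (by norm_num) isBounded_ball sub).trans (Real.le_sqrt_of_sq_le hh)
    have st := hst R ρ τ (Real.sqrt F) hGd h1 h2 h3 (by linarith) (by
      rw [Real.sq_sqrt (by linarith)]
      refine (setIntegral_mono_set (integrableOn_cont (grads_cont hu hv hθ) isBounded_ball) 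
        (Eventually.of_forall fun x => grads_nonneg _ _ _ _) sub.eventuallyLE).trans ?_
      linarith) (six hu.continuous.norm (by linarith)) (six hv.continuous.norm (by linarith)) (six hθ.continuous (by linarith))
    have P := Psi_big (l := lOf p) (lam := lamOf p r) M1 (by linarith : 1 ≤ R) h.sg s1 s2 s3 (by linarith) s4
    have e : Real.sqrt F ^ s = F ^ (s / 2) := by
      rw [Real.sqrt_eq_rpow, ← Real.rpow_mul (by linarith)]; congr 1; ring
    rw [e] at P
    rw [Real.sq_sqrt (by linarith)] at st
    rw [← hF]
    have L1 : 1 ≤ R / (τ - ρ) := by rw [one_le_div (by linarith)]; linarith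
    have L5 : 1 ≤ (R / (τ - ρ)) ^ 5 := one_le_pow₀ L1
    have Fs : 1 ≤ F ^ (s / 2) := Real.one_le_rpow F1 (by linarith)
    have x1 : 1 ≤ (R / (τ - ρ)) ^ 5 * F ^ (s / 2) := one_le_mul_of_one_le_of_one_le L5 Fs
    have x2 : C * R⁻¹ ≤ ε := by
      rw [div_le_iff₀ hε] at hRC
      rw [← div_eq_mul_inv, div_le_iff₀ hR0]; linarith
    have x3 : C * R⁻¹ * F ≤ ε * F := mul_le_mul_of_nonneg_right x2 (by linarith)
    have x4 : C * ((R / (τ - ρ)) ^ 5 * Psi (lOf p) (lamOf p r) (sgOf p q r α β γ) R (Real.sqrt F)) ≤ C * ((R / (τ - ρ)) ^ 5 * (7 * F ^ (s / 2))) :=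
      mul_le_mul_of_nonneg_left (mul_le_mul_of_nonneg_left P (by linarith)) hC
    calc _ ≤ C * ((R / (τ - ρ)) ^ 5 * (7 * F ^ (s / 2))) + C * R⁻¹ * F + (R / (τ - ρ)) ^ 5 * F ^ (s / 2) := by linarith
      _ ≤ _ := by linarith


lemma tail_zero {f : R3 → ℝ} (hf : Continuous f) (h0 : ∀ x, 0 ≤ f x) {B : ℝ} (hB : ∀ ρ, ∫ x in ball (0:R3) ρ, f x ≤ B) :
    Tendsto (fun R => ∫ x in sh R (2 * R), f x) atTop (nhds 0) := by
  obtain ⟨H, hH⟩ : ∃ H : ℝ → ℝ, H = fun ρ => ∫ x in ball (0:R3) ρ, f x := ⟨_, rfl⟩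
  have hm : Monotone H := by
    intro a b hab
    rw [hH]
    exact setIntegral_mono_set (integrableOn_cont hf isBounded_ball) 
      (Eventually.of_forall h0) (ball_subset_ball hab).eventuallyLE
  have hb : BddAbove (Set.range H) := ⟨B, by rintro _ ⟨ρ, rfl⟩; rw [hH]; exact hB ρ⟩
  have t := tendsto_atTop_ciSup hm hb
  have t2 : Tendsto (fun R => H (2 * R)) atTop (nhds (⨆ i, H i)) := t.comp (tendsto_id.const_mul_atTop (by norm_num : (0:ℝ) < 2))
  have t3 := t2.sub t
  rw [sub_self] at t3
  refine t3.congr' ?_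
  filter_upwards [eventually_ge_atTop 0] with R hR
  have := setIntegral_sdiff (μ := volume) (f := f) (measurableSet_ball (x := (0:R3)) (ε := R)) (integrableOn_cont hf (isBounded_ball (x := (0:R3)) (r := 2 * R))) (ball_subset_ball (by linarith))
  rw [hH]
  exact this.symm

lemma lp_tail {f : R3 → ℝ} (hf : Continuous f) {B : ℝ} (hB : ∀ ρ, lpS f 6 (ball (0:R3) ρ) ^ 2 ≤ B) :
    Tendsto (fun R => lpS f 6 (sh R (2 * R))) atTop (nhds 0) := by
  have h1 : ∀ ρ, ∫ x in ball (0:R3) ρ, |f x| ^ (6:ℝ) ≤ B ^ 3 := by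
    intro ρ
    rw [← lpS_rpow (by norm_num)]
    have := pow_le_pow_left₀ (sq_nonneg _) (hB ρ) 3
    refine le_trans (le_of_eq ?_) this
    rw [← pow_mul]; norm_cast
  have := tail_zero (cont_abs_rpow hf (by norm_num : (0:ℝ) ≤ 6)) (fun x => by positivity) h1
  have t := this.rpow_const (p := 1 / 6) (Or.inr (by norm_num))
  rw [Real.zero_rpow (by norm_num)] at t
  exact t

lemma ff_zero {u v : R3 → R3} {pr θ : R3 → ℝ} {p q r α β γ K0 : ℝ} (hu : ContDiff ℝ (⊤ : ℕ∞) u) (hv : ContDiff ℝ (⊤ : ℕ∞) v)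
    (hpr : ContDiff ℝ (⊤ : ℕ∞) pr) (hθ : ContDiff ℝ (⊤ : ℕ∞) θ) (hsol : TCM u v pr θ) (h : PR p q r α β γ) (hK0 : 1 ≤ K0) 
    (hfr : ∃ᶠ R in atTop, Good u v θ p q r α β γ K0 R) (ρ : ℝ) : ff u v θ ρ = 0 := by
  obtain ⟨C, hC, hst⟩ := step hu hv hpr hθ hsol h hK0
  obtain ⟨B, hB⟩ := bounded hu hv hpr hθ hsol h hK0 hfr
  obtain ⟨l0, l1⟩ := h.l01
  obtain ⟨m0, m1⟩ := h.lam01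
  have hσ := h.sg
  have n0 := ff_parts u v θ
  have n1 := fun ρ => sq_nonneg (lpS (fun x => ‖u x‖) 6 (ball 0 ρ))
  have n2 := fun ρ => sq_nonneg (lpS (fun x => ‖v x‖) 6 (ball 0 ρ))
  have n3 := fun ρ => sq_nonneg (lpS θ 6 (ball 0 ρ))
  have hB' : ∀ ρ, (∫ x in ball 0 ρ, grads u v θ x) + lpS (fun x => ‖u x‖) 6 (ball 0 ρ) ^ 2
      + lpS (fun x => ‖v x‖) 6 (ball 0 ρ) ^ 2 + lpS θ 6 (ball 0 ρ) ^ 2 ≤ B := hB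
  have t0 := tail_zero (grads_cont hu hv hθ) (grads_nonneg u v θ) (B := B) (fun ρ => by linarith [n0 ρ, n1 ρ, n2 ρ, n3 ρ, hB' ρ])
  have t1 := lp_tail hu.continuous.norm (B := B) (fun ρ => by linarith [n0 ρ, n1 ρ, n2 ρ, n3 ρ, hB' ρ])
  have t2 := lp_tail hv.continuous.norm (B := B) (fun ρ => by linarith [n0 ρ, n1 ρ, n2 ρ, n3 ρ, hB' ρ])
  have t3 := lp_tail hθ.continuous (B := B) (fun ρ => by linarith [n0 ρ, n1 ρ, n2 ρ, n3 ρ, hB' ρ])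
  obtain ⟨M, hM⟩ : ∃ M : ℝ → ℝ, M = fun R => Real.sqrt (∫ x in sh R (2 * R), grads u v θ x) + lpS (fun x => ‖u x‖) 6 (sh R (2 * R))
    + lpS (fun x => ‖v x‖) 6 (sh R (2 * R)) + lpS θ 6 (sh R (2 * R)) + R⁻¹ := ⟨_, rfl⟩
  have tM : Tendsto M atTop (nhds 0) := by
    have := (((t0.sqrt.add t1).add t2).add t3).add (tendsto_inv_atTop_zero (𝕜 := ℝ))
    simp only [Real.sqrt_zero, add_zero] at this
    rw [hM]; exact this
  have tp : ∀ {a : ℝ}, 0 < a → Tendsto (fun R => M R ^ a) atTop (nhds 0) := by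
    intro a ha
    have := tM.rpow_const (p := a) (Or.inr ha.le)
    rwa [Real.zero_rpow ha.ne'] at this
  have tPsi : Tendsto (fun R => Psi (lOf p) (lamOf p r) (sgOf p q r α β γ) R (M R)) atTop (nhds 0) := by
    have := ((((((tp (show 0 < 1 + lOf p by linarith)).add (tp (show 0 < 3 * lOf p by linarith))).add tM).add (tp (show (0:ℝ) < 3 / 2 by norm_num))).add
      (tp (show 0 < 2 * lOf p by linarith))).add (tp (show 0 < 2 * lamOf p r by linarith))).add (tendsto_rpow_neg_atTop (show 0 < sgOf p q r α β γ / 2 by linarith))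
    simp only [add_zero] at this
    exact this
  have tfin : Tendsto (fun R => C * (4 ^ 5 * Psi (lOf p) (lamOf p r) (sgOf p q r α β γ) R (M R) + R⁻¹ * M R ^ 2)) atTop (nhds 0) := by
    have := ((tPsi.const_mul (4 ^ 5)).add ((tendsto_inv_atTop_zero (𝕜 := ℝ)).mul (tM.pow 2))).const_mul C
    simpa using this
  apply le_antisymm _ (ff_nonneg u v θ ρ)
  apply le_of_forall_pos_le_add
  intro ε hε
  rw [zero_add]
  obtain ⟨R, hGd, hRρ, hRe⟩ := (hfr.and_eventually ((eventually_ge_atTop ρ).and (tfin.eventually_lt_const hε))).exists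
  have hR4 := hGd.hR
  have hR0 : 0 < R := by linarith
  have i0 := Real.sqrt_nonneg (∫ x in sh R (2 * R), grads u v θ x)
  have i1 := lpS_nonneg (fun x => ‖u x‖) 6 (sh R (2 * R))
  have i2 := lpS_nonneg (fun x => ‖v x‖) 6 (sh R (2 * R))
  have i3 := lpS_nonneg θ 6 (sh R (2 * R))
  have i4 : 0 < R⁻¹ := by positivity
  have hMR : M R = Real.sqrt (∫ x in sh R (2 * R), grads u v θ x) + lpS (fun x => ‖u x‖) 6 (sh R (2 * R))
    + lpS (fun x => ‖v x‖) 6 (sh R (2 * R)) + lpS θ 6 (sh R (2 * R)) + R⁻¹ := by rw [hM]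
  have st := hst R (7 * R / 4) (2 * R) (M R) hGd le_rfl (by linarith) le_rfl (by linarith)
    (by
      refine (Real.sqrt_le_left (by linarith)).1 ?_
      linarith) (by linarith) (by linarith) (by linarith)
  have e : R / (2 * R - 7 * R / 4) = 4 := by
    have : 2 * R - 7 * R / 4 = R / 4 := by ring
    rw [this]; field_simp
  rw [e] at st
  have := ff_mono hu hv hθ (show ρ ≤ 7 * R / 4 by linarith)
  linarith

lemma lp_zero {f : R3 → ℝ} (hf : Continuous f) (h : ∀ ρ, lpS f 6 (ball (0:R3) ρ) = 0) (x : R3) : f x = 0 := by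
  obtain ⟨ρ, hρ⟩ : ∃ ρ, ρ = ‖x‖ + 1 := ⟨_, rfl⟩
  have h1 := lpS_rpow (f := f) (p := 6) (by norm_num) (ball (0:R3) ρ)
  rw [h ρ, Real.zero_rpow (by norm_num)] at h1
  have h2 := (setIntegral_eq_zero_iff_of_nonneg_ae (Eventually.of_forall fun x => Real.rpow_nonneg (abs_nonneg _) _) 
    (integrableOn_cont (cont_abs_rpow hf (by norm_num : (0:ℝ) ≤ 6)) (isBounded_ball (x := (0:R3)) (r := ρ)))).1 h1.symm
  have h3 := Measure.eqOn_open_of_ae_eq h2 isOpen_ball (cont_abs_rpow hf (by norm_num : (0:ℝ) ≤ 6)).continuousOn continuousOn_const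
  have h4 := h3 (show x ∈ ball (0:R3) ρ by simp [hρ])
  simp only [Pi.zero_apply] at h4
  rw [Real.rpow_eq_zero (abs_nonneg _) (by norm_num)] at h4
  exact abs_eq_zero.1 h4


theorem liouville_tcm_A17 (u v : R3 → R3) (pr θ : R3 → ℝ)
    (hu : ContDiff ℝ (⊤ : ℕ∞) u) (hv : ContDiff ℝ (⊤ : ℕ∞) v)
    (hpr : ContDiff ℝ (⊤ : ℕ∞) pr) (hθ : ContDiff ℝ (⊤ : ℕ∞) θ)
    (hsol : TCM u v pr θ)
    (p q r α β γ : ℝ)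
    (hp1 : 3 / 2 < p) (hp2 : p < 3)
    (hq1 : 2 * (p / (p - 1)) ≤ q) (hq2 : q ≤ 6)
    (hr1 : 2 ≤ r) (hr2 : r < 2 * (p / (p - 1)))
    (hα1 : 0 ≤ α) (hα2 : α ≤ 2 / p - 1 / 3)
    (hβ1 : 0 ≤ β) (hβ2 : β ≤ 3 / q - 1 / 2)
    (hγ1 : 0 ≤ γ) (hγ2 : γ ≤ 3 / r - 1 / 2)
    (hc1 : α + 2 * β < 3 / p + 6 / q - 2)
    (hc2 : α + ((4 * p - 6) * r / ((6 - r) * p)) * γ ≤ 1)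
    (hc3 : β + γ < 3 / q + 3 / r - 2)
    (hliminf : ∃ C : ℝ, ∃ᶠ R in (atTop : Filter ℝ),
      XnV u α p R + XnV v β q R + XnS θ γ r R ≤ C) :
    (∀ x, u x = 0) ∧ (∀ x, v x = 0) ∧ (∀ x, θ x = 0) := by
  have h : PR p q r α β γ := ⟨hp1, hp2, hq1, hq2, hr1, hr2, hα1, hα2, hβ1, hβ2, hγ1, hγ2, hc1, hc2, hc3⟩
  obtain ⟨C, hC⟩ := hliminf
  have hfr : ∃ᶠ R in atTop, Good u v θ p q r α β γ (max C 1) R := by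
    refine (hC.and_eventually (eventually_ge_atTop 4)).mono ?_
    rintro R ⟨hR, h4⟩
    have R0 : 0 < R := by linarith
    have key : ∀ {a L : ℝ}, R ^ (-a) * L ≤ C → L ≤ max C 1 * R ^ a := by
      intro a L hL
      have w : 0 < R ^ a := by positivity
      rw [Real.rpow_neg R0.le, inv_mul_le_iff₀ w] at hL
      have := mul_le_mul_of_nonneg_right (le_max_left C 1) w.le
      linarith
    have nn : ∀ (f : R3 → ℝ) (a s : ℝ), 0 ≤ R ^ (-a) * lpS f s (annulus R) := fun f a s => mul_nonneg (by positivity) (lpS_nonneg _ _ _)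
    have n1 := nn (fun x => ‖u x‖) α p
    have n2 := nn (fun x => ‖v x‖) β q
    have n3 := nn θ γ r
    unfold XnV XnS at hR
    exact ⟨h4, key (by linarith), key (by linarith), key (by linarith)⟩
  have z := ff_zero hu hv hpr hθ hsol h (le_max_right C 1) hfr
  have parts : ∀ ρ, lpS (fun x => ‖u x‖) 6 (ball 0 ρ) = 0 ∧ lpS (fun x => ‖v x‖) 6 (ball 0 ρ) = 0 ∧ lpS θ 6 (ball 0 ρ) = 0 := by
    intro ρ
    have zr := z ρ
    unfold ff at zr
    have n0 := ff_parts u v θ ρ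
    have n1 := sq_nonneg (lpS (fun x => ‖u x‖) 6 (ball 0 ρ))
    have n2 := sq_nonneg (lpS (fun x => ‖v x‖) 6 (ball 0 ρ))
    have n3 := sq_nonneg (lpS θ 6 (ball 0 ρ))
    refine ⟨?_, ?_, ?_⟩ <;> refine pow_eq_zero_iff (n := 2) (by norm_num) |>.1 ?_ <;> linarith
  refine ⟨fun x => ?_, fun x => ?_, fun x => ?_⟩
  · exact norm_eq_zero.1 (lp_zero hu.continuous.norm (fun ρ => (parts ρ).1) x)
  · exact norm_eq_zero.1 (lp_zero hv.continuous.norm (fun ρ => (parts ρ).2.1) x)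
  · exact lp_zero hθ.continuous (fun ρ => (parts ρ).2.2) x
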